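/- Let 1 ≤ N ≤ 3 and Ω ⊂ ℝ^N a smoothly bounded domain. For every Λ > 0 there is a constant C = C(Ω, Λ) such that every stable classical solution (u, v) of the Gelfand system with parameters λ, μ ∈ (0, Λ] satisfying λ/μ + μ/λ ≤ Λ obeys sup_Ω u + sup_Ω v ≤ C. Consequently, for 1 ≤ N ≤ 3 extremal solutions of the Gelfand system are smooth. -/

import Mathlib

open MeasureTheory Real
open scoped RealInnerProductSpace

/-- The Laplacian of `u : ℝ^N → ℝ`, computed as the sum of second derivatives
along the standard basis directions. -/
noncomputable def lap {N : ℕ} (u : EuclideanSpace ℝ (Fin N) → ℝ)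
    (x : EuclideanSpace ℝ (Fin N)) : ℝ :=
  ∑ i : Fin N,
    fderiv ℝ (fun y => fderiv ℝ u y (EuclideanSpace.single i 1)) x (EuclideanSpace.single i 1)

/-- A (smoothly bounded) domain: a nonempty bounded open connected subset of `ℝ^N`. -/
def IsBoundedDomain {N : ℕ} (Ω : Set (EuclideanSpace ℝ (Fin N))) : Prop :=
  IsOpen Ω ∧ IsConnected Ω ∧ Bornology.IsBounded Ω

/-- `(u, v)` is a classical solution of the Gelfand system
`-Δu = μ e^v`, `-Δv = λ e^u` in `Ω`, `u = v = 0` on `∂Ω`. -/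
def IsGelfandSolution {N : ℕ} (Ω : Set (EuclideanSpace ℝ (Fin N))) (lam mu : ℝ)
    (u v : EuclideanSpace ℝ (Fin N) → ℝ) : Prop :=
  ContDiffOn ℝ 2 u (closure Ω) ∧ ContDiffOn ℝ 2 v (closure Ω) ∧
  (∀ x ∈ Ω, -lap u x = mu * exp (v x)) ∧
  (∀ x ∈ Ω, -lap v x = lam * exp (u x)) ∧
  (∀ x ∈ frontier Ω, u x = 0) ∧ (∀ x ∈ frontier Ω, v x = 0)

/-- `(u, v)` is a stable classical solution of the Gelfand system: there exist `λ₁ ≥ 0` and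
positive eigenfunctions `φ₁, ψ₁ ∈ C²(Ω̄)` of the linearized system, vanishing on `∂Ω`. -/
def IsStableGelfandSolution {N : ℕ} (Ω : Set (EuclideanSpace ℝ (Fin N))) (lam mu : ℝ)
    (u v : EuclideanSpace ℝ (Fin N) → ℝ) : Prop :=
  IsGelfandSolution Ω lam mu u v ∧
  ∃ (lam1 : ℝ) (φ₁ ψ₁ : EuclideanSpace ℝ (Fin N) → ℝ),
    0 ≤ lam1 ∧
    ContDiffOn ℝ 2 φ₁ (closure Ω) ∧ ContDiffOn ℝ 2 ψ₁ (closure Ω) ∧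
    (∀ x ∈ Ω, 0 < φ₁ x) ∧ (∀ x ∈ Ω, 0 < ψ₁ x) ∧
    (∀ x ∈ Ω, -lap φ₁ x - mu * exp (v x) * ψ₁ x = lam1 * φ₁ x) ∧
    (∀ x ∈ Ω, -lap ψ₁ x - lam * exp (u x) * φ₁ x = lam1 * ψ₁ x) ∧
    (∀ x ∈ frontier Ω, φ₁ x = 0) ∧ (∀ x ∈ frontier Ω, ψ₁ x = 0)

/-! ### Coordinate derivatives -/

section Calc
open Filter Topology

variable {N : ℕ}

noncomputable def pd (i : Fin N) (u : EuclideanSpace ℝ (Fin N) → ℝ)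
    (x : EuclideanSpace ℝ (Fin N)) : ℝ :=
  fderiv ℝ u x (EuclideanSpace.single i 1)

lemma lap_eq (u : EuclideanSpace ℝ (Fin N) → ℝ) (x : EuclideanSpace ℝ (Fin N)) :
    lap u x = ∑ i, pd i (pd i u) x := rfl

variable {u v w : EuclideanSpace ℝ (Fin N) → ℝ} {x : EuclideanSpace ℝ (Fin N)} {i : Fin N}

lemma pd_congr (h : u =ᶠ[𝓝 x] v) : pd i u x = pd i v x := by
  unfold pd; rw [h.fderiv_eq]

lemma pd_eventuallyEq (h : u =ᶠ[𝓝 x] v) : pd i u =ᶠ[𝓝 x] pd i v := by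
  filter_upwards [h.eventually_nhds] with y hy using pd_congr hy

lemma lap_congr (h : u =ᶠ[𝓝 x] v) : lap u x = lap v x := by
  simp only [lap_eq]
  exact Finset.sum_congr rfl fun i _ => pd_congr (pd_eventuallyEq h)

lemma ContDiffAt.pd' {m n : WithTop ℕ∞} (h : ContDiffAt ℝ n u x) (hmn : m + 1 ≤ n) :
    ContDiffAt ℝ m (pd i u) x :=
  (h.fderiv_right hmn).clm_apply contDiffAt_const

lemma ContDiffAt.pd1 (h : ContDiffAt ℝ 2 u x) : ContDiffAt ℝ 1 (pd i u) x :=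
  h.pd' (by norm_num)

lemma ContDiffAt.pd_diff (h : ContDiffAt ℝ 2 u x) : DifferentiableAt ℝ (pd i u) x :=
  h.pd1.differentiableAt (by norm_num)

lemma ContDiffAt.diff2 (h : ContDiffAt ℝ 2 u x) : DifferentiableAt ℝ u x :=
  h.differentiableAt (by norm_num)

lemma ContDiffAt.ev_diff (h : ContDiffAt ℝ 2 u x) : ∀ᶠ y in 𝓝 x, DifferentiableAt ℝ u y := by
  filter_upwards [h.eventually (by simp)] with y hy using hy.diff2

lemma pd_add (hu : DifferentiableAt ℝ u x) (hv : DifferentiableAt ℝ v x) :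
    pd i (fun y => u y + v y) x = pd i u x + pd i v x := by
  unfold pd; rw [fderiv_fun_add hu hv]; rfl

lemma pd_sub (hu : DifferentiableAt ℝ u x) (hv : DifferentiableAt ℝ v x) :
    pd i (fun y => u y - v y) x = pd i u x - pd i v x := by
  unfold pd; rw [fderiv_fun_sub hu hv]; rfl

lemma pd_neg : pd i (fun y => - u y) x = - pd i u x := by
  unfold pd; rw [fderiv_fun_neg]; rfl

lemma pd_mul (hu : DifferentiableAt ℝ u x) (hv : DifferentiableAt ℝ v x) :
    pd i (fun y => u y * v y) x = u x * pd i v x + v x * pd i u x := by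
  unfold pd; rw [fderiv_fun_mul hu hv]; simp

lemma pd_const_mul (c : ℝ) (hu : DifferentiableAt ℝ u x) :
    pd i (fun y => c * u y) x = c * pd i u x := by
  unfold pd; rw [fderiv_const_mul hu]; simp

lemma pd_const (c : ℝ) : pd i (fun _ => c) x = 0 := by
  unfold pd; simp

lemma pd_comp {g : ℝ → ℝ} {g' : ℝ} (hg : HasDerivAt g g' (u x)) (hu : DifferentiableAt ℝ u x) :
    pd i (fun y => g (u y)) x = g' * pd i u x := by
  unfold pd
  have := hg.comp_hasFDerivAt x hu.hasFDerivAt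
  rw [show (fun y => g (u y)) = g ∘ u from rfl, this.fderiv]; simp

lemma pd_coord (j : Fin N) : pd i (fun y : EuclideanSpace ℝ (Fin N) => y j) x
    = if i = j then 1 else 0 := by
  unfold pd
  have : HasFDerivAt (fun y : EuclideanSpace ℝ (Fin N) => y j)
    (EuclideanSpace.proj j : EuclideanSpace ℝ (Fin N) →L[ℝ] ℝ) x :=
    (EuclideanSpace.proj j : EuclideanSpace ℝ (Fin N) →L[ℝ] ℝ).hasFDerivAt
  rw [this.fderiv]
  simp [eq_comm]

lemma lap_add (hu : ContDiffAt ℝ 2 u x) (hv : ContDiffAt ℝ 2 v x) :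
    lap (fun y => u y + v y) x = lap u x + lap v x := by
  simp only [lap_eq, ← Finset.sum_add_distrib]
  refine Finset.sum_congr rfl fun i _ => ?_
  rw [← pd_add hu.pd_diff hv.pd_diff]
  apply pd_congr
  filter_upwards [hu.ev_diff, hv.ev_diff] with y h1 h2 using pd_add h1 h2

lemma lap_sub (hu : ContDiffAt ℝ 2 u x) (hv : ContDiffAt ℝ 2 v x) :
    lap (fun y => u y - v y) x = lap u x - lap v x := by
  simp only [lap_eq, ← Finset.sum_sub_distrib]
  refine Finset.sum_congr rfl fun i _ => ?_
  rw [← pd_sub hu.pd_diff hv.pd_diff]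
  apply pd_congr
  filter_upwards [hu.ev_diff, hv.ev_diff] with y h1 h2 using pd_sub h1 h2

lemma lap_const_mul (c : ℝ) (hu : ContDiffAt ℝ 2 u x) :
    lap (fun y => c * u y) x = c * lap u x := by
  simp only [lap_eq, Finset.mul_sum]
  refine Finset.sum_congr rfl fun i _ => ?_
  rw [← pd_const_mul c hu.pd_diff]
  apply pd_congr
  filter_upwards [hu.ev_diff] with y h1 using pd_const_mul c h1

lemma lap_neg : lap (fun y => - u y) x = - lap u x := by
  simp only [lap_eq, ← Finset.sum_neg_distrib]
  refine Finset.sum_congr rfl fun i _ => ?_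
  rw [← pd_neg]
  apply pd_congr
  filter_upwards with y using pd_neg

lemma lap_const (c : ℝ) : lap (fun _ => c) x = 0 := by
  simp only [lap_eq]
  refine Finset.sum_eq_zero fun i _ => ?_
  rw [← pd_const (i := i) (x := x) 0]
  apply pd_congr
  filter_upwards with y using pd_const c

lemma lap_mul (hu : ContDiffAt ℝ 2 u x) (hv : ContDiffAt ℝ 2 v x) :
    lap (fun y => u y * v y) x
      = u x * lap v x + v x * lap u x + 2 * ∑ i, pd i u x * pd i v x := by
  simp only [lap_eq, Finset.mul_sum, ← Finset.sum_add_distrib]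
  refine Finset.sum_congr rfl fun i _ => ?_
  have : pd i (pd i fun y => u y * v y) x
      = pd i (fun y => u y * pd i v y + v y * pd i u y) x := by
    apply pd_congr
    filter_upwards [hu.ev_diff, hv.ev_diff] with y h1 h2 using pd_mul h1 h2
  rw [this, pd_add (hu.diff2.fun_mul hv.pd_diff) (hv.diff2.fun_mul hu.pd_diff),
    pd_mul hu.diff2 hv.pd_diff, pd_mul hv.diff2 hu.pd_diff]
  ring

lemma lap_comp {g g' : ℝ → ℝ} {g'' : ℝ} (hg : ∀ t, HasDerivAt g (g' t) t)
    (hg' : HasDerivAt g' g'' (u x)) (hu : ContDiffAt ℝ 2 u x) :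
    lap (fun y => g (u y)) x = g' (u x) * lap u x + g'' * ∑ i, pd i u x ^ 2 := by
  simp only [lap_eq, Finset.mul_sum, ← Finset.sum_add_distrib]
  refine Finset.sum_congr rfl fun i _ => ?_
  have : pd i (pd i fun y => g (u y)) x
      = pd i (fun y => g' (u y) * pd i u y) x := by
    apply pd_congr
    filter_upwards [hu.ev_diff] with y h1 using pd_comp (hg _) h1
  rw [this, pd_mul (DifferentiableAt.fun_comp' x hg'.differentiableAt hu.diff2) hu.pd_diff, pd_comp hg' hu.diff2]
  ring

lemma lap_sum {ι : Type*} (s : Finset ι) (F : ι → EuclideanSpace ℝ (Fin N) → ℝ)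
    (h : ∀ j ∈ s, ContDiffAt ℝ 2 (F j) x) :
    lap (fun y => ∑ j ∈ s, F j y) x = ∑ j ∈ s, lap (F j) x := by
  classical
  induction s using Finset.induction_on with
  | empty => simpa using lap_const 0
  | insert a s ha ih =>
    simp only [Finset.sum_insert ha]
    rw [lap_add (h a (Finset.mem_insert_self _ _))
      (ContDiffAt.sum fun j hj => h j (Finset.mem_insert_of_mem hj)),
      ih fun j hj => h j (Finset.mem_insert_of_mem hj)]

lemma contDiff_coord {n : WithTop ℕ∞} (j : Fin N) :
    ContDiff ℝ n (fun y : EuclideanSpace ℝ (Fin N) => y j) :=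
  (EuclideanSpace.proj j : EuclideanSpace ℝ (Fin N) →L[ℝ] ℝ).contDiff

lemma pd_normsq (c : EuclideanSpace ℝ (Fin N)) :
    pd i (fun y => ‖y - c‖ ^ 2) x = 2 * (x i - c i) := by
  have h : (fun y : EuclideanSpace ℝ (Fin N) => ‖y - c‖ ^ 2) = fun y => ∑ j, (y j - c j) ^ 2 := by
    funext y; rw [EuclideanSpace.norm_sq_eq]; simp
  rw [h]; unfold pd
  have : HasFDerivAt (fun y : EuclideanSpace ℝ (Fin N) => ∑ j, (y j - c j) ^ 2)
      (∑ j, (2 * (x j - c j)) • (EuclideanSpace.proj j : EuclideanSpace ℝ (Fin N) →L[ℝ] ℝ)) x := by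
    apply HasFDerivAt.fun_sum
    intro j _
    have := (((EuclideanSpace.proj j : EuclideanSpace ℝ (Fin N) →L[ℝ] ℝ).hasFDerivAt (x := x)).sub_const
      (c j)).pow 2
    simpa using this
  rw [this.fderiv]
  simp

lemma lap_normsq (c : EuclideanSpace ℝ (Fin N)) :
    lap (fun y => ‖y - c‖ ^ 2) x = 2 * N := by
  simp only [lap_eq]
  have : ∀ i, pd i (pd i fun y => ‖y - c‖ ^ 2) x = 2 := by
    intro i
    have : pd i (pd i fun y => ‖y - c‖ ^ 2) x = pd i (fun y => 2 * (y i - c i)) x := by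
      apply pd_congr; filter_upwards with y using pd_normsq c
    rw [this, pd_const_mul, pd_sub, pd_coord, pd_const]
    · simp
    · exact (contDiff_coord (n := 1) i).differentiable (by norm_num) x
    · fun_prop
    · exact ((contDiff_coord (n := 1) i).differentiable (by norm_num) x).sub_const _
  simp [this]; ring

lemma contDiff_normsq {n : WithTop ℕ∞} (c : EuclideanSpace ℝ (Fin N)) :
    ContDiff ℝ n (fun y : EuclideanSpace ℝ (Fin N) => ‖y - c‖ ^ 2) :=
  (contDiff_id.sub contDiff_const).norm_sq ℝ

/-- second derivative test -/
lemma pd_pd_nonneg_of_isLocalMin (hu : ContDiffAt ℝ 2 u x) (hm : IsLocalMin u x) :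
    0 ≤ pd i (pd i u) x := by
  by_contra hneg
  push Not at hneg
  set e : EuclideanSpace ℝ (Fin N) := EuclideanSpace.single i 1
  set γ : ℝ → EuclideanSpace ℝ (Fin N) := fun t => x + t • e with hγ
  have hγd : ∀ t, HasDerivAt γ e t := by
    intro t
    have := ((hasDerivAt_id t).smul_const e).const_add x
    rw [one_smul] at this
    exact this
  have hγ0 : γ 0 = x := by simp [hγ]
  have hγc : Tendsto γ (𝓝 0) (𝓝 x) := by
    have := (hγd 0).continuousAt.tendsto; rwa [hγ0] at this
  set g : ℝ → ℝ := fun t => u (γ t)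
  have hg1 : ∀ᶠ t in 𝓝 (0:ℝ), HasDerivAt g (pd i u (γ t)) t := by
    filter_upwards [hγc.eventually hu.ev_diff] with t ht
    exact ht.hasFDerivAt.comp_hasDerivAt t (hγd t)
  have hd : deriv g =ᶠ[𝓝 0] fun t => pd i u (γ t) := by
    filter_upwards [hg1] with t ht using ht.deriv
  have hdd : deriv (deriv g) 0 = pd i (pd i u) x := by
    rw [hd.deriv_eq]
    have h1 : HasFDerivAt (pd i u) (fderiv ℝ (pd i u) x) (γ 0) := by
      rw [hγ0]; exact hu.pd_diff.hasFDerivAt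
    exact (h1.comp_hasDerivAt 0 (hγd 0)).deriv
  have hm0 : IsLocalMin g 0 := by
    have : ∀ᶠ t in 𝓝 (0:ℝ), u x ≤ u (γ t) := hγc.eventually hm
    filter_upwards [this] with t ht
    simpa [g, hγ0] using ht
  have hM := isLocalMax_of_deriv_deriv_neg (f := g) (x₀ := 0) (by rw [hdd]; exact hneg)
    hm0.deriv_eq_zero hg1.self_of_nhds.continuousAt
  have hc : g =ᶠ[𝓝 0] fun _ => g 0 := by
    filter_upwards [hm0, hM] with t h1 h2 using le_antisymm h2 h1
  have : deriv (deriv g) 0 = 0 := by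
    rw [hc.deriv.deriv_eq]; simp
  rw [hdd] at this; linarith

/-- weak minimum principle -/
lemma min_principle (hN : 0 < N) {D : Set (EuclideanSpace ℝ (Fin N))} (hD : IsOpen D)
    (hb : Bornology.IsBounded D) (hc : ContinuousOn w (closure D))
    (h2 : ∀ x ∈ D, ContDiffAt ℝ 2 w x) (hl : ∀ x ∈ D, lap w x ≤ 0)
    (hf : ∀ x ∈ frontier D, 0 ≤ w x) : ∀ x ∈ D, 0 ≤ w x := by
  intro x0 hx0
  by_contra hneg
  push Not at hneg
  obtain ⟨R, hRpos, hR⟩ : ∃ R, 0 < R ∧ ∀ y ∈ closure D, ‖y - x0‖ ^ 2 ≤ R := by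
    obtain ⟨r, hr⟩ := (hb.closure).subset_closedBall x0
    refine ⟨r ^ 2 + 1, by positivity, fun y hy => ?_⟩
    have h1 := hr hy
    rw [Metric.mem_closedBall, dist_eq_norm] at h1
    nlinarith [norm_nonneg (y - x0)]
  set ε := -w x0 / (2 * R) with hε
  have hεpos : 0 < ε := by apply div_pos <;> linarith
  set W := fun y => w y - ε * ‖y - x0‖ ^ 2 with hW
  have hcomp : IsCompact (closure D) := Metric.isCompact_of_isClosed_isBounded isClosed_closure hb.closure
  have hWc : ContinuousOn W (closure D) := by
    apply hc.sub; fun_prop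
  obtain ⟨p, hp, hmin⟩ := hcomp.exists_isMinOn ⟨x0, subset_closure hx0⟩ hWc
  have hpx : W p ≤ w x0 := by
    have := hmin (subset_closure hx0)
    simpa [hW] using this
  by_cases hpD : p ∈ D
  · have hloc : IsLocalMin W p := by
      filter_upwards [hD.mem_nhds hpD] with y hy using hmin (subset_closure hy)
    have hWd : ContDiffAt ℝ 2 W p := (h2 p hpD).sub (contDiffAt_const.mul (contDiff_normsq x0).contDiffAt)
    have h0 : 0 ≤ lap W p := by
      rw [lap_eq]; exact Finset.sum_nonneg fun i _ => pd_pd_nonneg_of_isLocalMin hWd hloc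
    rw [hW, lap_sub (h2 p hpD) (contDiffAt_const.mul (contDiff_normsq x0).contDiffAt),
      lap_const_mul _ (contDiff_normsq x0).contDiffAt, lap_normsq] at h0
    have := hl p hpD
    have hN' : (0:ℝ) < N := by exact_mod_cast hN
    have : 0 < ε * (2 * N) := by positivity
    linarith
  · have hpf : p ∈ frontier D := by
      rw [hD.frontier_eq]; exact ⟨hp, hpD⟩
    have h1 := hf p hpf
    have h3 : ε * ‖p - x0‖ ^ 2 ≤ ε * R := by gcongr; exact hR p hp
    have h4 : ε * R = -w x0 / 2 := by rw [hε]; field_simp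
    simp only [hW] at hpx
    linarith

end Calc

section GradEst
open Filter Topology

variable {N : ℕ} {u v w : EuclideanSpace ℝ (Fin N) → ℝ}

lemma deriv_nonneg_of_right {F : ℝ → ℝ} {F' : ℝ} (hF : HasDerivWithinAt F F' (Set.Ioi 0) 0)
    (h0 : F 0 = 0) (hp : ∀ᶠ t in 𝓝[>] (0:ℝ), 0 ≤ F t) : 0 ≤ F' := by
  have h1 := hasDerivWithinAt_iff_tendsto_slope.1 hF
  have hs : Set.Ioi (0:ℝ) \ {0} = Set.Ioi 0 := by ext t; simp
  rw [hs] at h1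
  refine ge_of_tendsto h1 ?_
  filter_upwards [hp, self_mem_nhdsWithin] with t ht ht0
  rw [slope_def_field, h0]
  have : (0:ℝ) < t := ht0
  apply div_nonneg <;> linarith

/-- coordinate reflection -/
noncomputable def reflS (i : Fin N) : EuclideanSpace ℝ (Fin N) →L[ℝ] EuclideanSpace ℝ (Fin N) :=
  ContinuousLinearMap.id ℝ _ -
    ((2:ℝ) • (EuclideanSpace.proj i : EuclideanSpace ℝ (Fin N) →L[ℝ] ℝ)).smulRight
      (EuclideanSpace.single i (1:ℝ))

lemma reflS_apply (i : Fin N) (y : EuclideanSpace ℝ (Fin N)) :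
    reflS i y = y - (2 * y i) • EuclideanSpace.single i (1:ℝ) := by
  simp [reflS]

lemma reflS_single (i j : Fin N) :
    reflS i (EuclideanSpace.single j (1:ℝ)) =
      (if j = i then (-1:ℝ) else 1) • EuclideanSpace.single j (1:ℝ) := by
  rw [reflS_apply]
  by_cases h : j = i
  · subst h; ext k; simp; split_ifs <;> norm_num
  · simp [h, Ne.symm h]

lemma norm_reflS (i : Fin N) (y : EuclideanSpace ℝ (Fin N)) : ‖reflS i y‖ = ‖y‖ := by
  have : ‖reflS i y‖ ^ 2 = ‖y‖ ^ 2 := by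
    rw [EuclideanSpace.norm_sq_eq, EuclideanSpace.norm_sq_eq]
    refine Finset.sum_congr rfl fun k _ => ?_
    rw [reflS_apply]
    by_cases h : k = i
    · subst h; simp; ring
    · simp [h]
  exact (sq_eq_sq₀ (norm_nonneg _) (norm_nonneg _)).1 this

lemma pd_refl (i j : Fin N) (c x : EuclideanSpace ℝ (Fin N))
    (hu : DifferentiableAt ℝ u (c + reflS i (x - c))) :
    pd j (fun y => u (c + reflS i (y - c))) x
      = (if j = i then (-1:ℝ) else 1) * pd j u (c + reflS i (x - c)) := by
  have h1 : HasFDerivAt (fun y : EuclideanSpace ℝ (Fin N) => c + reflS i (y - c)) (reflS i) x := by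
    have := (((reflS i).hasFDerivAt (x := x - c)).comp x ((hasFDerivAt_id x).sub_const c)).const_add c
    simpa using this
  have h2 := hu.hasFDerivAt.comp x h1
  unfold pd
  rw [show (fun y => u (c + reflS i (y - c))) = u ∘ fun y => c + reflS i (y - c) from rfl, h2.fderiv]
  rw [ContinuousLinearMap.comp_apply, reflS_single, map_smul, smul_eq_mul]

lemma contDiff_refl {n : WithTop ℕ∞} (i : Fin N) (c : EuclideanSpace ℝ (Fin N)) :
    ContDiff ℝ n (fun y : EuclideanSpace ℝ (Fin N) => c + reflS i (y - c)) := by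
  fun_prop

lemma lap_refl (i : Fin N) (c x : EuclideanSpace ℝ (Fin N))
    (hu : ContDiffAt ℝ 2 u (c + reflS i (x - c))) :
    lap (fun y => u (c + reflS i (y - c))) x = lap u (c + reflS i (x - c)) := by
  simp only [lap_eq]
  refine Finset.sum_congr rfl fun j _ => ?_
  have ht : Tendsto (fun y : EuclideanSpace ℝ (Fin N) => c + reflS i (y - c)) (𝓝 x)
      (𝓝 (c + reflS i (x - c))) := (contDiff_refl (n := 0) i c).continuous.tendsto x
  have h1 : pd j (pd j fun y => u (c + reflS i (y - c))) x
     = pd j (fun y => (if j = i then (-1:ℝ) else 1) * pd j u (c + reflS i (y - c))) x := by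
    apply pd_congr
    filter_upwards [ht.eventually hu.ev_diff] with y hy using pd_refl i j c y hy
  have h2 : DifferentiableAt ℝ (fun y => pd j u (c + reflS i (y - c))) x :=
    DifferentiableAt.fun_comp' x (g := pd j u) hu.pd_diff
      ((contDiff_refl (n := 1) i c).differentiable (by norm_num) x)
  rw [h1, pd_const_mul _ h2, pd_refl i j c x hu.pd_diff]
  split_ifs <;> ring

lemma grad_est (hN : 0 < N) (i : Fin N) {x0 : EuclideanSpace ℝ (Fin N)} {ρ M A : ℝ} (hρ : 0 < ρ)
    (hu : ∀ x ∈ Metric.closedBall x0 ρ, ContDiffAt ℝ 2 u x)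
    (hM : ∀ x ∈ Metric.closedBall x0 ρ, |u x| ≤ M)
    (hA : ∀ x ∈ Metric.closedBall x0 ρ, |lap u x| ≤ A) :
    |pd i u x0| ≤ N * M / ρ + A * ρ / 2 := by
  have hM0 : 0 ≤ M := (abs_nonneg _).trans (hM x0 (Metric.mem_closedBall_self hρ.le))
  have hA0 : 0 ≤ A := (abs_nonneg _).trans (hA x0 (Metric.mem_closedBall_self hρ.le))
  set σ : EuclideanSpace ℝ (Fin N) → EuclideanSpace ℝ (Fin N) := fun y => x0 + reflS i (y - x0) with hσ
  have hσb : ∀ x ∈ Metric.closedBall x0 ρ, σ x ∈ Metric.closedBall x0 ρ := by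
    intro x hx
    rw [Metric.mem_closedBall, dist_eq_norm] at hx ⊢
    have h1 : σ x - x0 = reflS i (x - x0) := by simp only [hσ, add_sub_cancel_left]
    rw [h1, norm_reflS]; exact hx
  set c' : ℝ := N * M / ρ ^ 2 + A / 2 with hc'
  have hc'0 : 0 ≤ c' := by positivity
  set c : ℝ := c' * ρ with hcc
  set D : Set (EuclideanSpace ℝ (Fin N)) := Metric.ball x0 ρ ∩ {x | x0 i < x i} with hDdef
  have hcoord : Continuous fun y : EuclideanSpace ℝ (Fin N) => y i := (contDiff_coord (n := 0) i).continuous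
  have hDo : IsOpen D := Metric.isOpen_ball.inter (isOpen_lt continuous_const hcoord)
  have hDb : Bornology.IsBounded D := Metric.isBounded_ball.subset Set.inter_subset_left
  have hDc : closure D ⊆ Metric.closedBall x0 ρ ∩ {x | x0 i ≤ x i} := by
    apply closure_minimal
    · exact fun x hx => ⟨Metric.ball_subset_closedBall hx.1, (show x0 i < x i from hx.2).le⟩
    · exact Metric.isClosed_closedBall.inter (isClosed_le continuous_const hcoord)
  have key : ∀ s : ℝ, |s| = 1 → ∀ x ∈ D, 0 ≤ (M / ρ ^ 2 * ‖x - x0‖ ^ 2 + (c * (x i - x0 i) +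
      (-c') * ((x i - x0 i) * (x i - x0 i)))) - (s / 2) * (u x - u (σ x)) := by
    intro s hs
    have h2a : ∀ x ∈ Metric.closedBall x0 ρ, ContDiffAt ℝ 2 (fun y => u (σ y)) x := by
      intro x hx
      exact (hu _ (hσb x hx)).comp x (contDiff_refl i x0).contDiffAt
    have hco : ContDiff ℝ 2 (fun y : EuclideanSpace ℝ (Fin N) => y i - x0 i) :=
      (contDiff_coord i).sub contDiff_const
    have hP : ContDiff ℝ 2 (fun x : EuclideanSpace ℝ (Fin N) => M / ρ ^ 2 * ‖x - x0‖ ^ 2 + (c * (x i - x0 i) +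
      (-c') * ((x i - x0 i) * (x i - x0 i)))) :=
      (contDiff_const.mul (contDiff_normsq x0)).add ((contDiff_const.mul hco).add
        (contDiff_const.mul (hco.mul hco)))
    have h2b : ∀ x ∈ Metric.closedBall x0 ρ, ContDiffAt ℝ 2 (fun x => (M / ρ ^ 2 * ‖x - x0‖ ^ 2 + (c * (x i - x0 i) +
      (-c') * ((x i - x0 i) * (x i - x0 i)))) - (s / 2) * (u x - u (σ x))) x := fun x hx =>
      hP.contDiffAt.sub (contDiffAt_const.mul ((hu x hx).sub (h2a x hx)))
    apply min_principle hN hDo hDb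
    · intro x hx
      exact (h2b x (hDc hx).1).continuousAt.continuousWithinAt
    · exact fun x hx => h2b x (Metric.ball_subset_closedBall hx.1)
    · intro x hx
      have hxb : x ∈ Metric.closedBall x0 ρ := Metric.ball_subset_closedBall hx.1
      have hlc : lap (fun y : EuclideanSpace ℝ (Fin N) => y i - x0 i) x = 0 := by
        rw [lap_sub (contDiff_coord i).contDiffAt contDiffAt_const, lap_const, sub_zero, lap_eq]
        refine Finset.sum_eq_zero fun j _ => ?_
        rw [← pd_const (i := j) (x := x) (if j = i then 1 else 0)]
        apply pd_congr
        filter_upwards with y using pd_coord i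
      have hpc : ∀ j, pd j (fun y : EuclideanSpace ℝ (Fin N) => y i - x0 i) x = if j = i then 1 else 0 := by
        intro j
        rw [pd_sub ((contDiff_coord (n := 1) i).differentiable (by norm_num) x) (by fun_prop), pd_coord,
          pd_const, sub_zero]
      rw [lap_sub hP.contDiffAt (contDiffAt_const.mul ((hu x hxb).sub (h2a x hxb))),
        lap_add (contDiff_const.mul (contDiff_normsq x0)).contDiffAt
          ((contDiff_const.mul hco).add (contDiff_const.mul (hco.mul hco))).contDiffAt,
        lap_const_mul _ (contDiff_normsq x0).contDiffAt, lap_normsq,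
        lap_add (contDiff_const.mul hco).contDiffAt (contDiff_const.mul (hco.mul hco)).contDiffAt,
        lap_const_mul _ hco.contDiffAt, lap_const_mul _ (hco.mul hco).contDiffAt,
        lap_mul hco.contDiffAt hco.contDiffAt, hlc,
        lap_const_mul _ ((hu x hxb).sub (h2a x hxb)), lap_sub (hu x hxb) (h2a x hxb),
        lap_refl i x0 x (hu _ (hσb x hxb))]
      simp only [hpc]
      have hsum : ∑ j : Fin N, ((if j = i then (1:ℝ) else 0) * if j = i then 1 else 0) = 1 := by
        simp
      rw [hsum]
      have h3 := hA x hxb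
      have h4 := hA _ (hσb x hxb)
      have h5 : |s / 2 * (lap u x - lap u (σ x))| ≤ A := by
        rw [abs_mul, abs_div, hs, abs_two]
        have := abs_sub (lap u x) (lap u (σ x))
        linarith
      have h6 := neg_abs_le (s / 2 * (lap u x - lap u (σ x)))
      have h7 : c' * 2 = M / ρ ^ 2 * (2 * N) + A := by rw [hc']; ring
      simp only [hσ] at h5 h6 ⊢
      linarith
    · intro x hx
      have hxc := hDc (frontier_subset_closure hx)
      have hxD : x ∉ D := by rw [hDo.frontier_eq] at hx; exact hx.2
      have ht : 0 ≤ x i - x0 i := sub_nonneg.2 hxc.2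
      have hnorm : ‖x - x0‖ ≤ ρ := by simpa [dist_eq_norm] using hxc.1
      have hti : x i - x0 i ≤ ‖x - x0‖ := by
        have := EuclideanSpace.norm_sq_eq (x - x0)
        have h8 : (x i - x0 i) ^ 2 ≤ ‖x - x0‖ ^ 2 := by
          rw [this]
          have := Finset.single_le_sum (f := fun j => ‖(x - x0) j‖ ^ 2) (fun j _ => by positivity)
            (Finset.mem_univ i)
          simpa using this
        exact le_of_abs_le (abs_le_of_sq_le_sq h8 (norm_nonneg _))
      have hq : 0 ≤ c * (x i - x0 i) + (-c') * ((x i - x0 i) * (x i - x0 i)) := by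
        have : 0 ≤ c' * (x i - x0 i) * (ρ - (x i - x0 i)) :=
          mul_nonneg (mul_nonneg hc'0 ht) (by linarith)
        rw [hcc]; linarith
      by_cases hlt : x0 i < x i
      · have hge : ρ ≤ ‖x - x0‖ := by
          by_contra hcon
          push Not at hcon
          exact hxD ⟨by simpa [dist_eq_norm] using hcon, hlt⟩
        have heq : ‖x - x0‖ = ρ := le_antisymm hnorm hge
        have h1 : M / ρ ^ 2 * ‖x - x0‖ ^ 2 = M := by rw [heq]; field_simp
        have h5 : |s / 2 * (u x - u (σ x))| ≤ M := by
          rw [abs_mul, abs_div, hs, abs_two]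
          have := abs_sub (u x) (u (σ x))
          linarith [hM x hxc.1, hM _ (hσb x hxc.1)]
        have h6 := le_abs_self (s / 2 * (u x - u (σ x)))
        rw [h1]; linarith
      · have heq : x i = x0 i := le_antisymm (not_lt.1 hlt) hxc.2
        have : σ x = x := by
          simp [hσ, reflS_apply, heq]
        rw [this]
        have : 0 ≤ M / ρ ^ 2 * ‖x - x0‖ ^ 2 := by positivity
        simp only [sub_self, mul_zero, sub_zero]
        linarith
  -- derivative at zero
  have hgoal : N * M / ρ + A * ρ / 2 = c := by rw [hcc, hc']; field_simp
  rw [hgoal]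
  set e : EuclideanSpace ℝ (Fin N) := EuclideanSpace.single i 1 with he
  have hdu : DifferentiableAt ℝ u x0 := (hu x0 (Metric.mem_closedBall_self hρ.le)).diff2
  have hline : ∀ b : ℝ, HasDerivAt (fun t : ℝ => u (x0 + t • (b • e))) (b * pd i u x0) 0 := by
    intro b
    have h1 : HasDerivAt (fun t : ℝ => x0 + t • (b • e)) (b • e) 0 := by
      have := ((hasDerivAt_id (0:ℝ)).smul_const (b • e)).const_add x0
      rw [one_smul] at this; exact this
    have h2 : HasFDerivAt u (fderiv ℝ u x0) (x0 + (0:ℝ) • (b • e)) := by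
      simpa using hdu.hasFDerivAt
    have := h2.comp_hasDerivAt 0 h1
    rw [map_smul, smul_eq_mul] at this
    exact this
  have hfin : ∀ s : ℝ, |s| = 1 → 0 ≤ c - s * pd i u x0 := by
    intro s hs
    have hF : HasDerivAt (fun t : ℝ => (M / ρ ^ 2 * t ^ 2 + (c * t + (-c') * (t * t)))
        - (s / 2) * (u (x0 + t • ((1:ℝ) • e)) - u (x0 + t • ((-1:ℝ) • e)))) (c - s * pd i u x0) 0 := by
      have h1 := (((hasDerivAt_pow 2 (0:ℝ)).const_mul (M / ρ ^ 2)).add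
        (((hasDerivAt_id (0:ℝ)).const_mul c).add (((hasDerivAt_id (0:ℝ)).mul (hasDerivAt_id (0:ℝ))).const_mul (-c')))).sub
        (((hline 1).sub (hline (-1))).const_mul (s / 2))
      refine HasDerivAt.congr_deriv h1 ?_
      simp only [id]; ring_nf
    refine deriv_nonneg_of_right hF.hasDerivWithinAt (by simp) ?_
    filter_upwards [Ioo_mem_nhdsGT hρ] with t ht
    have hx : x0 + t • e ∈ D := by
      constructor
      · simp [he, norm_smul, abs_of_pos ht.1, ht.2]
      · simp [he, ht.1]
    have hk := key s hs _ hx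
    have h1 : σ (x0 + t • e) = x0 + t • ((-1:ℝ) • e) := by
      show x0 + reflS i (x0 + t • e - x0) = _
      rw [add_sub_cancel_left, map_smul, he, reflS_single]
      simp
    have h2 : ‖x0 + t • e - x0‖ = t := by simp [he, norm_smul, abs_of_pos ht.1]
    have h3 : (x0 + t • e) i - x0 i = t := by simp [he]
    rw [h1, h2, h3] at hk
    simpa using hk
  rw [abs_le]
  have h1 := hfin 1 (by simp)
  have h2 := hfin (-1) (by simp)
  constructor <;> linarith

end GradEst

section Reg
open Filter Topology

variable {N : ℕ} {u v w : EuclideanSpace ℝ (Fin N) → ℝ}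

lemma fderiv_apply_eq_sum (x y : EuclideanSpace ℝ (Fin N)) :
    fderiv ℝ u x y = ∑ i, y i * pd i u x := by
  have h : y = ∑ i, y i • EuclideanSpace.single i (1:ℝ) := by
    ext k
    simp [Finset.sum_apply, Pi.single_apply]
  conv_lhs => rw [h, map_sum]
  simp [pd]

lemma abs_coord_le (y : EuclideanSpace ℝ (Fin N)) (i : Fin N) : |y i| ≤ ‖y‖ := by
  have := EuclideanSpace.norm_sq_eq y
  have h8 : (y i) ^ 2 ≤ ‖y‖ ^ 2 := by
    rw [this]
    have := Finset.single_le_sum (f := fun j => ‖y j‖ ^ 2) (fun j _ => by positivity)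
      (Finset.mem_univ i)
    simpa using this
  exact abs_le_of_sq_le_sq h8 (norm_nonneg _)

lemma clm_norm_le (l : EuclideanSpace ℝ (Fin N) →L[ℝ] ℝ) :
    ‖l‖ ≤ ∑ i, |l (EuclideanSpace.single i 1)| := by
  refine l.opNorm_le_bound (Finset.sum_nonneg fun i _ => abs_nonneg _) fun y => ?_
  have h : y = ∑ i, y i • EuclideanSpace.single i (1:ℝ) := by
    ext k
    simp [Finset.sum_apply, Pi.single_apply]
  conv_lhs => rw [h, map_sum]
  rw [Finset.sum_mul]
  refine (norm_sum_le _ _).trans (Finset.sum_le_sum fun i _ => ?_)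
  rw [map_smul, smul_eq_mul, norm_mul, Real.norm_eq_abs, Real.norm_eq_abs, mul_comm]
  exact mul_le_mul_of_nonneg_left (abs_coord_le y i) (abs_nonneg _)

lemma abs_pd_le (i : Fin N) (x : EuclideanSpace ℝ (Fin N)) : |pd i u x| ≤ ‖fderiv ℝ u x‖ := by
  have := (fderiv ℝ u x).le_opNorm (EuclideanSpace.single i (1:ℝ))
  simpa [pd] using this

lemma pd_translate (i : Fin N) (c x : EuclideanSpace ℝ (Fin N)) :
    pd i (fun y => u (y + c)) x = pd i u (x + c) := by
  unfold pd; rw [fderiv_comp_add_right]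

lemma lap_translate (c x : EuclideanSpace ℝ (Fin N)) :
    lap (fun y => u (y + c)) x = lap u (x + c) := by
  simp only [lap_eq]
  refine Finset.sum_congr rfl fun i _ => ?_
  have : pd i (fun y => u (y + c)) = fun y => pd i u (y + c) := by
    funext y; exact pd_translate i c y
  rw [this, pd_translate]

lemma pd_comm {x : EuclideanSpace ℝ (Fin N)} (hu : ContDiffAt ℝ 2 u x) (i j : Fin N) :
    pd i (pd j u) x = pd j (pd i u) x := by
  have hs := hu.isSymmSndFDerivAt (by simp)
  have hd : DifferentiableAt ℝ (fderiv ℝ u) x :=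
    (hu.fderiv_right (m := 1) (by norm_num)).differentiableAt (by norm_num)
  have h : ∀ i j, pd i (pd j u) x = fderiv ℝ (fderiv ℝ u) x (EuclideanSpace.single i 1)
      (EuclideanSpace.single j 1) := by
    intro i j
    unfold pd
    rw [fderiv_clm_apply hd (differentiableAt_const _)]
    simp
  rw [h, h]; exact hs _ _

lemma contDiffOn_of_pd {k : ℕ} {Ω : Set (EuclideanSpace ℝ (Fin N))} (ho : IsOpen Ω)
    (hd : DifferentiableOn ℝ u Ω) (h : ∀ i, ContDiffOn ℝ k (pd i u) Ω) :
    ContDiffOn ℝ (k + 1 : ℕ) u Ω := by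
  push_cast
  rw [contDiffOn_succ_iff_fderiv_of_isOpen ho]
  refine ⟨hd, by simp, ?_⟩
  have : fderiv ℝ u = fun x => ∑ i, (pd i u x) • (EuclideanSpace.proj i :
      EuclideanSpace ℝ (Fin N) →L[ℝ] ℝ) := by
    funext x; ext y
    rw [fderiv_apply_eq_sum]
    simp [mul_comm]
  rw [this]
  exact ContDiffOn.sum fun i _ => (h i).smul contDiffOn_const

lemma limit_C1 (hN : 0 < N) {w : ℕ → EuclideanSpace ℝ (Fin N) → ℝ}
    {W L : EuclideanSpace ℝ (Fin N) → ℝ} {x0 : EuclideanSpace ℝ (Fin N)} {r : ℝ} (hr : 0 < r)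
    (hw : ∀ n, ∀ x ∈ Metric.closedBall x0 (2 * r), ContDiffAt ℝ 2 (w n) x)
    (hT : TendstoUniformlyOn w W atTop (Metric.closedBall x0 (2 * r)))
    (hL : TendstoUniformlyOn (fun n => lap (w n)) L atTop (Metric.closedBall x0 (2 * r))) :
    ContDiffOn ℝ 1 W (Metric.ball x0 r) := by
  have hNR : (0:ℝ) < N := by exact_mod_cast hN
  have hsub : ∀ x ∈ Metric.ball x0 r, Metric.closedBall x r ⊆ Metric.closedBall x0 (2 * r) := by
    intro x hx
    apply Metric.closedBall_subset_closedBall'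
    have := Metric.mem_ball.1 hx
    linarith
  have hC : UniformCauchySeqOn (fun n => fderiv ℝ (w n)) atTop (Metric.ball x0 r) := by
    rw [Metric.uniformCauchySeqOn_iff]
    intro ε hε
    have hM := Metric.uniformCauchySeqOn_iff.1 hT.uniformCauchySeqOn (ε / (4 * N) / (N / r))
      (by positivity)
    have hA := Metric.uniformCauchySeqOn_iff.1 hL.uniformCauchySeqOn (ε / (4 * N) / r)
      (by positivity)
    obtain ⟨n1, h1⟩ := hM
    obtain ⟨n2, h2⟩ := hA
    refine ⟨max n1 n2, fun m hm n hn x hx => ?_⟩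
    have hxx : x ∈ Metric.closedBall x0 (2 * r) := hsub x hx (Metric.mem_closedBall_self hr.le)
    have hpd : ∀ i, |pd i (fun y => w m y - w n y) x| ≤ ε / (4 * N) + ε / (4 * N) / 2 := by
      intro i
      have := grad_est hN i hr (u := fun y => w m y - w n y) (x0 := x)
        (M := ε / (4 * N) / (N / r)) (A := ε / (4 * N) / r)
        (fun y hy => (hw m y (hsub x hx hy)).sub (hw n y (hsub x hx hy)))
        (fun y hy => (h1 m ((le_max_left _ _).trans hm) n ((le_max_left _ _).trans hn) y
          (hsub x hx hy)).le)
        (fun y hy => by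
          rw [lap_sub (hw m y (hsub x hx hy)) (hw n y (hsub x hx hy))]
          exact (h2 m ((le_max_right _ _).trans hm) n ((le_max_right _ _).trans hn) y
            (hsub x hx hy)).le)
      refine this.trans (le_of_eq ?_)
      field_simp
    rw [dist_eq_norm, ← fderiv_fun_sub (hw m x hxx).diff2 (hw n x hxx).diff2]
    refine (clm_norm_le _).trans_lt ?_
    calc _ ≤ ∑ i : Fin N, (ε / (4 * N) + ε / (4 * N) / 2) := Finset.sum_le_sum fun i _ => hpd i
      _ = 3 / 8 * ε := by simp; field_simp; ring
      _ < ε := by linarith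
  have hlim : ∀ x ∈ Metric.ball x0 r, ∃ g, Tendsto (fun n => fderiv ℝ (w n) x) atTop (𝓝 g) := by
    intro x hx
    exact cauchySeq_tendsto_of_complete (hC.cauchySeq hx)
  choose! g hg using hlim
  have hU := hC.tendstoUniformlyOn_of_tendsto hg
  have hxx : ∀ x ∈ Metric.ball x0 r, x ∈ Metric.closedBall x0 (2 * r) := fun x hx =>
    hsub x hx (Metric.mem_closedBall_self hr.le)
  have hfd : ∀ x ∈ Metric.ball x0 r, HasFDerivAt W (g x) x := fun x hx =>
    hasFDerivAt_of_tendstoUniformlyOn Metric.isOpen_ball hU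
      (fun n y hy => (hw n y (hxx y hy)).diff2.hasFDerivAt)
      (fun y hy => hT.tendsto_at (hxx y hy)) hx
  have hgc : ContinuousOn g (Metric.ball x0 r) := by
    refine hU.continuousOn (Eventually.frequently (Eventually.of_forall fun n y hy => ?_))
    exact ((hw n y (hxx y hy)).fderiv_right (m := 1) (by norm_num)).continuousAt.continuousWithinAt
  have : ContDiffOn ℝ (0 + 1) W (Metric.ball x0 r) := by
    rw [contDiffOn_succ_iff_fderiv_of_isOpen Metric.isOpen_ball]
    refine ⟨fun x hx => (hfd x hx).differentiableAt.differentiableWithinAt, by simp, ?_⟩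
    rw [contDiffOn_zero]
    exact hgc.congr fun x hx => (hfd x hx).fderiv
  simpa using this

/-- double difference quotient -/
noncomputable def ddq (i j : Fin N) (f : EuclideanSpace ℝ (Fin N) → ℝ) (h : ℝ)
    (x : EuclideanSpace ℝ (Fin N)) : ℝ :=
  (1 / h ^ 2) * ((f (x + (h • EuclideanSpace.single i 1 + h • EuclideanSpace.single j 1))
    - f (x + h • EuclideanSpace.single i 1)) - (f (x + h • EuclideanSpace.single j 1) - f x))

lemma hasDerivAt_line {f : EuclideanSpace ℝ (Fin N) → ℝ} (i : Fin N)
    (x : EuclideanSpace ℝ (Fin N)) (t : ℝ)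
    (hf : DifferentiableAt ℝ f (x + t • EuclideanSpace.single i 1)) :
    HasDerivAt (fun s : ℝ => f (x + s • EuclideanSpace.single i 1))
      (pd i f (x + t • EuclideanSpace.single i 1)) t := by
  have h1 : HasDerivAt (fun s : ℝ => x + s • EuclideanSpace.single i (1:ℝ))
      (EuclideanSpace.single i (1:ℝ)) t := by
    have := ((hasDerivAt_id t).smul_const (EuclideanSpace.single i (1:ℝ))).const_add x
    rw [one_smul] at this; exact this
  exact hf.hasFDerivAt.comp_hasDerivAt t h1

lemma ddq_eq (i j : Fin N) {f : EuclideanSpace ℝ (Fin N) → ℝ} {h : ℝ} (hh : 0 < h)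
    {x : EuclideanSpace ℝ (Fin N)}
    (hf : ∀ y ∈ Metric.closedBall x (2 * h), ContDiffAt ℝ 2 f y) :
    ∃ y ∈ Metric.closedBall x (2 * h), ddq i j f h x = pd j (pd i f) y := by
  have hmem : ∀ s t : ℝ, s ∈ Set.Icc 0 h → t ∈ Set.Icc 0 h →
      x + s • EuclideanSpace.single i (1:ℝ) + t • EuclideanSpace.single j (1:ℝ) ∈
        Metric.closedBall x (2 * h) := by
    intro s t hs ht
    rw [Metric.mem_closedBall, dist_eq_norm, add_assoc, add_sub_cancel_left]
    refine (norm_add_le _ _).trans ?_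
    rw [norm_smul, norm_smul]
    simp [abs_of_nonneg hs.1, abs_of_nonneg ht.1]
    linarith [hs.2, ht.2]
  have h0 : (0:ℝ) ∈ Set.Icc 0 h := ⟨le_rfl, hh.le⟩
  have h1 : h ∈ Set.Icc 0 h := ⟨hh.le, le_rfl⟩
  have hG : ∀ s ∈ Set.Icc 0 h, HasDerivAt (fun s : ℝ =>
      f (x + h • EuclideanSpace.single j (1:ℝ) + s • EuclideanSpace.single i (1:ℝ)) -
        f (x + s • EuclideanSpace.single i (1:ℝ)))
      (pd i f (x + h • EuclideanSpace.single j (1:ℝ) + s • EuclideanSpace.single i (1:ℝ)) -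
        pd i f (x + s • EuclideanSpace.single i (1:ℝ))) s := by
    intro s hs
    refine (hasDerivAt_line i _ s ?_).sub (hasDerivAt_line i _ s ?_)
    · rw [add_right_comm]; exact (hf _ (hmem s h hs h1)).diff2
    · have := hmem s 0 hs h0
      rw [zero_smul, add_zero] at this
      exact (hf _ this).diff2
  obtain ⟨s, hs, hs2⟩ := exists_hasDerivAt_eq_slope _ _ hh
    (fun s hs => (hG s hs).continuousAt.continuousWithinAt)
    (fun s hs => hG s (Set.Ioo_subset_Icc_self hs))
  have hs' := Set.Ioo_subset_Icc_self hs
  have hH : ∀ t ∈ Set.Icc 0 h, HasDerivAt (fun t : ℝ =>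
      pd i f (x + s • EuclideanSpace.single i (1:ℝ) + t • EuclideanSpace.single j (1:ℝ)))
      (pd j (pd i f) (x + s • EuclideanSpace.single i (1:ℝ) + t • EuclideanSpace.single j (1:ℝ))) t :=
    fun t ht => hasDerivAt_line j _ t (hf _ (hmem s t hs' ht)).pd_diff
  obtain ⟨t, ht, ht2⟩ := exists_hasDerivAt_eq_slope _ _ hh
    (fun s hs => (hH s hs).continuousAt.continuousWithinAt)
    (fun s hs => hH s (Set.Ioo_subset_Icc_self hs))
  refine ⟨_, hmem s t hs' (Set.Ioo_subset_Icc_self ht), ?_⟩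
  rw [ht2]
  rw [add_right_comm] at hs2
  simp only [zero_smul, add_zero, sub_zero] at hs2 ⊢
  rw [hs2]
  unfold ddq
  have e1 : x + (h • EuclideanSpace.single i (1:ℝ) + h • EuclideanSpace.single j (1:ℝ)) =
    x + h • EuclideanSpace.single j (1:ℝ) + h • EuclideanSpace.single i (1:ℝ) := by abel
  rw [e1]
  field_simp

lemma ddq_tendsto (i j : Fin N) {f : EuclideanSpace ℝ (Fin N) → ℝ}
    {x0 : EuclideanSpace ℝ (Fin N)} {R : ℝ} (hR : 0 < R)
    (hf : ∀ y ∈ Metric.closedBall x0 (2 * R), ContDiffAt ℝ 2 f y) :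
    TendstoUniformlyOn (fun n : ℕ => ddq i j f (R / (2 * (n + 1)))) (pd j (pd i f)) atTop
      (Metric.closedBall x0 R) := by
  have hc : ContinuousOn (pd j (pd i f)) (Metric.closedBall x0 (2 * R)) := fun y hy =>
    ((hf y hy).pd1.pd' (m := 0) (by norm_num)).continuousAt.continuousWithinAt
  have hu := (isCompact_closedBall x0 (2 * R)).uniformContinuousOn_of_continuous hc
  rw [Metric.uniformContinuousOn_iff] at hu
  rw [Metric.tendstoUniformlyOn_iff]
  intro ε hε
  obtain ⟨δ, hδ, hd⟩ := hu ε hε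
  obtain ⟨n0, hn0⟩ := exists_nat_gt (R / δ)
  filter_upwards [eventually_ge_atTop n0] with n hn x hx
  have hn' : (n0 : ℝ) ≤ n := by exact_mod_cast hn
  have hh : 0 < R / (2 * ((n:ℝ) + 1)) := by positivity
  have h2h : 2 * (R / (2 * ((n:ℝ) + 1))) < δ := by
    rw [div_lt_iff₀ hδ] at hn0
    rw [show 2 * (R / (2 * ((n:ℝ) + 1))) = R / (n + 1) by field_simp, div_lt_iff₀ (by positivity)]
    nlinarith
  have h2R : 2 * (R / (2 * ((n:ℝ) + 1))) ≤ R := by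
    rw [show 2 * (R / (2 * ((n:ℝ) + 1))) = R / (n + 1) by field_simp]
    exact div_le_self hR.le (by linarith [(Nat.cast_nonneg n : (0:ℝ) ≤ n)])
  have hsub : Metric.closedBall x (2 * (R / (2 * ((n:ℝ) + 1)))) ⊆ Metric.closedBall x0 (2 * R) := by
    apply Metric.closedBall_subset_closedBall'
    have := Metric.mem_closedBall.1 hx
    linarith
  obtain ⟨y, hy, he⟩ := ddq_eq i j hh (fun y hy => hf y (hsub hy))
  rw [he]
  refine hd x (hsub (Metric.mem_closedBall_self (by positivity))) y (hsub hy) ?_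
  rw [dist_comm]
  exact (Metric.mem_closedBall.1 hy).trans_lt h2h

lemma lap_ddq (i j : Fin N) {f : EuclideanSpace ℝ (Fin N) → ℝ} {h : ℝ}  (hh : 0 < h)
    {x : EuclideanSpace ℝ (Fin N)}
    (hf : ∀ y ∈ Metric.closedBall x (2 * h), ContDiffAt ℝ 2 f y) :
    ContDiffAt ℝ 2 (ddq i j f h) x ∧ lap (ddq i j f h) x = ddq i j (lap f) h x := by
  have hmem : ∀ c : EuclideanSpace ℝ (Fin N), ‖c‖ ≤ 2 * h →
      ContDiffAt ℝ 2 (fun y => f (y + c)) x := by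
    intro c hc
    have : ContDiffAt ℝ 2 f (x + c) := hf _ (by
      rw [Metric.mem_closedBall, dist_eq_norm, add_sub_cancel_left]; exact hc)
    exact ContDiffAt.comp x this (by fun_prop)
  have hs : ∀ k : Fin N, ‖h • EuclideanSpace.single k (1:ℝ)‖ = h := by
    intro k; rw [norm_smul]; simp [abs_of_pos hh]
  have c1 := hmem (h • EuclideanSpace.single i (1:ℝ) + h • EuclideanSpace.single j (1:ℝ))
    ((norm_add_le _ _).trans (by rw [hs, hs]; linarith))
  have c2 := hmem (h • EuclideanSpace.single i (1:ℝ)) (by rw [hs]; linarith)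
  have c3 := hmem (h • EuclideanSpace.single j (1:ℝ)) (by rw [hs]; linarith)
  have c4 : ContDiffAt ℝ 2 f x := hf x (Metric.mem_closedBall_self (by positivity))
  have c5 := (c1.sub c2).sub (c3.sub c4)
  refine ⟨contDiffAt_const.mul c5, ?_⟩
  unfold ddq
  rw [lap_const_mul _ c5, lap_sub (c1.sub c2) (c3.sub c4), lap_sub c1 c2, lap_sub c3 c4]
  simp only [lap_translate]

lemma reg_base (hN : 0 < N) {Ω : Set (EuclideanSpace ℝ (Fin N))} (ho : IsOpen Ω)
    (hu : ContDiffOn ℝ 2 u Ω) (hl : ContDiffOn ℝ 2 (lap u) Ω) : ContDiffOn ℝ 3 u Ω := by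
  have hu' : ∀ x ∈ Ω, ContDiffAt ℝ 2 u x := fun x hx => hu.contDiffAt (ho.mem_nhds hx)
  have hl' : ∀ x ∈ Ω, ContDiffAt ℝ 2 (lap u) x := fun x hx => hl.contDiffAt (ho.mem_nhds hx)
  have key : ∀ i j, ContDiffOn ℝ (1:ℕ) (pd j (pd i u)) Ω := by
    intro i j x0 hx0
    obtain ⟨R, hR, hB⟩ := Metric.nhds_basis_closedBall.mem_iff.1 (ho.mem_nhds hx0)
    have h4 : 0 < R / 4 := by positivity
    have hB2 : Metric.closedBall x0 (2 * (2 * (R / 4))) ⊆ Ω := by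
      refine Set.Subset.trans (Metric.closedBall_subset_closedBall ?_) hB
      linarith
    have h1 := ddq_tendsto i j (x0 := x0) (R := 2 * (R / 4)) (by positivity)
      (fun y hy => hu' y (hB2 hy))
    have h2 := ddq_tendsto i j (x0 := x0) (R := 2 * (R / 4)) (by positivity)
      (fun y hy => hl' y (hB2 hy))
    have h3 : ∀ n : ℕ, ∀ x ∈ Metric.closedBall x0 (2 * (R / 4)),
        ContDiffAt ℝ 2 (ddq i j u (2 * (R / 4) / (2 * ((n:ℝ) + 1)))) x ∧
        lap (ddq i j u (2 * (R / 4) / (2 * ((n:ℝ) + 1)))) x =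
          ddq i j (lap u) (2 * (R / 4) / (2 * ((n:ℝ) + 1))) x := by
      intro n x hx
      refine lap_ddq i j (by positivity) fun y hy => hu' y (hB2 ?_)
      have : 2 * (2 * (R / 4) / (2 * ((n:ℝ) + 1))) ≤ 2 * (R / 4) := by
        rw [show 2 * (2 * (R / 4) / (2 * ((n:ℝ) + 1))) = 2 * (R / 4) / (n + 1) by field_simp]
        exact div_le_self (by positivity) (by linarith [(Nat.cast_nonneg n : (0:ℝ) ≤ n)])
      refine Metric.closedBall_subset_closedBall' ?_ hy
      have := Metric.mem_closedBall.1 hx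
      linarith
    have := limit_C1 hN h4 (fun n x hx => (h3 n x hx).1) h1
      (h2.congr (Eventually.of_forall fun n x hx => (h3 n x hx).2.symm))
    exact (this.contDiffAt (Metric.ball_mem_nhds x0 h4)).contDiffWithinAt
  have k1 : ∀ i, ContDiffOn ℝ (1 + 1 : ℕ) (pd i u) Ω := fun i =>
    contDiffOn_of_pd ho (fun x hx => (hu' x hx).pd_diff.differentiableWithinAt) (key i)
  have k2 := contDiffOn_of_pd ho (fun x hx => (hu' x hx).diff2.differentiableWithinAt) k1
  exact_mod_cast k2

lemma lap_pd {x : EuclideanSpace ℝ (Fin N)} (hu : ContDiffAt ℝ 3 u x) (i : Fin N) :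
    lap (pd i u) x = pd i (lap u) x := by
  have hu2 : ContDiffAt ℝ 2 u x := hu.of_le (by norm_num)
  have h : pd i (lap u) x = ∑ j, pd i (pd j (pd j u)) x := by
    have : lap u = fun y => ∑ j, pd j (pd j u) y := by funext y; rfl
    rw [this]; unfold pd
    rw [fderiv_fun_sum]
    · simp
    · intro j _
      exact ((hu.pd' (i := j) (m := 2) (by norm_num)).pd_diff (i := j))
  rw [h, lap_eq]
  refine Finset.sum_congr rfl fun j _ => ?_
  rw [pd_comm (hu.pd' (i := j) (m := 2) (by norm_num)) i j]
  apply pd_congr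
  filter_upwards [hu2.eventually (by simp)] with y hy using pd_comm hy j i

lemma reg_step (hN : 0 < N) {Ω : Set (EuclideanSpace ℝ (Fin N))} (ho : IsOpen Ω) (k : ℕ) :
    ∀ u : EuclideanSpace ℝ (Fin N) → ℝ, 
    ContDiffOn ℝ (k + 2 : ℕ) u Ω → ContDiffOn ℝ (k + 2 : ℕ) (lap u) Ω →
    ContDiffOn ℝ (k + 3 : ℕ) u Ω := by
  induction k with
  | zero => intro u h1 h2; exact_mod_cast reg_base hN ho (by exact_mod_cast h1) (by exact_mod_cast h2)
  | succ k ih =>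
    intro u h1 h2
    have h1' : ∀ x ∈ Ω, ContDiffAt ℝ (k + 3 : ℕ) u x := fun x hx => by
      have := h1.contDiffAt (ho.mem_nhds hx)
      convert this using 2
    have h2' : ∀ x ∈ Ω, ContDiffAt ℝ (k + 3 : ℕ) (lap u) x := fun x hx => by
      have := h2.contDiffAt (ho.mem_nhds hx)
      convert this using 2
    have : ContDiffOn ℝ ((k + 3) + 1 : ℕ) u Ω := by
      refine contDiffOn_of_pd ho (fun x hx => ((h1' x hx).of_le ?_).diff2.differentiableWithinAt)
        fun i => ih _ ?_ ?_
      · norm_cast; omega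
      · exact fun x hx => ((h1' x hx).pd' (by norm_cast)).contDiffWithinAt
      · intro x hx
        refine ContDiffAt.contDiffWithinAt ?_
        refine ((h2' x hx).pd' (i := i) (m := (k + 2 : ℕ)) (by norm_cast)).congr_of_eventuallyEq ?_
        filter_upwards [ho.mem_nhds hx] with y hy
        exact lap_pd ((h1' y hy).of_le (by norm_cast; omega)) i
    convert this using 2

lemma gelfand_smooth (hN : 0 < N) {Ω : Set (EuclideanSpace ℝ (Fin N))} (ho : IsOpen Ω)
    {lam mu : ℝ} (hu : ContDiffOn ℝ 2 u Ω) (hv : ContDiffOn ℝ 2 v Ω)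
    (h1 : ∀ x ∈ Ω, -lap u x = mu * exp (v x)) (h2 : ∀ x ∈ Ω, -lap v x = lam * exp (u x)) :
    ContDiffOn ℝ (⊤ : ℕ∞) u Ω ∧ ContDiffOn ℝ (⊤ : ℕ∞) v Ω := by
  have key : ∀ k : ℕ, ContDiffOn ℝ (k + 2 : ℕ) u Ω ∧ ContDiffOn ℝ (k + 2 : ℕ) v Ω := by
    intro k
    induction k with
    | zero => exact ⟨by exact_mod_cast hu, by exact_mod_cast hv⟩
    | succ k ih =>
      have e1 : ContDiffOn ℝ (k + 2 : ℕ) (lap u) Ω :=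
        ((contDiffOn_const (c := -mu)).mul ih.2.exp).congr fun x hx => by
          have := h1 x hx; linarith
      have e2 : ContDiffOn ℝ (k + 2 : ℕ) (lap v) Ω :=
        ((contDiffOn_const (c := -lam)).mul ih.1.exp).congr fun x hx => by
          have := h2 x hx; linarith
      have a1 := reg_step hN ho k u ih.1 e1
      have a2 := reg_step hN ho k v ih.2 e2
      constructor
      · convert a1 using 2
      · convert a2 using 2
  constructor
  · rw [contDiffOn_infty]; exact fun n => (key n).1.of_le (by norm_cast; omega)
  · rw [contDiffOn_infty]; exact fun n => (key n).2.of_le (by norm_cast; omega)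

end Reg

section Tools
open Filter Topology

variable {N : ℕ} {u v w : EuclideanSpace ℝ (Fin N) → ℝ}

lemma continuous_pd (hw : ContDiff ℝ 1 w) (i : Fin N) : Continuous (pd i w) :=
  (hw.continuous_fderiv (by norm_num)).clm_apply continuous_const

lemma hasCompactSupport_pd (hs : HasCompactSupport w) (i : Fin N) :
    HasCompactSupport (pd i w) :=
  hs.fderiv_apply (𝕜 := ℝ) _

lemma integral_pd_zero (hw : ContDiff ℝ 1 w) (hs : HasCompactSupport w) (i : Fin N) :
    ∫ x, pd i w x = 0 := by
  have h := integral_mul_fderiv_eq_neg_fderiv_mul_of_integrable (𝕜 := ℝ) (μ := volume)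
    (v := EuclideanSpace.single i (1:ℝ)) (f := fun _ : EuclideanSpace ℝ (Fin N) => (1:ℝ)) (g := w)
    (by simp)
    (by
      simp only [one_mul]
      exact (continuous_pd hw i).integrable_of_hasCompactSupport (hasCompactSupport_pd hs i))
    (by
      simp only [one_mul]
      exact hw.continuous.integrable_of_hasCompactSupport hs)
    (by fun_prop) (fun x _ => hw.differentiable (by norm_num) x)
  simpa [pd] using h

lemma ext0_contDiff {Ω K : Set (EuclideanSpace ℝ (Fin N))} (ho : IsOpen Ω) (hK : IsCompact K)
    (hKΩ : K ⊆ Ω) {f : EuclideanSpace ℝ (Fin N) → ℝ} {n : WithTop ℕ∞}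
    (hf : ∀ x ∈ Ω, ContDiffAt ℝ n f x) (h0 : ∀ x ∈ Ω, x ∉ K → f x = 0) :
    ContDiff ℝ n (Ω.indicator f) ∧ HasCompactSupport (Ω.indicator f) := by
  have hz : ∀ x ∉ K, Ω.indicator f x = 0 := by
    intro x hx
    by_cases h : x ∈ Ω
    · rw [Set.indicator_of_mem h]; exact h0 x h hx
    · exact Set.indicator_of_notMem h f
  refine ⟨contDiff_iff_contDiffAt.2 fun x => ?_, HasCompactSupport.intro hK hz⟩
  by_cases h : x ∈ Ω
  · refine (hf x h).congr_of_eventuallyEq ?_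
    filter_upwards [ho.mem_nhds h] with y hy using Set.indicator_of_mem hy f
  · refine (contDiffAt_const (c := (0:ℝ))).congr_of_eventuallyEq ?_
    filter_upwards [hK.isClosed.isOpen_compl.mem_nhds (fun hx => h (hKΩ hx))] with y hy using hz y hy

lemma ext0_eq {Ω : Set (EuclideanSpace ℝ (Fin N))} (ho : IsOpen Ω)
    (f : EuclideanSpace ℝ (Fin N) → ℝ) {x : EuclideanSpace ℝ (Fin N)} (hx : x ∈ Ω) :
    Ω.indicator f =ᶠ[𝓝 x] f := by
  filter_upwards [ho.mem_nhds hx] with y hy using Set.indicator_of_mem hy f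

lemma superlevel_compact {Ω : Set (EuclideanSpace ℝ (Fin N))} (ho : IsOpen Ω)
    (hb : Bornology.IsBounded Ω) (hc : ContinuousOn u (closure Ω))
    (h0 : ∀ x ∈ frontier Ω, u x = 0) {c : ℝ} (hc0 : 0 < c) :
    IsCompact {x ∈ closure Ω | c ≤ u x} ∧ {x ∈ closure Ω | c ≤ u x} ⊆ Ω := by
  have hcl : IsCompact (closure Ω) := hb.isCompact_closure
  constructor
  · have : IsClosed {x ∈ closure Ω | c ≤ u x} :=
      hc.preimage_isClosed_of_isClosed isClosed_closure isClosed_Ici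
    exact hcl.of_isClosed_subset this fun x hx => hx.1
  · intro x hx
    by_contra h
    have : x ∈ frontier Ω := by rw [ho.frontier_eq]; exact ⟨hx.1, h⟩
    have := h0 x this
    have := hx.2
    linarith

lemma hasDerivAt_posPow (k : ℕ) (t : ℝ) :
    HasDerivAt (fun s : ℝ => max s 0 ^ (k + 2)) ((k + 2) * max t 0 ^ (k + 1)) t := by
  rcases lt_trichotomy t 0 with h | h | h
  · have : (fun s : ℝ => max s 0 ^ (k + 2)) =ᶠ[𝓝 t] fun _ => 0 := by
      filter_upwards [Iio_mem_nhds h] with s hs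
      rw [max_eq_right (le_of_lt hs)]; simp
    rw [max_eq_right h.le]
    simpa using (hasDerivAt_const t (0:ℝ)).congr_of_eventuallyEq this
  · subst h
    have h2 : HasDerivAt (fun s : ℝ => s ^ 2) 0 0 := by simpa using hasDerivAt_pow 2 (0:ℝ)
    simp only [max_self, ne_eq, Nat.add_eq_zero_iff, one_ne_zero, and_false, not_false_eq_true,
      zero_pow, mul_zero]
    rw [hasDerivAt_iff_isLittleO] at h2 ⊢
    refine Asymptotics.IsBigO.trans_isLittleO ?_ h2
    refine Asymptotics.IsBigO.of_bound 1 ?_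
    filter_upwards [Icc_mem_nhds (show (-1:ℝ) < 0 by norm_num) (show (0:ℝ) < 1 by norm_num)] with s hs
    simp
    have h3 : max s 0 ≤ 1 := max_le hs.2 (by norm_num)
    have h4 : 0 ≤ max s 0 := le_max_right _ _
    rw [abs_of_nonneg h4, pow_add]
    have h5 : max s 0 ^ 2 ≤ s ^ 2 := by
      rcases le_total s 0 with h | h
      · rw [max_eq_right h]; nlinarith [sq_nonneg s]
      · rw [max_eq_left h]
    calc max s 0 ^ k * max s 0 ^ 2 ≤ 1 * max s 0 ^ 2 := by
          gcongr; exact pow_le_one₀ h4 h3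
      _ ≤ s ^ 2 := by linarith
  · have : (fun s : ℝ => max s 0 ^ (k + 2)) =ᶠ[𝓝 t] fun s => s ^ (k + 2) := by
      filter_upwards [Ioi_mem_nhds h] with s hs
      rw [max_eq_left (le_of_lt hs)]
    rw [max_eq_left h.le]
    have h6 := (hasDerivAt_pow (k + 2) t).congr_of_eventuallyEq this
    simpa using h6

lemma contDiff_posPow (n : ℕ) : ContDiff ℝ n (fun s : ℝ => max s 0 ^ (n + 1)) := by
  induction n with
  | zero =>
    simp only [Nat.cast_zero, zero_add, pow_one]
    exact contDiff_zero.2 (by fun_prop)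
  | succ n ih =>
    push_cast
    rw [contDiff_succ_iff_deriv]
    refine ⟨fun t => (hasDerivAt_posPow n t).differentiableAt, by simp, ?_⟩
    have : deriv (fun s : ℝ => max s 0 ^ (n + 1 + 1)) = fun t => ((n:ℝ) + 2) * max t 0 ^ (n + 1) := by
      funext t; exact (hasDerivAt_posPow n t).deriv
    rw [this]
    exact contDiff_const.mul ih

end Tools

section Energy
open Filter Topology

variable {N : ℕ} {u v w : EuclideanSpace ℝ (Fin N) → ℝ}

lemma ext0_zero {Ω K : Set (EuclideanSpace ℝ (Fin N))} (hK : IsCompact K)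
    (hKΩ : K ⊆ Ω) {f : EuclideanSpace ℝ (Fin N) → ℝ} (h0 : ∀ x ∈ Ω, x ∉ K → f x = 0)
    {x : EuclideanSpace ℝ (Fin N)} (hx : x ∉ Ω) : Ω.indicator f =ᶠ[𝓝 x] fun _ => 0 := by
  filter_upwards [hK.isClosed.isOpen_compl.mem_nhds (fun h => hx (hKΩ h))] with y hy
  by_cases h : y ∈ Ω
  · rw [Set.indicator_of_mem h]; exact h0 y h hy
  · exact Set.indicator_of_notMem h f

lemma contDiffAt_of_closure {Ω : Set (EuclideanSpace ℝ (Fin N))} (ho : IsOpen Ω)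
    (hu : ContDiffOn ℝ 2 u (closure Ω)) {x : EuclideanSpace ℝ (Fin N)} (hx : x ∈ Ω) :
    ContDiffAt ℝ 2 u x :=
  (hu.mono subset_closure).contDiffAt (ho.mem_nhds hx)

lemma lap_log {φ : EuclideanSpace ℝ (Fin N) → ℝ} {x : EuclideanSpace ℝ (Fin N)}
    (hφ : ContDiffAt ℝ 2 φ x) (h0 : 0 < φ x) :
    ContDiffAt ℝ 2 (fun y => log (φ y)) x ∧
    lap φ x = φ x * (lap (fun y => log (φ y)) x + ∑ i, pd i (fun y => log (φ y)) x ^ 2) := by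
  have h1 : ContDiffAt ℝ 2 (fun y => log (φ y)) x := hφ.log h0.ne'
  refine ⟨h1, ?_⟩
  have h2 := lap_comp (u := fun y => log (φ y)) (x := x) (g := exp) (g' := exp)
    (fun t => hasDerivAt_exp t) (hasDerivAt_exp _) h1
  have h3 : (fun y => exp (log (φ y))) =ᶠ[𝓝 x] φ := by
    filter_upwards [hφ.continuousAt.eventually (lt_mem_nhds h0)] with y hy using exp_log hy
  rw [lap_congr h3, exp_log h0] at h2
  rw [h2]; ring

/-- the truncated exponential -/
noncomputable def tx (t : ℝ) : ℝ := max (exp (t / 2) - 2) 0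

lemma hasDerivAt_txpow (k : ℕ) (t : ℝ) :
    HasDerivAt (fun s => tx s ^ (k + 2)) ((k + 2) * tx t ^ (k + 1) * (exp (t / 2) / 2)) t := by
  have h1 : HasDerivAt (fun s : ℝ => exp (s / 2) - 2) (exp (t / 2) / 2) t := by
    have := (((hasDerivAt_id t).div_const 2).exp).sub_const 2
    simpa [div_eq_mul_inv] using this
  exact (hasDerivAt_posPow k (exp (t / 2) - 2)).comp t h1

lemma contDiff_txpow (n : ℕ) : ContDiff ℝ n (fun s => tx s ^ (n + 1)) := by
  have : ContDiff ℝ n (fun s : ℝ => exp (s / 2) - 2) := by fun_prop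
  exact (contDiff_posPow n).comp this

lemma tx_nonneg (t : ℝ) : 0 ≤ tx t := le_max_right _ _

lemma tx_mul (t : ℝ) : tx t * exp (t / 2) = tx t * (tx t + 2) := by
  unfold tx
  rcases le_total (exp (t / 2) - 2) 0 with h | h
  · rw [max_eq_right h]; simp
  · rw [max_eq_left h]; ring

lemma continuous_tx : Continuous tx := by unfold tx; fun_prop

lemma energy_one {Ω : Set (EuclideanSpace ℝ (Fin N))} (ho : IsOpen Ω)
    (hb : Bornology.IsBounded Ω) {sl sm lam1 : ℝ} (hsm : 0 < sm) (hl1 : 0 ≤ lam1)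
    {φ ψ : EuclideanSpace ℝ (Fin N) → ℝ}
    (hu : ContDiffOn ℝ 2 u (closure Ω)) (hv : ContinuousOn v (closure Ω))
    (hu1 : ∀ x ∈ Ω, -lap u x = sm ^ 2 * exp (v x)) (hu0 : ∀ x ∈ frontier Ω, u x = 0)
    (hφ : ContDiffOn ℝ 2 φ (closure Ω)) (hψ : ContDiffOn ℝ 2 ψ (closure Ω))
    (hφ0 : ∀ x ∈ Ω, 0 < φ x) (hψ0 : ∀ x ∈ Ω, 0 < ψ x)
    (hφ1 : ∀ x ∈ Ω, -lap φ x - sm ^ 2 * exp (v x) * ψ x = lam1 * φ x)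
    (hψ1 : ∀ x ∈ Ω, -lap ψ x - sl ^ 2 * exp (u x) * φ x = lam1 * ψ x) :
    sl * ∫ x in Ω, exp (u x / 2) * exp (v x / 2) * tx (u x) ^ 4 ≤
      sm * ∫ x in Ω, exp (v x / 2) ^ 2 * (tx (u x) ^ 4 / 2 + 4 / 3 * tx (u x) ^ 3) := by
  have hcl : IsCompact (closure Ω) := hb.isCompact_closure
  have huc := hu.continuousOn
  obtain ⟨hK, hKΩ⟩ := superlevel_compact ho hb huc hu0 (c := 2 * log 2) (by positivity)
  set K := {x ∈ closure Ω | 2 * log 2 ≤ u x} with hKdef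
  have htx0 : ∀ x ∈ Ω, x ∉ K → tx (u x) = 0 := by
    intro x hx hxK
    have h1 : u x < 2 * log 2 := by
      by_contra h
      exact hxK ⟨subset_closure hx, not_lt.1 h⟩
    have h2 : exp (u x / 2) < 2 := by
      exact (lt_log_iff_exp_lt (by norm_num)).1 (by linarith)
    unfold tx
    exact max_eq_right (by linarith)
  set Z : ℝ → ℝ := fun t => tx t ^ 4 / 2 + 4 / 3 * tx t ^ 3 with hZ
  set P : EuclideanSpace ℝ (Fin N) → ℝ := fun y => log (φ y) with hP
  set Q : EuclideanSpace ℝ (Fin N) → ℝ := fun y => log (ψ y) with hQ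
  set f : Fin N → EuclideanSpace ℝ (Fin N) → ℝ := fun i y =>
    tx (u y) ^ 4 * (1 / 2 * (pd i P y + pd i Q y)) - Z (u y) * pd i u y with hf
  have hZd : ∀ t, HasDerivAt Z (tx t ^ 2 * (tx t + 2) * exp (t / 2)) t := by
    intro t
    have := ((hasDerivAt_txpow 2 t).div_const 2).add ((hasDerivAt_txpow 1 t).const_mul (4/3))
    refine HasDerivAt.congr_deriv this ?_
    push_cast; ring
  have hZc : ContDiff ℝ 1 Z := by
    have h3 : ContDiff ℝ 1 (fun s => tx s ^ 3) := (contDiff_txpow 2).of_le (by norm_num)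
    have h4 : ContDiff ℝ 1 (fun s => tx s ^ 4) := (contDiff_txpow 3).of_le (by norm_num)
    exact (h4.div_const 2).add (contDiff_const.mul h3)
  have ha : ∀ x ∈ Ω, ContDiffAt ℝ 2 u x := fun x hx => contDiffAt_of_closure ho hu hx
  have hp : ∀ x ∈ Ω, ContDiffAt ℝ 2 P x := fun x hx =>
    (lap_log (contDiffAt_of_closure ho hφ hx) (hφ0 x hx)).1
  have hq : ∀ x ∈ Ω, ContDiffAt ℝ 2 Q x := fun x hx =>
    (lap_log (contDiffAt_of_closure ho hψ hx) (hψ0 x hx)).1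
  have hX4 : ∀ x ∈ Ω, ContDiffAt ℝ 1 (fun y => tx (u y) ^ 4) x := fun x hx => by
    have h4 : ContDiff ℝ 1 (fun s => tx s ^ 4) := (contDiff_txpow 3).of_le (by norm_num)
    exact h4.contDiffAt.comp x ((ha x hx).of_le (by norm_num))
  have hZu : ∀ x ∈ Ω, ContDiffAt ℝ 1 (fun y => Z (u y)) x := fun x hx =>
    hZc.contDiffAt.comp x ((ha x hx).of_le (by norm_num))
  have hfc : ∀ i, ∀ x ∈ Ω, ContDiffAt ℝ 1 (f i) x := fun i x hx =>
    ((hX4 x hx).mul (contDiffAt_const.mul ((hp x hx).pd1.add (hq x hx).pd1))).sub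
      ((hZu x hx).mul (ha x hx).pd1)
  have hf0 : ∀ i, ∀ x ∈ Ω, x ∉ K → f i x = 0 := by
    intro i x hx hxK
    simp [hf, hZ, htx0 x hx hxK]
  have hext := fun i => ext0_contDiff ho hK hKΩ (hfc i) (hf0 i)
  set R : EuclideanSpace ℝ (Fin N) → ℝ := fun x => sm ^ 2 * (exp (v x / 2) ^ 2 * Z (u x)) -
    sl * sm * (exp (u x / 2) * exp (v x / 2) * tx (u x) ^ 4) with hR
  have hpt : ∀ x, ∑ i, pd i (Ω.indicator (f i)) x ≤ Ω.indicator R x := by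
    intro x
    by_cases hx : x ∈ Ω
    swap
    · rw [Set.indicator_of_notMem hx]
      refine le_of_eq (Finset.sum_eq_zero fun i _ => ?_)
      rw [pd_congr (ext0_zero hK hKΩ (hf0 i) hx), pd_const]
    rw [Set.indicator_of_mem hx]
    have hdu := (ha x hx).diff2
    have e1 : ∀ i, pd i (Ω.indicator (f i)) x =
        tx (u x) ^ 4 * (1 / 2 * (pd i (pd i P) x + pd i (pd i Q) x)) +
        (1 / 2 * (pd i P x + pd i Q x)) * (2 * tx (u x) ^ 3 * exp (u x / 2) * pd i u x)
        - (Z (u x) * pd i (pd i u) x +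
          pd i u x * (tx (u x) ^ 2 * (tx (u x) + 2) * exp (u x / 2) * pd i u x)) := by
      intro i
      rw [pd_congr (ext0_eq ho (f i) hx)]
      simp only [hf]
      have d1 := (hX4 x hx).differentiableAt (by norm_num)
      have d2 := (hZu x hx).differentiableAt (by norm_num)
      have d3 := (hp x hx).pd_diff (i := i)
      have d4 := (hq x hx).pd_diff (i := i)
      have d5 := (ha x hx).pd_diff (i := i)
      have d6 : DifferentiableAt ℝ (fun y => pd i P y + pd i Q y) x := d3.add d4
      have d7 : DifferentiableAt ℝ (fun y => 1 / 2 * (pd i P y + pd i Q y)) x := d6.const_mul _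
      rw [pd_sub (d1.fun_mul d7) (d2.fun_mul d5), pd_mul d1 d7, pd_mul d2 d5, pd_const_mul _ d6,
        pd_add d3 d4, pd_comp (hZd (u x)) hdu, pd_comp (g := fun s => tx s ^ 4) (hasDerivAt_txpow 2 (u x)) hdu]
      push_cast; ring
    have e2 : ∑ i, pd i (Ω.indicator (f i)) x ≤ ∑ i, (tx (u x) ^ 4 / 2 *
        ((pd i (pd i P) x + pd i P x ^ 2) + (pd i (pd i Q) x + pd i Q x ^ 2)) -
        Z (u x) * pd i (pd i u) x) := by
      refine Finset.sum_le_sum fun i _ => ?_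
      rw [e1]
      have hm := tx_mul (u x)
      have h1 : tx (u x) ^ 2 * (tx (u x) + 2) * exp (u x / 2) = (tx (u x) * exp (u x / 2)) ^ 2 := by
        linear_combination (-tx (u x) * exp (u x / 2)) * hm
      rw [h1]
      nlinarith [sq_nonneg (tx (u x) ^ 2 * pd i P x - tx (u x) * exp (u x / 2) * pd i u x),
        sq_nonneg (tx (u x) ^ 2 * pd i Q x - tx (u x) * exp (u x / 2) * pd i u x)]
    refine e2.trans ?_
    rw [Finset.sum_sub_distrib, ← Finset.mul_sum, ← Finset.mul_sum, Finset.sum_add_distrib,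
      Finset.sum_add_distrib, Finset.sum_add_distrib, ← lap_eq, ← lap_eq, ← lap_eq]
    have l1 := (lap_log (contDiffAt_of_closure ho hφ hx) (hφ0 x hx)).2
    have l2 := (lap_log (contDiffAt_of_closure ho hψ hx) (hψ0 x hx)).2
    have l3 := hφ1 x hx
    have l4 := hψ1 x hx
    have l5 := hu1 x hx
    rw [l1] at l3
    rw [l2] at l4
    have p1 := hφ0 x hx
    have p2 := hψ0 x hx
    change -(φ x * (lap P x + ∑ i, pd i P x ^ 2)) - sm ^ 2 * exp (v x) * ψ x = lam1 * φ x at l3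
    change -(ψ x * (lap Q x + ∑ i, pd i Q x ^ 2)) - sl ^ 2 * exp (u x) * φ x = lam1 * ψ x at l4
    set p := lap P x + ∑ i, pd i P x ^ 2
    set q := lap Q x + ∑ i, pd i Q x ^ 2
    have ea : exp (u x) = exp (u x / 2) ^ 2 := by rw [← exp_nat_mul]; congr 1; push_cast; ring
    have eb : exp (v x) = exp (v x / 2) ^ 2 := by rw [← exp_nat_mul]; congr 1; push_cast; ring
    rw [ea] at l4
    rw [eb] at l3 l5
    have hpq : p + q ≤ - (2 * (sl * sm * (exp (u x / 2) * exp (v x / 2)))) := by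
      set r := ψ x / φ x with hr
      have hr0 : 0 < r := div_pos p2 p1
      have hp' : p = -(sm ^ 2 * exp (v x / 2) ^ 2 * r) - lam1 := by
        rw [hr]; field_simp; linarith
      have hq' : q = -(sl ^ 2 * exp (u x / 2) ^ 2 / r) - lam1 := by
        rw [hr]; field_simp; linarith
      have hx2 : 2 * (sl * sm * (exp (u x / 2) * exp (v x / 2))) ≤
          sm ^ 2 * exp (v x / 2) ^ 2 * r + sl ^ 2 * exp (u x / 2) ^ 2 / r := by
        have : sm ^ 2 * exp (v x / 2) ^ 2 * r + sl ^ 2 * exp (u x / 2) ^ 2 / r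
           - 2 * (sl * sm * (exp (u x / 2) * exp (v x / 2))) =
            (sm * exp (v x / 2) * r - sl * exp (u x / 2)) ^ 2 / r := by
          field_simp; ring
        have h2 : 0 ≤ (sm * exp (v x / 2) * r - sl * exp (u x / 2)) ^ 2 / r := by positivity
        linarith
      rw [hp', hq']; linarith
    have h4 : 0 ≤ tx (u x) ^ 4 / 2 := by positivity
    have h5 := mul_le_mul_of_nonneg_left hpq h4
    have h6 : lap u x = -(sm ^ 2 * exp (v x / 2) ^ 2) := by linarith
    rw [h6]
    simp only [hR]
    linarith
  have hintg : ∫ x, ∑ i, pd i (Ω.indicator (f i)) x = 0 := by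
    rw [integral_finsetSum]
    · exact Finset.sum_eq_zero fun i _ => integral_pd_zero (hext i).1 (hext i).2 i
    · exact fun i _ => (continuous_pd (hext i).1 i).integrable_of_hasCompactSupport
        (hasCompactSupport_pd (hext i).2 i)
  have cu : ContinuousOn (fun x => tx (u x)) (closure Ω) := continuous_tx.comp_continuousOn huc
  have i1 : IntegrableOn (fun x => exp (v x / 2) ^ 2 * Z (u x)) Ω := by
    refine IntegrableOn.mono_set (ContinuousOn.integrableOn_compact hcl ?_) subset_closure
    have : ContinuousOn (fun x => Z (u x)) (closure Ω) := hZc.continuous.comp_continuousOn huc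
    exact ((hv.div_const 2).rexp.pow 2).mul this
  have i2 : IntegrableOn (fun x => exp (u x / 2) * exp (v x / 2) * tx (u x) ^ 4) Ω := by
    refine IntegrableOn.mono_set (ContinuousOn.integrableOn_compact hcl ?_) subset_closure
    fun_prop
  have hRi : IntegrableOn R Ω := (i1.const_mul _).sub (i2.const_mul _)
  have hfin : 0 ≤ ∫ x in Ω, R x := by
    rw [← hintg, ← integral_indicator ho.measurableSet]
    refine integral_mono ?_ (hRi.integrable_indicator ho.measurableSet) hpt
    exact integrable_finsetSum _ fun i _ =>
      (continuous_pd (hext i).1 i).integrable_of_hasCompactSupport (hasCompactSupport_pd (hext i).2 i)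
  rw [hR, integral_sub (i1.const_mul _) (i2.const_mul _), integral_const_mul, integral_const_mul] at hfin
  have : sm * (sl * ∫ x in Ω, exp (u x / 2) * exp (v x / 2) * tx (u x) ^ 4) ≤
      sm * (sm * ∫ x in Ω, exp (v x / 2) ^ 2 * Z (u x)) := by linarith
  exact le_of_mul_le_mul_left this hsm

end Energy

section EB
open Filter Topology

variable {N : ℕ} {u v w : EuclideanSpace ℝ (Fin N) → ℝ}

lemma scal1 {a X : ℝ} (ha : 0 < a) (hX : X = max (a - 2) 0) :
    3 / 4 * a ^ 4 - 100000 ≤ X ^ 4 ∧ X ^ 4 / 2 + 4 / 3 * X ^ 3 ≤ a ^ 4 / 2 := by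
  have hX0 : 0 ≤ X := hX ▸ le_max_right _ _
  have haX : a ≤ X + 2 := by
    have : a - 2 ≤ X := hX ▸ le_max_left _ _
    linarith
  constructor
  · have h1 : a ^ 4 ≤ (X + 2) ^ 4 := by gcongr
    have h2 : 0 ≤ (X * (X - 36)) ^ 2 := sq_nonneg _
    have h3 : 0 ≤ (X ^ 2 - 169 * 9 / 2) ^ 2 := sq_nonneg _
    have h4 : 0 ≤ (X - 16) ^ 2 := sq_nonneg _
    have h5 : 0 ≤ X ^ 4 := by positivity
    nlinarith
  · rcases le_total (a - 2) 0 with h | h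
    · rw [max_eq_right h] at hX
      rw [hX]; norm_num; positivity
    · rw [max_eq_left h] at hX
      have : a = X + 2 := by linarith
      rw [this]
      nlinarith [pow_nonneg hX0 2, pow_nonneg hX0 3, pow_nonneg hX0 4]

lemma scal2 {a b κ X Y : ℝ} (ha : 0 < a) (hb : 0 < b) (hκ : 0 < κ) (hX : X = max (a - 2) 0)
    (hY : Y = max (b - 2) 0) {c : ℝ} (hc : c = 100000 * (1 + κ ^ 4)) :
    1 / 8 * (a * (κ * b) * (a ^ 4 + (κ * b) ^ 4)) - c * (1 + 4 * c) ≤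
      κ * (a * b * X ^ 4) - κ ^ 2 * (b ^ 2 * (X ^ 4 / 2 + 4 / 3 * X ^ 3)) +
      κ ^ 4 * (κ * (a * b * Y ^ 4) - (a ^ 2 * (Y ^ 4 / 2 + 4 / 3 * Y ^ 3))) := by
  obtain ⟨h1, h2⟩ := scal1 ha hX
  obtain ⟨h3, h4⟩ := scal1 hb hY
  set B := κ * b with hB
  have hB0 : 0 < B := mul_pos hκ hb
  have e1 : κ * (a * b) * (3 / 4 * a ^ 4 - 100000) ≤ κ * (a * b) * X ^ 4 :=
    mul_le_mul_of_nonneg_left h1 (by positivity)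
  have e2 : κ ^ 4 * (κ * (a * b)) * (3 / 4 * b ^ 4 - 100000) ≤ κ ^ 4 * (κ * (a * b)) * Y ^ 4 :=
    mul_le_mul_of_nonneg_left h3 (by positivity)
  have e3 : κ ^ 2 * b ^ 2 * (X ^ 4 / 2 + 4 / 3 * X ^ 3) ≤ κ ^ 2 * b ^ 2 * (a ^ 4 / 2) :=
    mul_le_mul_of_nonneg_left h2 (by positivity)
  have e4 : κ ^ 4 * a ^ 2 * (Y ^ 4 / 2 + 4 / 3 * Y ^ 3) ≤ κ ^ 4 * a ^ 2 * (b ^ 4 / 2) :=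
    mul_le_mul_of_nonneg_left h4 (by positivity)
  have e5 : 0 ≤ a * B * ((a - B) ^ 2 * (a ^ 2 + a * B + B ^ 2)) := by positivity
  have hc0 : 0 < c := by rw [hc]; positivity
  set P := a * B with hP
  have hP0 : 0 < P := by positivity
  have e6 : 2 * P ^ 2 ≤ a ^ 4 + B ^ 4 := by
    have := sq_nonneg (a ^ 2 - B ^ 2); rw [hP]; nlinarith
  have e7 : c * P ≤ 1 / 8 * (P * (a ^ 4 + B ^ 4)) + c * (1 + 4 * c) := by
    by_cases h : 4 * c ≤ P ^ 2
    · have : P * (8 * c) ≤ P * (a ^ 4 + B ^ 4) := mul_le_mul_of_nonneg_left (by linarith) hP0.le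
      nlinarith [mul_pos hc0 hc0]
    · push Not at h
      have : P ≤ 1 + 4 * c := by nlinarith [sq_nonneg (P - 1)]
      have h8 := mul_le_mul_of_nonneg_left this hc0.le
      have : 0 ≤ 1 / 8 * (P * (a ^ 4 + B ^ 4)) := by positivity
      linarith
  have e8 : κ ^ 4 * b ^ 4 = B ^ 4 := by rw [hB]; ring
  have e9 : κ * (a * b) = P := by rw [hP, hB]; ring
  have e10 : κ ^ 2 * b ^ 2 = B ^ 2 := by rw [hB]; ring
  rw [e9] at e1 e2
  rw [e10] at e3
  have e11 : c * P = P * 100000 + κ ^ 4 * P * 100000 := by rw [hc]; ring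
  have g1 : κ ^ 4 * P * (3 / 4 * b ^ 4 - 100000) = 3 / 4 * P * B ^ 4 - κ ^ 4 * P * 100000 := by
    rw [← e8]; ring
  have g2 : κ ^ 4 * a ^ 2 * (b ^ 4 / 2) = a ^ 2 * B ^ 4 / 2 := by rw [← e8]; ring
  have g3 : κ * (a * b * X ^ 4) = P * X ^ 4 := by rw [← e9]; ring
  have g4 : κ * (a * b * Y ^ 4) = P * Y ^ 4 := by rw [← e9]; ring
  have g5 : κ ^ 2 * (b ^ 2 * (X ^ 4 / 2 + 4 / 3 * X ^ 3)) = B ^ 2 * (X ^ 4 / 2 + 4 / 3 * X ^ 3) := by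
    rw [← e10]; ring
  rw [g3, g4, g5]
  rw [g1] at e2
  rw [g2] at e4
  have g6 : P * ((a - B) ^ 2 * (a ^ 2 + a * B + B ^ 2)) = P * (a ^ 4 + B ^ 4) - B ^ 2 * a ^ 4 - a ^ 2 * B ^ 4 := by
    rw [hP]; ring
  rw [g6] at e5
  linarith

lemma energy_bound {Ω : Set (EuclideanSpace ℝ (Fin N))} (ho : IsOpen Ω)
    (hb : Bornology.IsBounded Ω) (Λ : ℝ) (hΛ : 0 < Λ) : ∃ C : ℝ, 0 ≤ C ∧ 
      ∀ (lam mu : ℝ), 0 < lam → 0 < mu → lam / mu + mu / lam ≤ Λ →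
        ∀ (u v : EuclideanSpace ℝ (Fin N) → ℝ), IsStableGelfandSolution Ω lam mu u v →
        ∫ x in Ω, exp (u x / 2) ^ 5 * exp (v x / 2) ≤ C ∧
        ∫ x in Ω, exp (v x / 2) ^ 5 * exp (u x / 2) ≤ C := by
  set c := 100000 * (1 + Λ ^ 2) with hc
  have hc0 : 0 < c := by positivity
  set C1 := 8 * (c * (1 + 4 * c)) * (volume Ω).toReal with hC1
  have hC10 : 0 ≤ C1 := by positivity
  refine ⟨(1 + Λ) ^ 5 * C1, by positivity, ?_⟩
  rintro lam mu hl hm hr u v ⟨⟨hu, hv, hu1, hv1, hu0, hv0⟩, lam1, φ, ψ, hl1, hφ, hψ, hφ0, hψ0, hφ1, hψ1, -, -⟩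
  set sl := √lam with hsl
  set sm := √mu with hsm
  have hsl0 : 0 < sl := sqrt_pos.2 hl
  have hsm0 : 0 < sm := sqrt_pos.2 hm
  have hsl2 : sl ^ 2 = lam := sq_sqrt hl.le
  have hsm2 : sm ^ 2 = mu := sq_sqrt hm.le
  rw [← hsl2] at hv1 hψ1
  rw [← hsm2] at hu1 hφ1
  have E1 := energy_one ho hb hsm0 hl1 hu hv.continuousOn hu1 hu0 hφ hψ hφ0 hψ0 hφ1 hψ1
  have E2 := energy_one ho hb hsl0 hl1 hv hu.continuousOn hv1 hv0 hψ hφ hψ0 hφ0 hψ1 hφ1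
  set κ := sm / sl with hκ
  have hκ0 : 0 < κ := div_pos hsm0 hsl0
  have hlm : 0 < lam / mu := div_pos hl hm
  have hml : 0 < mu / lam := div_pos hm hl
  have hκ2 : κ ^ 2 ≤ Λ := by
    rw [hκ, div_pow, hsl2, hsm2]; linarith
  have hκ2' : κ⁻¹ ^ 2 ≤ Λ := by
    rw [hκ, inv_div, div_pow, hsl2, hsm2]; linarith
  have hκ4 : κ ^ 4 ≤ Λ ^ 2 := by
    calc κ ^ 4 = (κ ^ 2) ^ 2 := by ring
      _ ≤ Λ ^ 2 := by gcongr
  have hκi : κ⁻¹ ≤ 1 + Λ := by nlinarith [sq_nonneg (κ⁻¹ - 1)]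
  have hκi0 : 0 < κ⁻¹ := inv_pos.2 hκ0
  have hcl : IsCompact (closure Ω) := hb.isCompact_closure
  have huc := hu.continuousOn
  have hvc := hv.continuousOn
  have cu : ContinuousOn (fun x => tx (u x)) (closure Ω) := continuous_tx.comp_continuousOn huc
  have cv : ContinuousOn (fun x => tx (v x)) (closure Ω) := continuous_tx.comp_continuousOn hvc
  have ca : ContinuousOn (fun x => exp (u x / 2)) (closure Ω) := (huc.div_const 2).rexp
  have cb : ContinuousOn (fun x => exp (v x / 2)) (closure Ω) := (hvc.div_const 2).rexp
  have II : ∀ f : EuclideanSpace ℝ (Fin N) → ℝ, ContinuousOn f (closure Ω) → IntegrableOn f Ω :=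
    fun f hf => IntegrableOn.mono_set (ContinuousOn.integrableOn_compact hcl hf) subset_closure
  have i1 : IntegrableOn (fun x => exp (u x / 2) * exp (v x / 2) * tx (u x) ^ 4) Ω := II _ ((ca.mul cb).mul (cu.pow 4))
  have i2 : IntegrableOn (fun x => exp (v x / 2) ^ 2 * (tx (u x) ^ 4 / 2 + 4 / 3 * tx (u x) ^ 3)) Ω := II _ ((cb.pow 2).mul (((cu.pow 4).div_const 2).add ((cu.pow 3).const_mul (4/3))))
  have i3 : IntegrableOn (fun x => exp (v x / 2) * exp (u x / 2) * tx (v x) ^ 4) Ω := II _ ((cb.mul ca).mul (cv.pow 4))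
  have i4 : IntegrableOn (fun x => exp (u x / 2) ^ 2 * (tx (v x) ^ 4 / 2 + 4 / 3 * tx (v x) ^ 3)) Ω := II _ ((ca.pow 2).mul (((cv.pow 4).div_const 2).add ((cv.pow 3).const_mul (4/3))))
  have i5 : IntegrableOn (fun x => exp (u x / 2) ^ 5 * exp (v x / 2)) Ω := II _ ((ca.pow 5).mul cb)
  have i6 : IntegrableOn (fun x => exp (v x / 2) ^ 5 * exp (u x / 2)) Ω := II _ ((cb.pow 5).mul ca)
  have hk : sm = κ * sl := by rw [hκ]; field_simp
  set I1 := ∫ x in Ω, exp (u x / 2) * exp (v x / 2) * tx (u x) ^ 4 with hI1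
  set I2 := ∫ x in Ω, exp (v x / 2) ^ 2 * (tx (u x) ^ 4 / 2 + 4 / 3 * tx (u x) ^ 3) with hI2
  set I3 := ∫ x in Ω, exp (v x / 2) * exp (u x / 2) * tx (v x) ^ 4 with hI3
  set I4 := ∫ x in Ω, exp (u x / 2) ^ 2 * (tx (v x) ^ 4 / 2 + 4 / 3 * tx (v x) ^ 3) with hI4
  have E1' : I1 ≤ κ * I2 := by
    rw [hk] at E1
    have : sl * I1 ≤ sl * (κ * I2) := by linarith
    exact le_of_mul_le_mul_left this hsl0
  have E2' : κ * I3 ≤ I4 := by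
    rw [hk] at E2
    have : sl * (κ * I3) ≤ sl * I4 := by linarith
    exact le_of_mul_le_mul_left this hsl0
  have hT : κ * I1 - κ ^ 2 * I2 + κ ^ 4 * (κ * I3 - I4) ≤ 0 := by
    have h1 : κ * I1 ≤ κ * (κ * I2) := mul_le_mul_of_nonneg_left E1' hκ0.le
    have h2 : κ ^ 4 * (κ * I3 - I4) ≤ 0 := mul_nonpos_of_nonneg_of_nonpos (by positivity) (by linarith)
    nlinarith
  set J1 := ∫ x in Ω, exp (u x / 2) ^ 5 * exp (v x / 2) with hJ1
  set J2 := ∫ x in Ω, exp (v x / 2) ^ 5 * exp (u x / 2) with hJ2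
  have J10 : 0 ≤ J1 := integral_nonneg fun x => by positivity
  have J20 : 0 ≤ J2 := integral_nonneg fun x => by positivity
  have hmain : 1 / 8 * (κ * J1 + κ ^ 5 * J2) - c * (1 + 4 * c) * (volume Ω).toReal ≤ 
      κ * I1 - κ ^ 2 * I2 + κ ^ 4 * (κ * I3 - I4) := by
    have hvol : volume Ω ≠ ⊤ := hb.measure_lt_top.ne
    have ic : IntegrableOn (fun _ : EuclideanSpace ℝ (Fin N) => c * (1 + 4 * c)) Ω :=
      integrableOn_const hvol
    have j1 : IntegrableOn (fun x => 1 / 8 * (κ * (exp (u x / 2) ^ 5 * exp (v x / 2)) +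
        κ ^ 5 * (exp (v x / 2) ^ 5 * exp (u x / 2)))) Ω :=
      ((i5.const_mul _).add (i6.const_mul _)).const_mul _
    have j2 : IntegrableOn (fun x => κ * (exp (u x / 2) * exp (v x / 2) * tx (u x) ^ 4) -
        κ ^ 2 * (exp (v x / 2) ^ 2 * (tx (u x) ^ 4 / 2 + 4 / 3 * tx (u x) ^ 3))) Ω :=
      (i1.const_mul _).sub (i2.const_mul _)
    have j3 : IntegrableOn (fun x => κ ^ 4 * (κ * (exp (v x / 2) * exp (u x / 2) * tx (v x) ^ 4) -
          exp (u x / 2) ^ 2 * (tx (v x) ^ 4 / 2 + 4 / 3 * tx (v x) ^ 3))) Ω :=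
      ((i3.const_mul _).sub i4).const_mul _
    have L : ∫ x in Ω, (1 / 8 * (κ * (exp (u x / 2) ^ 5 * exp (v x / 2)) +
        κ ^ 5 * (exp (v x / 2) ^ 5 * exp (u x / 2))) - c * (1 + 4 * c)) =
        1 / 8 * (κ * J1 + κ ^ 5 * J2) - c * (1 + 4 * c) * (volume Ω).toReal := by
      rw [integral_sub j1 ic, integral_const_mul,
        integral_add (i5.const_mul _) (i6.const_mul _), integral_const_mul, integral_const_mul,
        setIntegral_const, smul_eq_mul]
      rw [measureReal_def]; ring
    have Rr : ∫ x in Ω, (κ * (exp (u x / 2) * exp (v x / 2) * tx (u x) ^ 4) -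
        κ ^ 2 * (exp (v x / 2) ^ 2 * (tx (u x) ^ 4 / 2 + 4 / 3 * tx (u x) ^ 3)) +
        κ ^ 4 * (κ * (exp (v x / 2) * exp (u x / 2) * tx (v x) ^ 4) -
          exp (u x / 2) ^ 2 * (tx (v x) ^ 4 / 2 + 4 / 3 * tx (v x) ^ 3))) =
        κ * I1 - κ ^ 2 * I2 + κ ^ 4 * (κ * I3 - I4) := by
      rw [integral_add j2 j3,
        integral_sub (i1.const_mul _) (i2.const_mul _), integral_const_mul, integral_const_mul,
        integral_const_mul, integral_sub (i3.const_mul _) i4, integral_const_mul]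
    rw [← L, ← Rr]
    refine integral_mono (j1.sub ic) (j2.add j3) fun x => ?_
    have := scal2 (a := exp (u x / 2)) (b := exp (v x / 2)) (exp_pos _) (exp_pos _) hκ0
      (X := tx (u x)) (Y := tx (v x)) rfl rfl rfl
    set c' := 100000 * (1 + κ ^ 4) with hc'
    have hcc : c' ≤ c := by rw [hc, hc']; linarith
    have hc'0 : 0 < c' := by positivity
    have hcc2 : c' * (1 + 4 * c') ≤ c * (1 + 4 * c) := by gcongr
    show 1 / 8 * (κ * (exp (u x / 2) ^ 5 * exp (v x / 2)) +
        κ ^ 5 * (exp (v x / 2) ^ 5 * exp (u x / 2))) - c * (1 + 4 * c) ≤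
        (κ * (exp (u x / 2) * exp (v x / 2) * tx (u x) ^ 4) -
        κ ^ 2 * (exp (v x / 2) ^ 2 * (tx (u x) ^ 4 / 2 + 4 / 3 * tx (u x) ^ 3)) +
        κ ^ 4 * (κ * (exp (v x / 2) * exp (u x / 2) * tx (v x) ^ 4) -
          exp (u x / 2) ^ 2 * (tx (v x) ^ 4 / 2 + 4 / 3 * tx (v x) ^ 3)))
    linarith
  have hS : κ * J1 + κ ^ 5 * J2 ≤ C1 := by rw [hC1]; linarith
  have k1 : 1 ≤ 1 + Λ := by linarith
  have a1 : κ * J1 ≤ C1 := by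
    have : 0 ≤ κ ^ 5 * J2 := by positivity
    linarith
  have a2 : κ ^ 5 * J2 ≤ C1 := by
    have : 0 ≤ κ * J1 := by positivity
    linarith
  constructor
  · calc J1 = κ⁻¹ * (κ * J1) := by field_simp
      _ ≤ (1 + Λ) ^ 5 * C1 := by
        have : κ⁻¹ ≤ (1 + Λ) ^ 5 := hκi.trans (le_self_pow₀ k1 (by norm_num))
        gcongr
  · calc J2 = κ⁻¹ ^ 5 * (κ ^ 5 * J2) := by field_simp
      _ ≤ (1 + Λ) ^ 5 * C1 := by gcongr

end EB

section SB
open Filter Topology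
variable {N : ℕ} {u v w : EuclideanSpace ℝ (Fin N) → ℝ}

noncomputable def kG (y : EuclideanSpace ℝ (Fin N)) : ℝ := max (1 - ‖y‖ ^ 2) 0 ^ 2
noncomputable def kK (y : EuclideanSpace ℝ (Fin N)) : ℝ := 1 / 6 * max (1 - ‖y‖ ^ 2) 0 ^ 3

lemma contDiff_nsq0 {n} : ContDiff ℝ n (fun y : EuclideanSpace ℝ (Fin N) => ‖y‖ ^ 2) := contDiff_norm_sq ℝ

lemma kK_contDiff : ContDiff ℝ 2 (kK (N := N)) := by
  have h := (contDiff_posPow 2).comp ((contDiff_const (c := (1:ℝ))).sub (contDiff_nsq0 (N := N) (n := 2)))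
  exact contDiff_const.mul h

lemma kG_cont : Continuous (kG (N := N)) := by
  unfold kG; fun_prop

lemma kG_nonneg (y : EuclideanSpace ℝ (Fin N)) : 0 ≤ kG y := by unfold kG; positivity
lemma kK_nonneg (y : EuclideanSpace ℝ (Fin N)) : 0 ≤ kK y := by unfold kK; positivity

lemma kG_le (y : EuclideanSpace ℝ (Fin N)) : kG y ≤ 1 := by
  unfold kG
  have h : max (1 - ‖y‖ ^ 2) 0 ≤ 1 := max_le (by nlinarith [sq_nonneg ‖y‖]) (by norm_num)
  exact pow_le_one₀ (le_max_right _ _) h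

lemma kmax_zero {y : EuclideanSpace ℝ (Fin N)} (hy : y ∉ Metric.closedBall (0 : EuclideanSpace ℝ (Fin N)) 1) :
    max (1 - ‖y‖ ^ 2) 0 = 0 := by
  simp only [Metric.mem_closedBall, dist_zero_right, not_le] at hy
  exact max_eq_right (by nlinarith)

lemma kG_supp : HasCompactSupport (kG (N := N)) :=
  HasCompactSupport.intro (isCompact_closedBall 0 1) fun y hy => by
    unfold kG; rw [kmax_zero hy]; norm_num

lemma kK_supp : HasCompactSupport (kK (N := N)) :=
  HasCompactSupport.intro (isCompact_closedBall 0 1) fun y hy => by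
    unfold kK; rw [kmax_zero hy]; norm_num

lemma pd_kK (i : Fin N) (y : EuclideanSpace ℝ (Fin N)) : pd i kK y = - (y i * kG y) := by
  have h1 : HasFDerivAt (fun y : EuclideanSpace ℝ (Fin N) => ‖y‖ ^ 2) _ y :=
    ((contDiff_nsq0 (N := N) (n := 1)).differentiable (by norm_num) y).hasFDerivAt
  have h2 := (hasDerivAt_posPow 1 (1 - ‖y‖ ^ 2)).comp_hasFDerivAt y (h1.const_sub 1)
  have h3 := h2.const_mul (1 / 6 : ℝ)
  have h4 : pd i kK y = _ := congrArg (fun l => l (EuclideanSpace.single i 1)) h3.fderiv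
  rw [h4]
  have h5 : fderiv ℝ (fun y : EuclideanSpace ℝ (Fin N) => ‖y‖ ^ 2) y (EuclideanSpace.single i 1) = 2 * y i :=
    by
      have h := pd_normsq (N := N) (x := y) (i := i) 0
      simp only [sub_zero, PiLp.zero_apply] at h
      exact h
  simp only [ContinuousLinearMap.smul_apply, ContinuousLinearMap.neg_apply, smul_eq_mul, kG]
  rw [h5]
  push_cast
  ring

lemma int_cs {f g : EuclideanSpace ℝ (Fin N) → ℝ} (hf : Continuous f) (hs : HasCompactSupport f)
    (hg : Continuous g) : Integrable (fun y => f y * g y) :=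
  (hf.mul hg).integrable_of_hasCompactSupport hs.mul_right

lemma M_hasDeriv {q : EuclideanSpace ℝ (Fin N) → ℝ} (hq : ContDiff ℝ 2 q) (hs : HasCompactSupport q)
    (x0 : EuclideanSpace ℝ (Fin N)) (r : ℝ) :
    HasDerivAt (fun r => ∫ y, kG y * q (x0 + r • y)) (r * ∫ y, kK y * lap q (x0 + r • y)) r := by
  have hq1 : ContDiff ℝ 1 q := hq.of_le (by norm_num)
  have cf : Continuous (fderiv ℝ q) := hq1.continuous_fderiv (by norm_num)
  have sf : HasCompactSupport (fderiv ℝ q) := hs.fderiv ℝ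
  obtain ⟨B, hB⟩ := cf.bounded_above_of_compact_support sf
  have key : HasDerivAt (fun r => ∫ y, kG y * q (x0 + r • y))
      (∫ y, kG y * fderiv ℝ q (x0 + r • y) y) r := by
    refine (hasDerivAt_integral_of_dominated_loc_of_deriv_le (μ := volume)
      (F := fun (r : ℝ) (y : EuclideanSpace ℝ (Fin N)) => kG y * q (x0 + r • y)) 
      (F' := fun (r : ℝ) (y : EuclideanSpace ℝ (Fin N)) => kG y * fderiv ℝ q (x0 + r • y) y)
      (bound := fun y => kG y * (B * ‖y‖)) (s := Set.univ) univ_mem ?_ ?_ ?_ ?_ ?_ ?_).2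
    · refine Eventually.of_forall fun s => ?_
      have : Continuous fun y => kG y * q (x0 + s • y) :=
        kG_cont.mul (hq.continuous.comp (by fun_prop))
      exact this.aestronglyMeasurable
    · exact int_cs kG_cont kG_supp (hq.continuous.comp (by fun_prop))
    · have : Continuous fun y => kG y * fderiv ℝ q (x0 + r • y) y :=
        kG_cont.mul ((cf.comp (by fun_prop : Continuous fun y : EuclideanSpace ℝ (Fin N) => x0 + r • y)).clm_apply continuous_id)
      exact this.aestronglyMeasurable
    · refine Eventually.of_forall fun y s _ => ?_
      rw [norm_mul, norm_of_nonneg (kG_nonneg y)]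
      refine mul_le_mul_of_nonneg_left ?_ (kG_nonneg y)
      exact (ContinuousLinearMap.le_opNorm _ _).trans (mul_le_mul_of_nonneg_right (hB _) (norm_nonneg _))
    · exact int_cs kG_cont kG_supp (by fun_prop)
    · refine Eventually.of_forall fun y s _ => ?_
      have h1 : HasDerivAt (fun s : ℝ => x0 + s • y) y s := by
        simpa using ((hasDerivAt_id s).smul_const y).const_add x0
      exact (((hq.differentiable (by norm_num) _).hasFDerivAt).comp_hasDerivAt s h1).const_mul _
  convert key using 1
  have cpd : ∀ i, ContDiff ℝ 1 (pd i q) := fun i =>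
    contDiff_iff_contDiffAt.2 fun x => hq.contDiffAt.pd1
  have tr : ContDiff ℝ 1 (fun y : EuclideanSpace ℝ (Fin N) => x0 + r • y) := by fun_prop
  have pdc : ∀ i y, pd i (fun y => pd i q (x0 + r • y)) y = r * pd i (pd i q) (x0 + r • y) := by
    intro i y
    have h1 : HasFDerivAt (fun y : EuclideanSpace ℝ (Fin N) => x0 + r • y)
        (r • ContinuousLinearMap.id ℝ _) y := ((hasFDerivAt_id y).const_smul r).const_add x0
    have h2 := (((cpd i).differentiable (by norm_num) (x0 + r • y)).hasFDerivAt).comp y h1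
    have : pd i (fun y => pd i q (x0 + r • y)) y = _ := 
      congrArg (fun l => l (EuclideanSpace.single i 1)) h2.fderiv
    rw [this]
    simp [pd]
  have ip : ∀ i, ∫ y, y i * kG y * pd i q (x0 + r • y) = ∫ y, kK y * (r * pd i (pd i q) (x0 + r • y)) := by
    intro i
    have hw : ContDiff ℝ 1 (fun y => kK y * pd i q (x0 + r • y)) :=
      (kK_contDiff.of_le (by norm_num)).mul ((cpd i).comp tr)
    have h0 := integral_pd_zero hw (kK_supp.mul_right) i
    have e : ∀ y, pd i (fun y => kK y * pd i q (x0 + r • y)) y =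
        kK y * (r * pd i (pd i q) (x0 + r • y)) - y i * kG y * pd i q (x0 + r • y) := by
      intro y
      rw [pd_mul (v := fun y => pd i q (x0 + r • y)) ((kK_contDiff.differentiable (by norm_num)) y) (((cpd i).comp tr).differentiable (by norm_num) y),
        pd_kK, pdc]
      ring
    simp_rw [e] at h0
    rw [integral_sub] at h0
    · linarith
    · exact int_cs kK_contDiff.continuous kK_supp (continuous_const.mul ((continuous_pd (cpd i) i).comp (by fun_prop)))
    · have := int_cs kG_cont kG_supp (g := fun y => y i * pd i q (x0 + r • y))
        ((by fun_prop : Continuous fun y : EuclideanSpace ℝ (Fin N) => y i).mul ((continuous_pd hq1 i).comp (by fun_prop)))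
      refine this.congr (Eventually.of_forall fun y => ?_)
      simp only; ring
  have e1 : ∀ y : EuclideanSpace ℝ (Fin N), kG y * fderiv ℝ q (x0 + r • y) y = ∑ i, y i * kG y * pd i q (x0 + r • y) := by
    intro y
    rw [fderiv_apply_eq_sum, Finset.mul_sum]
    exact Finset.sum_congr rfl fun i _ => by ring
  simp_rw [e1]
  rw [integral_finsetSum]
  · simp_rw [ip]
    rw [← integral_const_mul, ← integral_finsetSum]
    · refine integral_congr_ae (Eventually.of_forall fun y => ?_)
      simp only [lap_eq, Finset.mul_sum]
      exact Finset.sum_congr rfl fun i _ => by ring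
    · intro i _
      exact int_cs kK_contDiff.continuous kK_supp (continuous_const.mul ((continuous_pd (cpd i) i).comp (by fun_prop)))
  · intro i _
    have := int_cs kG_cont kG_supp (g := fun y => y i * pd i q (x0 + r • y))
        ((by fun_prop : Continuous fun y : EuclideanSpace ℝ (Fin N) => y i).mul ((continuous_pd hq1 i).comp (by fun_prop)))
    refine this.congr (Eventually.of_forall fun y => ?_)
    simp only; ring

lemma sub_bound (hN3 : N ≤ 3) (C1 C2 : ℝ) : ∃ C : ℝ, ∀ (q F : EuclideanSpace ℝ (Fin N) → ℝ),
    ContDiff ℝ 2 q → HasCompactSupport q → (∀ x, 0 ≤ q x) → Continuous F → HasCompactSupport F →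
    (∀ x, - lap q x ≤ F x) → ∫ x, q x ≤ C1 → ∫ x, F x ^ 2 ≤ C2 → ∀ x0, q x0 ≤ C := by
  set I := ∫ y : EuclideanSpace ℝ (Fin N), kG y with hI
  set cK := ∫ y : EuclideanSpace ℝ (Fin N), kK y ^ 2 with hcK
  have hI0 : 0 < I := by
    refine kG_cont.integral_pos_of_hasCompactSupport_nonneg_nonzero kG_supp kG_nonneg (x := 0) ?_
    simp [kG]
  refine ⟨(C1 + (C2 + cK)) / I, fun q F hq hqs hq0 hF hFs hqF h1 h2 x0 => ?_⟩
  rw [le_div_iff₀ hI0]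
  set M : ℝ → ℝ := fun r => ∫ y, kG y * q (x0 + r • y) with hM
  have hd : ∀ s : ℝ, HasDerivAt (fun s => M (s ^ 2) + (C2 + cK) * s)
      (s ^ 2 * (∫ y, kK y * lap q (x0 + s ^ 2 • y)) * (2 * s) + (C2 + cK)) s := by
    intro s
    have a := (M_hasDeriv hq hqs x0 (s ^ 2)).comp s (by simpa using hasDerivAt_pow 2 s : HasDerivAt (fun s : ℝ => s ^ 2) (2 * s) s)
    have b := (hasDerivAt_id s).const_mul (C2 + cK)
    rw [mul_one] at b
    exact a.fun_add b
  have hlapc : Continuous (lap q) := by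
    have : lap q = fun x => ∑ i, pd i (pd i q) x := rfl
    rw [this]
    refine continuous_finsetSum _ fun i _ => continuous_pd ?_ i
    exact contDiff_iff_contDiffAt.2 fun x => hq.contDiffAt.pd1
  have hnn : ∀ s ∈ Set.Ioo (0:ℝ) 1, 0 ≤ s ^ 2 * (∫ y, kK y * lap q (x0 + s ^ 2 • y)) * (2 * s) + (C2 + cK) := by
    rintro s ⟨hs0, hs1⟩
    have hsc : Continuous fun y : EuclideanSpace ℝ (Fin N) => x0 + s ^ 2 • y := by fun_prop
    have hF2s : HasCompactSupport fun x => F x ^ 2 := by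
      refine hFs.comp_left (g := fun t : ℝ => t ^ 2) (by norm_num)
    have hFi : Integrable (fun y => F (x0 + s ^ 2 • y) ^ 2) := by
      have : Integrable (fun x => F (x0 + x) ^ 2) := by
        have := ((hF.pow 2).integrable_of_hasCompactSupport (μ := volume) hF2s).comp_add_left x0
        exact this
      exact (integrable_comp_smul_iff volume (fun x => F (x0 + x) ^ 2) (by positivity : s ^ 2 ≠ 0)).2 this
    have hFe : ∫ y, F (x0 + s ^ 2 • y) ^ 2 = ((s ^ 2) ^ N)⁻¹ * ∫ x, F x ^ 2 := by
      have a := Measure.integral_comp_smul volume (fun x => F (x0 + x) ^ 2) (s ^ 2)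
      rw [a, integral_add_left_eq_self (fun x => F x ^ 2) x0]
      rw [finrank_euclideanSpace_fin, abs_of_nonneg (by positivity), smul_eq_mul]
    have hK2 : Integrable (fun y : EuclideanSpace ℝ (Fin N) => kK y ^ 2) := by
      have := int_cs (N := N) kK_contDiff.continuous kK_supp kK_contDiff.continuous
      refine this.congr (Eventually.of_forall fun y => ?_)
      simp only; ring
    have hle : -(1 / 2 * (s ^ 3 * (∫ y, F (x0 + s ^ 2 • y) ^ 2) + (s ^ 3)⁻¹ * cK)) ≤ ∫ y, kK y * lap q (x0 + s ^ 2 • y) := by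
      have e : -(1 / 2 * (s ^ 3 * (∫ y, F (x0 + s ^ 2 • y) ^ 2) + (s ^ 3)⁻¹ * cK)) =
        ∫ y, -(1 / 2 * (s ^ 3 * F (x0 + s ^ 2 • y) ^ 2 + (s ^ 3)⁻¹ * kK y ^ 2)) := by
        rw [integral_neg, integral_const_mul, integral_add (hFi.const_mul _) (hK2.const_mul _),
          integral_const_mul, integral_const_mul]
      rw [e]
      refine integral_mono (((hFi.const_mul _).add (hK2.const_mul _)).const_mul _).neg
        (int_cs kK_contDiff.continuous kK_supp (hlapc.comp hsc)) fun y => ?_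
      have a := mul_le_mul_of_nonneg_left (hqF (x0 + s ^ 2 • y)) (kK_nonneg y)
      have b : kK y * F (x0 + s ^ 2 • y) ≤ 1 / 2 * (s ^ 3 * F (x0 + s ^ 2 • y) ^ 2 + (s ^ 3)⁻¹ * kK y ^ 2) := by
        have h3 : 0 < s ^ 3 := by positivity
        have : 0 ≤ (s ^ 3)⁻¹ * (s ^ 3 * F (x0 + s ^ 2 • y) - kK y) ^ 2 := by positivity
        have e : (s ^ 3)⁻¹ * (s ^ 3 * F (x0 + s ^ 2 • y) - kK y) ^ 2 = 
          s ^ 3 * F (x0 + s ^ 2 • y) ^ 2 - 2 * (kK y * F (x0 + s ^ 2 • y)) + (s ^ 3)⁻¹ * kK y ^ 2 := by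
          field_simp; ring
        linarith
      show -(1 / 2 * (s ^ 3 * F (x0 + s ^ 2 • y) ^ 2 + (s ^ 3)⁻¹ * kK y ^ 2)) ≤ kK y * lap q (x0 + s ^ 2 • y)
      linarith
    have hI2 : 0 ≤ ∫ x, F x ^ 2 := integral_nonneg fun x => by positivity
    have hp : s ^ 6 * ((s ^ 2) ^ N)⁻¹ ≤ 1 := by
      rw [← div_eq_mul_inv, div_le_one (by positivity), ← pow_mul]
      exact pow_le_pow_of_le_one hs0.le hs1.le (by omega)
    have hm := mul_le_mul_of_nonneg_left hle (by positivity : 0 ≤ s ^ 2 * (2 * s))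
    rw [hFe] at hm
    have e2 : s ^ 2 * (2 * s) * -(1 / 2 * (s ^ 3 * (((s ^ 2) ^ N)⁻¹ * ∫ x, F x ^ 2) + (s ^ 3)⁻¹ * cK)) =
      -((s ^ 6 * ((s ^ 2) ^ N)⁻¹) * ∫ x, F x ^ 2) - cK := by
      have h3 : s ^ 3 * (s ^ 3)⁻¹ = 1 := mul_inv_cancel₀ (by positivity)
      linear_combination (-cK) * h3
    rw [e2] at hm
    have := mul_le_mul_of_nonneg_right hp hI2
    linarith
  have mono : MonotoneOn (fun s => M (s ^ 2) + (C2 + cK) * s) (Set.Icc 0 1) := by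
    refine monotoneOn_of_deriv_nonneg (convex_Icc 0 1) ?_ ?_ ?_
    · exact fun s _ => (hd s).continuousAt.continuousWithinAt
    · exact fun s _ => (hd s).differentiableAt.differentiableWithinAt
    · intro s hs
      rw [(hd s).deriv]
      rw [interior_Icc] at hs
      exact hnn s hs
  have h := mono (Set.left_mem_Icc.2 zero_le_one) (Set.right_mem_Icc.2 zero_le_one) zero_le_one
  have hM0 : M 0 = q x0 * I := by
    rw [hM]; simp only [zero_smul, add_zero]
    rw [integral_mul_const, mul_comm]
  have hM1 : M 1 ≤ C1 := by
    rw [hM]; simp only [one_smul]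
    have qi : Integrable q := hq.continuous.integrable_of_hasCompactSupport hqs
    calc ∫ y, kG y * q (x0 + y) ≤ ∫ y, q (x0 + y) := by
          refine integral_mono (int_cs kG_cont kG_supp (hq.continuous.comp (by fun_prop))) (qi.comp_add_left x0) fun y => ?_
          simp only
          nlinarith [kG_le y, kG_nonneg y, hq0 (x0 + y)]
      _ = ∫ y, q y := integral_add_left_eq_self _ _
      _ ≤ C1 := h1
  simp only [one_pow, mul_one, mul_zero, add_zero] at h
  norm_num at h
  rw [hM0] at h
  linarith

end SB

section SC
open Filter Topology
variable {N : ℕ} {u v w : EuclideanSpace ℝ (Fin N) → ℝ}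

lemma sup_one (hN3 : N ≤ 3) {Ω : Set (EuclideanSpace ℝ (Fin N))} (ho : IsOpen Ω)
    (hb : Bornology.IsBounded Ω) (Λ E : ℝ) (hΛ : 0 ≤ Λ) : ∃ C : ℝ, ∀ (lam : ℝ), 0 < lam → lam ≤ Λ →
      ∀ (u v : EuclideanSpace ℝ (Fin N) → ℝ), ContDiffOn ℝ 2 u (closure Ω) →
        ContDiffOn ℝ 2 v (closure Ω) → (∀ x ∈ Ω, -lap v x = lam * exp (u x)) →
        (∀ x ∈ frontier Ω, v x = 0) → (∀ x ∈ Ω, 0 ≤ u x) → (∀ x ∈ Ω, 0 ≤ v x) →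
        ∫ x in Ω, exp (u x / 2) ^ 5 * exp (v x / 2) ≤ E →
        ∫ x in Ω, exp (v x / 2) ^ 5 * exp (u x / 2) ≤ E → ∀ x ∈ Ω, v x ≤ C := by
  obtain ⟨C, hC⟩ := sub_bound (N := N) hN3 (48 * E) (3456 * Λ ^ 2 * E)
  refine ⟨2 + C, fun lam hl hlΛ u v hu hv hv1 hv0 hu0 hvn hE1 hE2 => ?_⟩
  have hcl : IsCompact (closure Ω) := hb.isCompact_closure
  have huc := hu.continuousOn
  have hvc := hv.continuousOn
  obtain ⟨hK, hKΩ⟩ := superlevel_compact ho hb hvc hv0 (c := 1) (by norm_num)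
  set K := {x ∈ closure Ω | 1 ≤ v x} with hKdef
  have hm0 : ∀ x ∈ Ω, x ∉ K → max (v x - 1) 0 = 0 := by
    intro x hx hxK
    have h1 : v x < 1 := by
      by_contra h
      exact hxK ⟨subset_closure hx, not_lt.1 h⟩
    exact max_eq_right (by linarith)
  have hva : ∀ x ∈ Ω, ContDiffAt ℝ 2 v x := fun x hx => contDiffAt_of_closure ho hv hx
  have hua : ∀ x ∈ Ω, ContDiffAt ℝ 2 u x := fun x hx => contDiffAt_of_closure ho hu hx
  set q0 : EuclideanSpace ℝ (Fin N) → ℝ := fun x => max (v x - 1) 0 ^ 3 with hq0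
  set F0 : EuclideanSpace ℝ (Fin N) → ℝ := fun x => 3 * max (v x - 1) 0 ^ 2 * (lam * exp (u x)) with hF0
  have hq0c : ∀ x ∈ Ω, ContDiffAt ℝ 2 q0 x := fun x hx =>
    (contDiff_posPow 2).contDiffAt.comp x ((hva x hx).sub contDiffAt_const)
  have hq00 : ∀ x ∈ Ω, x ∉ K → q0 x = 0 := fun x hx hxK => by
    simp [hq0, hm0 x hx hxK]
  have hF00 : ∀ x ∈ Ω, x ∉ K → F0 x = 0 := fun x hx hxK => by
    simp [hF0, hm0 x hx hxK]
  have hF0c : ∀ x ∈ Ω, ContDiffAt ℝ 0 F0 x := fun x hx => by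
    have h1 : ContDiffAt ℝ 1 (fun x => max (v x - 1) 0 ^ 2) x :=
      (contDiff_posPow 1).contDiffAt.comp x (((hva x hx).sub contDiffAt_const).of_le (by norm_num))
    have h2 : ContDiffAt ℝ 0 (fun x => exp (u x)) x := ((hua x hx).exp).of_le (by norm_num)
    exact (contDiffAt_const.mul (h1.of_le (by norm_num))).mul (contDiffAt_const.mul h2)
  obtain ⟨q1, q2⟩ := ext0_contDiff ho hK hKΩ hq0c hq00
  obtain ⟨F1, F2⟩ := ext0_contDiff ho hK hKΩ hF0c hF00
  have II : ∀ f : EuclideanSpace ℝ (Fin N) → ℝ, ContinuousOn f (closure Ω) → IntegrableOn f Ω :=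
    fun f hf => IntegrableOn.mono_set (ContinuousOn.integrableOn_compact hcl hf) subset_closure
  have ca : ContinuousOn (fun x => exp (u x / 2)) (closure Ω) := (huc.div_const 2).rexp
  have cb : ContinuousOn (fun x => exp (v x / 2)) (closure Ω) := (hvc.div_const 2).rexp
  have cm : ContinuousOn (fun x => max (v x - 1) 0) (closure Ω) :=
    (hvc.sub continuousOn_const).sup continuousOn_const
  have i5 : IntegrableOn (fun x => exp (u x / 2) ^ 5 * exp (v x / 2)) Ω := II _ ((ca.pow 5).mul cb)
  have i6 : IntegrableOn (fun x => exp (v x / 2) ^ 5 * exp (u x / 2)) Ω := II _ ((cb.pow 5).mul ca)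
  have ea : ∀ x ∈ Ω, 1 ≤ exp (u x / 2) := fun x hx => one_le_exp (by have := hu0 x hx; linarith)
  have eb : ∀ x ∈ Ω, 1 ≤ exp (v x / 2) := fun x hx => one_le_exp (by have := hvn x hx; linarith)
  have em : ∀ x ∈ Ω, max (v x - 1) 0 ≤ v x := fun x hx => max_le (by linarith) (hvn x hx)
  have key := hC (Ω.indicator q0) (Ω.indicator F0) q1 q2
    (fun x => Set.indicator_nonneg (fun y _ => by simp only [hq0]; positivity) x) F1.continuous F2 ?_ ?_ ?_
  · intro x hx
    have h := key x
    rw [Set.indicator_of_mem hx] at h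
    have h0 : 0 ≤ max (v x - 1) 0 := le_max_right _ _
    have h1 : v x - 1 ≤ max (v x - 1) 0 := le_max_left _ _
    simp only [hq0] at h
    set t := max (v x - 1) 0
    have : t ≤ 1 + C := by
      by_contra hlt
      push Not at hlt
      nlinarith [pow_nonneg h0 3, sq_nonneg t, mul_nonneg h0 h0]
    linarith
  · intro x
    by_cases hx : x ∈ Ω
    swap
    · rw [lap_congr (ext0_zero hK hKΩ hq00 hx), lap_const, Set.indicator_of_notMem hx]; simp
    rw [lap_congr (ext0_eq ho q0 hx), Set.indicator_of_mem hx]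
    have hd : ∀ t : ℝ, HasDerivAt (fun t => max (t - 1) 0 ^ 3) (3 * max (t - 1) 0 ^ 2) t := by
      intro t
      have := (hasDerivAt_posPow 1 (t - 1)).comp t ((hasDerivAt_id t).sub_const 1)
      refine HasDerivAt.congr_deriv this ?_
      push_cast; ring
    have hd2 : HasDerivAt (fun t : ℝ => 3 * max (t - 1) 0 ^ 2) (6 * max (v x - 1) 0) (v x) := by
      have := ((hasDerivAt_posPow 0 (v x - 1)).comp (v x) ((hasDerivAt_id (v x)).sub_const 1)).const_mul 3
      refine HasDerivAt.congr_deriv this ?_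
      push_cast; ring
    have e := lap_comp hd hd2 (hva x hx)
    have e' : lap q0 x = _ := e
    rw [e']
    have : 0 ≤ 6 * max (v x - 1) 0 * ∑ i, pd i v x ^ 2 := by positivity
    have h1 := hv1 x hx
    simp only [hF0]
    rw [← h1]
    linarith
  · rw [integral_indicator ho.measurableSet]
    have iq : IntegrableOn q0 Ω := II _ (cm.pow 3)
    calc ∫ x in Ω, q0 x ≤ ∫ x in Ω, 48 * (exp (v x / 2) ^ 5 * exp (u x / 2)) := by
          refine setIntegral_mono_on iq (i6.const_mul 48) ho.measurableSet fun x hx => ?_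
          have h1 := pow_div_factorial_le_exp (x := v x / 2) (by have := hvn x hx; linarith) 3
          have h2 : max (v x - 1) 0 ^ 3 ≤ v x ^ 3 := pow_le_pow_left₀ (le_max_right _ _) (em x hx) 3
          have h3 := eb x hx
          have h4 := ea x hx
          have h5 : exp (v x / 2) ≤ exp (v x / 2) ^ 5 := le_self_pow₀ h3 (by norm_num)
          have h6 : exp (v x / 2) ^ 5 ≤ exp (v x / 2) ^ 5 * exp (u x / 2) := le_mul_of_one_le_right (by positivity) h4
          have h7 : (Nat.factorial 3 : ℝ) = 6 := by norm_num [Nat.factorial]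
          rw [h7] at h1
          simp only [hq0]
          have : (v x / 2) ^ 3 / 6 = v x ^ 3 / 48 := by ring
          rw [this] at h1
          linarith
      _ = 48 * ∫ x in Ω, (exp (v x / 2) ^ 5 * exp (u x / 2)) := by rw [integral_const_mul]
      _ ≤ 48 * E := by linarith
  · have e0 : ∀ x, Ω.indicator F0 x ^ 2 = Ω.indicator (fun x => F0 x ^ 2) x := by
      intro x
      by_cases hx : x ∈ Ω
      · rw [Set.indicator_of_mem hx, Set.indicator_of_mem hx]
      · rw [Set.indicator_of_notMem hx, Set.indicator_of_notMem hx]; norm_num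
    simp_rw [e0]
    rw [integral_indicator ho.measurableSet]
    have iF : IntegrableOn (fun x => F0 x ^ 2) Ω := 
      II _ (((continuousOn_const.mul (cm.pow 2)).mul (continuousOn_const.mul huc.rexp)).pow 2)
    calc ∫ x in Ω, F0 x ^ 2 ≤ ∫ x in Ω, 3456 * Λ ^ 2 * (exp (u x / 2) ^ 5 * exp (v x / 2)) := by
          refine setIntegral_mono_on iF (i5.const_mul _) ho.measurableSet fun x hx => ?_
          have h1 := pow_div_factorial_le_exp (x := v x / 2) (by have := hvn x hx; linarith) 4
          have h2 : max (v x - 1) 0 ^ 4 ≤ v x ^ 4 := pow_le_pow_left₀ (le_max_right _ _) (em x hx) 4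
          have h7 : (Nat.factorial 4 : ℝ) = 24 := by norm_num [Nat.factorial]
          rw [h7] at h1
          have e1 : (v x / 2) ^ 4 / 24 = v x ^ 4 / 384 := by ring
          rw [e1] at h1
          have h3 : max (v x - 1) 0 ^ 4 ≤ 384 * exp (v x / 2) := by linarith
          have e2 : exp (u x) = exp (u x / 2) ^ 2 := by
            rw [← exp_nat_mul]; congr 1; push_cast; ring
          have e3 : F0 x ^ 2 = 9 * lam ^ 2 * exp (u x / 2) ^ 4 * max (v x - 1) 0 ^ 4 := by
            simp only [hF0]; rw [e2]; ring
          rw [e3]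
          have h4 := ea x hx
          calc 9 * lam ^ 2 * exp (u x / 2) ^ 4 * max (v x - 1) 0 ^ 4 
              ≤ 9 * Λ ^ 2 * exp (u x / 2) ^ 5 * (384 * exp (v x / 2)) := by
                have : exp (u x / 2) ^ 4 ≤ exp (u x / 2) ^ 5 := pow_le_pow_right₀ h4 (by norm_num)
                gcongr
            _ = _ := by ring
      _ = 3456 * Λ ^ 2 * ∫ x in Ω, (exp (u x / 2) ^ 5 * exp (v x / 2)) := by rw [integral_const_mul]
      _ ≤ 3456 * Λ ^ 2 * E := by gcongr

lemma gelfand_nonneg (hN : 0 < N) {Ω : Set (EuclideanSpace ℝ (Fin N))} (ho : IsOpen Ω)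
    (hb : Bornology.IsBounded Ω) {lam mu : ℝ} (hl : 0 ≤ lam) (hm : 0 ≤ mu)
    (h : IsGelfandSolution Ω lam mu u v) : (∀ x ∈ Ω, 0 ≤ u x) ∧ ∀ x ∈ Ω, 0 ≤ v x := by
  obtain ⟨hu, hv, hu1, hv1, hu0, hv0⟩ := h
  constructor
  · refine min_principle hN ho hb hu.continuousOn (fun x hx => contDiffAt_of_closure ho hu hx) 
      (fun x hx => ?_) (fun x hx => (hu0 x hx).ge)
    have := hu1 x hx
    have : 0 ≤ mu * exp (v x) := by positivity
    linarith
  · refine min_principle hN ho hb hv.continuousOn (fun x hx => contDiffAt_of_closure ho hv hx) 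
      (fun x hx => ?_) (fun x hx => (hv0 x hx).ge)
    have := hv1 x hx
    have : 0 ≤ lam * exp (u x) := by positivity
    linarith

lemma part_one (hN : 0 < N) (hN3 : N ≤ 3) {Ω : Set (EuclideanSpace ℝ (Fin N))} (ho : IsOpen Ω)
    (hb : Bornology.IsBounded Ω) (Λ : ℝ) (hΛ : 0 < Λ) : ∃ C : ℝ, ∀ (lam mu : ℝ), 0 < lam → 0 < mu →
      lam ≤ Λ → mu ≤ Λ → lam / mu + mu / lam ≤ Λ → ∀ (u v : EuclideanSpace ℝ (Fin N) → ℝ),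
          IsStableGelfandSolution Ω lam mu u v → ∀ x ∈ Ω, ∀ y ∈ Ω, u x + v y ≤ C := by
  obtain ⟨E, hE0, hE⟩ := energy_bound ho hb Λ hΛ
  obtain ⟨C, hC⟩ := sup_one hN3 ho hb Λ E hΛ.le
  refine ⟨C + C, fun lam mu hl hm hl1 hm1 hr u v hs x hx y hy => ?_⟩
  obtain ⟨e1, e2⟩ := hE lam mu hl hm hr u v hs
  obtain ⟨p1, p2⟩ := gelfand_nonneg hN ho hb hl.le hm.le hs.1
  obtain ⟨hu, hv, hu1, hv1, hu0, hv0⟩ := hs.1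
  have a := hC lam hl hl1 u v hu hv hv1 hv0 p1 p2 e1 e2 y hy
  have b := hC mu hm hm1 v u hv hu hu1 hu0 p2 p1 e2 e1 x hx
  linarith

end SC

section NC
open Filter Topology
variable {N : ℕ} {u v w : EuclideanSpace ℝ (Fin N) → ℝ}

/-- The linear form with given coefficients. -/
noncomputable def mkL (a : Fin N → ℝ) : EuclideanSpace ℝ (Fin N) →L[ℝ] ℝ :=
  ∑ i, a i • (EuclideanSpace.proj i : EuclideanSpace ℝ (Fin N) →L[ℝ] ℝ)

lemma mkL_apply (a : Fin N → ℝ) (y : EuclideanSpace ℝ (Fin N)) : mkL a y = ∑ i, a i * y i := by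
  simp [mkL]

lemma mkL_single (a : Fin N → ℝ) (i : Fin N) : mkL a (EuclideanSpace.single i 1) = a i := by
  rw [mkL_apply]; simp

lemma eq_mkL (l : EuclideanSpace ℝ (Fin N) →L[ℝ] ℝ) :
    l = mkL fun i => l (EuclideanSpace.single i 1) := by
  ext y
  rw [mkL_apply]
  have h : y = ∑ i, y i • EuclideanSpace.single i (1:ℝ) := by
    ext k
    simp [Finset.sum_apply, Pi.single_apply]
  conv_lhs => rw [h]
  rw [map_sum]
  exact Finset.sum_congr rfl fun i _ => by rw [map_smul, smul_eq_mul, mul_comm]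

lemma ext_one {Ω : Set (EuclideanSpace ℝ (Fin N))} (ho : IsOpen Ω) (n : ℕ)
    (hf : ContDiffOn ℝ (n + 1) u (closure Ω)) :
    (∀ x ∈ closure Ω, HasFDerivWithinAt u (mkL fun i => extendFrom Ω (pd i u) x) (closure Ω) x) ∧
    (∀ i, ContDiffOn ℝ n (extendFrom Ω (pd i u)) (closure Ω)) ∧
    ∀ i, ∀ x ∈ Ω, extendFrom Ω (pd i u) x = pd i u x := by
  have loc : ∀ x ∈ closure Ω, ∃ o : Set (EuclideanSpace ℝ (Fin N)), IsOpen o ∧ x ∈ o ∧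
      ∃ f' : EuclideanSpace ℝ (Fin N) → EuclideanSpace ℝ (Fin N) →L[ℝ] ℝ,
      (∀ y ∈ closure Ω ∩ o, HasFDerivWithinAt u (f' y) (closure Ω ∩ o) y) ∧
      ContDiffOn ℝ n f' (closure Ω ∩ o) ∧
      (∀ i, ∀ y ∈ closure Ω ∩ o, extendFrom Ω (pd i u) y = f' y (EuclideanSpace.single i 1)) ∧
      (∀ i, ∀ y ∈ Ω ∩ o, pd i u y = f' y (EuclideanSpace.single i 1)) := by
    intro x hx
    obtain ⟨s, hs, -, f', h1, h2⟩ := (contDiffOn_succ_iff_hasFDerivWithinAt (by simp)).1 hf x hx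
    rw [Set.insert_eq_of_mem hx, mem_nhdsWithin] at hs
    obtain ⟨o, oo, xo, hos⟩ := hs
    rw [Set.inter_comm] at hos
    have h3 : ∀ i, ∀ y ∈ Ω ∩ o, pd i u y = f' y (EuclideanSpace.single i 1) := by
      rintro i y ⟨hy, hyo⟩
      have hn : s ∈ 𝓝 y := mem_of_superset ((ho.inter oo).mem_nhds ⟨hy, hyo⟩) 
        ((Set.inter_subset_inter_left o subset_closure).trans hos)
      unfold pd
      rw [((h1 y (hos ⟨subset_closure hy, hyo⟩)).hasFDerivAt hn).fderiv]
    refine ⟨o, oo, xo, f', fun y hy => (h1 y (hos hy)).mono hos, h2.mono hos, ?_, h3⟩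
    rintro i y hy
    refine extendFrom_eq hy.1 ?_
    have hc : ContinuousWithinAt f' (closure Ω ∩ o) y := (h2.mono hos).continuousOn y hy
    have hc2 : Tendsto (fun z => f' z (EuclideanSpace.single i 1)) (𝓝[Ω ∩ o] y) (𝓝 (f' y (EuclideanSpace.single i 1))) :=
      ((hc.mono (Set.inter_subset_inter_left o subset_closure)).clm_apply continuousWithinAt_const)
    rw [nhdsWithin_inter_of_mem' (mem_nhdsWithin_of_mem_nhds (oo.mem_nhds hy.2))] at hc2
    refine hc2.congr' ?_
    filter_upwards [self_mem_nhdsWithin, mem_nhdsWithin_of_mem_nhds (oo.mem_nhds hy.2)] with z hz hzo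
    exact (h3 i z ⟨hz, hzo⟩).symm
  refine ⟨fun x hx => ?_, fun i => ?_, fun i x hx => ?_⟩
  · obtain ⟨o, oo, xo, f', h1, h2, h3, h4⟩ := loc x hx
    have : (mkL fun i => extendFrom Ω (pd i u) x) = f' x := by
      rw [eq_mkL (f' x)]
      congr 1; funext i
      exact h3 i x ⟨hx, xo⟩
    rw [this]
    exact (hasFDerivWithinAt_inter (oo.mem_nhds xo)).1 (h1 x ⟨hx, xo⟩)
  · refine contDiffOn_of_locally_contDiffOn fun x hx => ?_
    obtain ⟨o, oo, xo, f', h1, h2, h3, h4⟩ := loc x hx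
    refine ⟨o, oo, xo, ?_⟩
    exact (h2.clm_apply contDiffOn_const).congr (h3 i)
  · obtain ⟨o, oo, xo, f', h1, h2, h3, h4⟩ := loc x (subset_closure hx)
    rw [h3 i x ⟨subset_closure hx, xo⟩, h4 i x ⟨hx, xo⟩]

/-- `C²` up to the boundary with explicit derivatives, smooth inside, zero boundary values. -/
structure Nice (Ω : Set (EuclideanSpace ℝ (Fin N))) (h : EuclideanSpace ℝ (Fin N) → ℝ)
    (g : Fin N → EuclideanSpace ℝ (Fin N) → ℝ) (H : Fin N → Fin N → EuclideanSpace ℝ (Fin N) → ℝ) : Prop where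
  sm : ∀ x ∈ Ω, ContDiffAt ℝ 4 h x
  b0 : ∀ x ∈ frontier Ω, h x = 0
  dh : ∀ x ∈ closure Ω, HasFDerivWithinAt h (mkL fun i => g i x) (closure Ω) x
  dg : ∀ i, ∀ x ∈ closure Ω, HasFDerivWithinAt (g i) (mkL fun j => H i j x) (closure Ω) x
  cH : ∀ i j, ContinuousOn (H i j) (closure Ω)
  gi : ∀ i, ∀ x ∈ Ω, g i x = pd i h x
  Hi : ∀ i j, ∀ x ∈ Ω, H i j x = pd j (pd i h) x

lemma exists_nice {Ω : Set (EuclideanSpace ℝ (Fin N))} (ho : IsOpen Ω)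
    (hu : ContDiffOn ℝ 2 u (closure Ω)) (hs : ContDiffOn ℝ (⊤ : ℕ∞) u Ω) (h0 : ∀ x ∈ frontier Ω, u x = 0) :
    ∃ g H, Nice Ω u g H := by
  obtain ⟨h1, h2, h3⟩ := ext_one ho 1 (by norm_num; exact hu)
  have k := fun i => ext_one ho 0 (u := extendFrom Ω (pd i u)) (by norm_num; exact_mod_cast h2 i)
  refine ⟨fun i => extendFrom Ω (pd i u), fun i j => extendFrom Ω (pd j (extendFrom Ω (pd i u))),
    fun x hx => ?_, h0, h1, fun i => (k i).1, fun i j => ((k i).2.1 j).continuousOn, h3, fun i j x hx => ?_⟩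
  · exact ((contDiffOn_infty.1 hs 4).contDiffAt (ho.mem_nhds hx))
  · rw [(k i).2.2 j x hx]
    refine pd_congr ?_
    filter_upwards [ho.mem_nhds hx] with y hy using h3 i y hy

namespace Nice
variable {Ω : Set (EuclideanSpace ℝ (Fin N))} {h h' : EuclideanSpace ℝ (Fin N) → ℝ}
  {g g' : Fin N → EuclideanSpace ℝ (Fin N) → ℝ} {H H' : Fin N → Fin N → EuclideanSpace ℝ (Fin N) → ℝ}

lemma ch (n : Nice Ω h g H) : ContinuousOn h (closure Ω) := fun x hx => (n.dh x hx).continuousWithinAt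
lemma cg (n : Nice Ω h g H) (i : Fin N) : ContinuousOn (g i) (closure Ω) :=
  fun x hx => (n.dg i x hx).continuousWithinAt
lemma sm2 (n : Nice Ω h g H) : ∀ x ∈ Ω, ContDiffAt ℝ 2 h x := fun x hx => (n.sm x hx).of_le (by norm_num)

lemma gev (n : Nice Ω h g H) (ho : IsOpen Ω) (i : Fin N) {x} (hx : x ∈ Ω) : g i =ᶠ[𝓝 x] pd i h := by
  filter_upwards [ho.mem_nhds hx] with y hy using n.gi i y hy
lemma Hev (n : Nice Ω h g H) (ho : IsOpen Ω) (i j : Fin N) {x} (hx : x ∈ Ω) : H i j =ᶠ[𝓝 x] pd j (pd i h) := by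
  filter_upwards [ho.mem_nhds hx] with y hy using n.Hi i j y hy

lemma gsm (n : Nice Ω h g H) (ho : IsOpen Ω) (i : Fin N) {x} (hx : x ∈ Ω) : ContDiffAt ℝ 3 (g i) x :=
  ((n.sm x hx).pd' (by norm_num)).congr_of_eventuallyEq (n.gev ho i hx)
lemma gsm2 (n : Nice Ω h g H) (ho : IsOpen Ω) (i : Fin N) {x} (hx : x ∈ Ω) : ContDiffAt ℝ 2 (g i) x :=
  (n.gsm ho i hx).of_le (by norm_num)
lemma Hsm2 (n : Nice Ω h g H) (ho : IsOpen Ω) (i j : Fin N) {x} (hx : x ∈ Ω) : ContDiffAt ℝ 2 (H i j) x :=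
  (((n.sm x hx).pd' (m := 3) (by norm_num)).pd' (by norm_num)).congr_of_eventuallyEq (n.Hev ho i j hx)

lemma lapg (n : Nice Ω h g H) (ho : IsOpen Ω) (i : Fin N) {x} (hx : x ∈ Ω) : lap (g i) x = pd i (lap h) x := by
  rw [lap_congr (n.gev ho i hx), lap_pd ((n.sm x hx).of_le (by norm_num))]
lemma lapH (n : Nice Ω h g H) (ho : IsOpen Ω) (i j : Fin N) {x} (hx : x ∈ Ω) :
    lap (H i j) x = pd j (pd i (lap h)) x := by
  rw [lap_congr (n.Hev ho i j hx), lap_pd ((n.sm x hx).pd' (by norm_num))]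
  refine pd_congr ?_
  filter_upwards [ho.mem_nhds hx] with y hy
  exact lap_pd ((n.sm y hy).of_le (by norm_num)) i
lemma pdg (n : Nice Ω h g H) (ho : IsOpen Ω) (i j : Fin N) {x} (hx : x ∈ Ω) : pd j (g i) x = H i j x := by
  rw [pd_congr (n.gev ho i hx), n.Hi i j x hx]

lemma closure_eq {f k : EuclideanSpace ℝ (Fin N) → ℝ} (hf : ContinuousOn f (closure Ω))
    (hk : ContinuousOn k (closure Ω)) (e : ∀ x ∈ Ω, f x = k x) : ∀ x ∈ closure Ω, f x = k x := by
  intro x hx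
  have : (𝓝[Ω] x).NeBot := mem_closure_iff_nhdsWithin_neBot.1 hx
  refine tendsto_nhds_unique (((hf x hx).mono subset_closure)) ?_
  refine Tendsto.congr' ?_ ((hk x hx).mono subset_closure)
  filter_upwards [self_mem_nhdsWithin] with y hy using (e y hy).symm

lemma closure_le' {f k : EuclideanSpace ℝ (Fin N) → ℝ} (hf : ContinuousOn f (closure Ω))
    (hk : ContinuousOn k (closure Ω)) (e : ∀ x ∈ Ω, f x ≤ k x) : ∀ x ∈ closure Ω, f x ≤ k x := by
  intro x hx
  have : (𝓝[Ω] x).NeBot := mem_closure_iff_nhdsWithin_neBot.1 hx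
  refine le_of_tendsto_of_tendsto ((hf x hx).mono subset_closure) ((hk x hx).mono subset_closure) ?_
  filter_upwards [self_mem_nhdsWithin] with y hy using e y hy

lemma Hsymm (n : Nice Ω h g H) (i j : Fin N) : ∀ x ∈ closure Ω, H i j x = H j i x :=
  closure_eq (n.cH i j) (n.cH j i) fun x hx => by
    rw [n.Hi i j x hx, n.Hi j i x hx, pd_comm (n.sm2 x hx)]

lemma trace (n : Nice Ω h g H) {x} (hx : x ∈ Ω) : ∑ i, H i i x = lap h x := by
  rw [lap_eq]
  exact Finset.sum_congr rfl fun i _ => n.Hi i i x hx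

lemma sub (n : Nice Ω h g H) (n' : Nice Ω h' g' H') :
    Nice Ω (fun x => h x - h' x) (fun i x => g i x - g' i x) (fun i j x => H i j x - H' i j x) := by
  have hm : ∀ a b : Fin N → ℝ, mkL (fun i => a i - b i) = mkL a - mkL b := by
    intro a b; ext y
    simp only [mkL_apply, sub_apply, sub_mul, Finset.sum_sub_distrib]
  refine ⟨fun x hx => (n.sm x hx).sub (n'.sm x hx), fun x hx => by rw [n.b0 x hx, n'.b0 x hx, sub_zero],
    fun x hx => ?_, fun i x hx => ?_, fun i j => (n.cH i j).sub (n'.cH i j), fun i x hx => ?_, fun i j x hx => ?_⟩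
  · rw [hm]; exact (n.dh x hx).sub (n'.dh x hx)
  · rw [hm]; exact (n.dg i x hx).sub (n'.dg i x hx)
  · rw [n.gi i x hx, n'.gi i x hx, pd_sub (n.sm2 x hx).diff2 (n'.sm2 x hx).diff2]
  · rw [n.Hi i j x hx, n'.Hi i j x hx, ← pd_sub (n.sm2 x hx).pd_diff (n'.sm2 x hx).pd_diff]
    refine pd_congr ?_
    filter_upwards [(n.sm2 x hx).ev_diff, (n'.sm2 x hx).ev_diff] with y h1 h2
    rw [pd_sub h1 h2]

lemma bdd (n : Nice Ω h g H) (hb : Bornology.IsBounded Ω) : ∃ L : ℝ, 0 ≤ L ∧ ∀ x ∈ closure Ω,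
    |h x| ≤ L ∧ (∀ i, |g i x| ≤ L) ∧ ∀ i j, |H i j x| ≤ L := by
  have hcl : IsCompact (closure Ω) := hb.isCompact_closure
  obtain ⟨c0, h0⟩ := hcl.exists_bound_of_continuousOn n.ch
  choose c1 h1 using fun i => hcl.exists_bound_of_continuousOn (n.cg i)
  choose c2 h2 using fun i j => hcl.exists_bound_of_continuousOn (n.cH i j)
  refine ⟨|c0| + ∑ i, |c1 i| + ∑ i, ∑ j, |c2 i j|, by positivity, fun x hx => ⟨?_, fun i => ?_, fun i j => ?_⟩⟩
  · have := h0 x hx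
    rw [norm_eq_abs] at this
    have p : 0 ≤ ∑ i, |c1 i| + ∑ i, ∑ j, |c2 i j| := by positivity
    have := le_abs_self c0
    linarith
  · have := h1 i x hx
    rw [norm_eq_abs] at this
    have p : |c1 i| ≤ ∑ i, |c1 i| := Finset.single_le_sum (fun i _ => abs_nonneg (c1 i)) (Finset.mem_univ i)
    have p2 : 0 ≤ |c0| + ∑ i, ∑ j, |c2 i j| := by positivity
    have := le_abs_self (c1 i)
    linarith
  · have := h2 i j x hx
    rw [norm_eq_abs] at this
    have p : |c2 i j| ≤ ∑ j, |c2 i j| := Finset.single_le_sum (fun j _ => abs_nonneg (c2 i j)) (Finset.mem_univ j)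
    have p' : ∑ j, |c2 i j| ≤ ∑ i, ∑ j, |c2 i j| :=
      Finset.single_le_sum (f := fun i => ∑ j, |c2 i j|) (fun i _ => by positivity) (Finset.mem_univ i)
    have p2 : 0 ≤ |c0| + ∑ i, |c1 i| := by positivity
    have := le_abs_self (c2 i j)
    linarith

end Nice

end NC

section RP
open Filter Topology
variable {N : ℕ} {u v w : EuclideanSpace ℝ (Fin N) → ℝ}

structure Ref (Ω : Set (EuclideanSpace ℝ (Fin N))) (U : EuclideanSpace ℝ (Fin N) → ℝ)
    (G : Fin N → EuclideanSpace ℝ (Fin N) → ℝ) (H : Fin N → Fin N → EuclideanSpace ℝ (Fin N) → ℝ)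
    (m L : ℝ) : Prop where
  hN : 0 < N
  ho : IsOpen Ω
  hb : Bornology.IsBounded Ω
  nu : Nice Ω U G H
  m0 : 0 < m
  lapU : ∀ x ∈ Ω, lap U x ≤ -m
  L1 : 1 ≤ L
  bU : ∀ x ∈ closure Ω, |U x| ≤ L
  bG : ∀ i, ∀ x ∈ closure Ω, |G i x| ≤ L
  bH : ∀ i j, ∀ x ∈ closure Ω, |H i j x| ≤ L
  bl : ∀ x ∈ Ω, |lap U x| ≤ L
  bl' : ∀ i, ∀ x ∈ Ω, |pd i (lap U) x| ≤ L

/-- Boundary points touched by an interior ball. -/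
def IsReg (Ω : Set (EuclideanSpace ℝ (Fin N))) (q : EuclideanSpace ℝ (Fin N)) : Prop :=
  q ∈ frontier Ω ∧ ∃ c : EuclideanSpace ℝ (Fin N), ∃ R : ℝ, 0 < R ∧ Metric.ball c R ⊆ Ω ∧ dist c q = R

lemma reg_dense {Ω : Set (EuclideanSpace ℝ (Fin N))} (ho : IsOpen Ω)
    {p : EuclideanSpace ℝ (Fin N)} (hp : p ∈ frontier Ω) {ε : ℝ} (hε : 0 < ε) :
    ∃ q, IsReg Ω q ∧ dist q p < ε := by
  have hpc : p ∈ closure Ω := frontier_subset_closure hp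
  have hpn : p ∈ Ωᶜ := by rw [ho.frontier_eq] at hp; exact hp.2
  obtain ⟨c, hc, hcp⟩ := Metric.mem_closure_iff.1 hpc (ε / 2) (by positivity)
  obtain ⟨q, hq, hd⟩ := ho.isClosed_compl.exists_infDist_eq_dist ⟨p, hpn⟩ c
  have hle : dist c q ≤ dist c p := by rw [← hd]; exact Metric.infDist_le_dist_of_mem hpn
  have hR : 0 < dist c q := by
    rw [dist_pos]; rintro rfl; exact hq hc
  have hball : Metric.ball c (dist c q) ⊆ Ω := by
    intro y hy
    by_contra hyn
    have h1 : Metric.infDist c Ωᶜ ≤ dist c y := Metric.infDist_le_dist_of_mem hyn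
    rw [hd] at h1
    rw [Metric.mem_ball, dist_comm] at hy
    linarith
  have hqc : q ∈ closure Ω := by
    have h1 : q ∈ Metric.closedBall c (dist c q) := by rw [Metric.mem_closedBall, dist_comm]
    rw [← closure_ball c hR.ne'] at h1
    exact closure_mono hball h1
  refine ⟨q, ⟨?_, c, dist c q, hR, hball, rfl⟩, ?_⟩
  · rw [ho.frontier_eq]; exact ⟨hqc, hq⟩
  · calc dist q p ≤ dist q c + dist c p := dist_triangle _ _ _
      _ < ε := by
        rw [dist_comm q c]
        rw [dist_comm] at hcp
        linarith

lemma reg_le {Ω : Set (EuclideanSpace ℝ (Fin N))} (ho : IsOpen Ω) {f k : EuclideanSpace ℝ (Fin N) → ℝ}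
    (hf : ContinuousOn f (closure Ω)) (hk : ContinuousOn k (closure Ω)) (h : ∀ q, IsReg Ω q → f q ≤ k q) :
    ∀ p ∈ frontier Ω, f p ≤ k p := by
  intro p hp
  have hcl : p ∈ closure {q | IsReg Ω q} := by
    rw [Metric.mem_closure_iff]
    intro ε hε
    obtain ⟨q, hq, hd⟩ := reg_dense ho hp hε
    exact ⟨q, hq, by rwa [dist_comm]⟩
  have hsub : {q | IsReg Ω q} ⊆ closure Ω := fun q hq => frontier_subset_closure hq.1
  have : (𝓝[{q | IsReg Ω q}] p).NeBot := mem_closure_iff_nhdsWithin_neBot.1 hcl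
  have hpc := frontier_subset_closure hp
  refine le_of_tendsto_of_tendsto ((hf p hpc).mono hsub) ((hk p hpc).mono hsub) ?_
  filter_upwards [self_mem_nhdsWithin] with q hq using h q hq

lemma ray_deriv {Ω : Set (EuclideanSpace ℝ (Fin N))} {φ : EuclideanSpace ℝ (Fin N) → ℝ}
    {φ' : EuclideanSpace ℝ (Fin N) →L[ℝ] ℝ} {q e : EuclideanSpace ℝ (Fin N)}
    (hφ : HasFDerivWithinAt φ φ' (closure Ω) q) (he : ∀ᶠ t in 𝓝[>] (0:ℝ), q + t • e ∈ Ω) :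
    HasDerivWithinAt (fun t : ℝ => φ (q + t • e)) (φ' e) (Set.Ioi 0) 0 := by
  have h1 : HasDerivWithinAt (fun t : ℝ => q + t • e) e {t | q + t • e ∈ Ω} 0 := by
    simpa using (((hasDerivAt_id (0:ℝ)).smul_const e).const_add q).hasDerivWithinAt
  have hφ2 : HasFDerivWithinAt φ φ' (closure Ω) (q + (0:ℝ) • e) := by simpa using hφ
  have h2 := hφ2.comp_hasDerivWithinAt (0:ℝ) h1 (fun t ht => subset_closure ht)
  exact h2.mono_of_mem_nhdsWithin he

lemma reg_dir {Ω : Set (EuclideanSpace ℝ (Fin N))} {c q e : EuclideanSpace ℝ (Fin N)} {R : ℝ}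
    (hR : 0 < R) (hball : Metric.ball c R ⊆ Ω) (hd : dist c q = R) (he : 0 < ⟪c - q, e⟫) :
    ∀ᶠ t in 𝓝[>] (0:ℝ), q + t • e ∈ Ω := by
  have hpos : 0 < ⟪c - q, e⟫ / (1 + ‖e‖ ^ 2) := by positivity
  filter_upwards [Ioo_mem_nhdsGT hpos] with t ht
  apply hball
  rw [Metric.mem_ball, dist_eq_norm]
  have hn : ‖c - q‖ = R := by rw [← dist_eq_norm, hd]
  have e1 : q + t • e - c = t • e - (c - q) := by abel
  have h2 : ‖q + t • e - c‖ ^ 2 < R ^ 2 := by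
    rw [e1, norm_sub_sq_real, norm_smul, inner_smul_left, hn, mul_pow, norm_of_nonneg ht.1.le,
      real_inner_comm]
    have h3 : t * (1 + ‖e‖ ^ 2) < ⟪c - q, e⟫ := (lt_div_iff₀ (by positivity)).1 ht.2
    simp only [conj_trivial]
    have h4 : t * ‖e‖ ^ 2 < ⟪c - q, e⟫ := by nlinarith [ht.1]
    have h5 : t * (t * ‖e‖ ^ 2) < t * ⟪c - q, e⟫ := mul_lt_mul_of_pos_left h4 ht.1
    nlinarith [ht.1]
  exact lt_of_pow_lt_pow_left₀ 2 hR.le h2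

/-- nonnegative functions vanishing at a regular point have gradient along the normal. -/
lemma reg_normal {Ω : Set (EuclideanSpace ℝ (Fin N))} {q : EuclideanSpace ℝ (Fin N)} (hq : IsReg Ω q) :
    ∃ ν : Fin N → ℝ, ∑ i, ν i ^ 2 = 1 ∧ (∃ c : EuclideanSpace ℝ (Fin N), ∃ R : ℝ, 0 < R ∧
        Metric.ball c R ⊆ Ω ∧ dist c q = R ∧ c - q = R • WithLp.toLp 2 ν) ∧
      ∀ (φ : EuclideanSpace ℝ (Fin N) → ℝ) (a : Fin N → ℝ),
      HasFDerivWithinAt φ (mkL a) (closure Ω) q → φ q = 0 → (∀ᶠ x in 𝓝[Ω] q, 0 ≤ φ x) →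
      ∃ t : ℝ, 0 ≤ t ∧ ∀ i, a i = t * ν i := by
  obtain ⟨hqf, c, R, hR, hball, hd⟩ := hq
  have hn : ‖c - q‖ = R := by rw [← dist_eq_norm, hd]
  set n : EuclideanSpace ℝ (Fin N) := R⁻¹ • (c - q) with hndef
  have hn1 : ‖n‖ = 1 := by
    rw [hndef, norm_smul, hn, norm_of_nonneg (by positivity), inv_mul_cancel₀ hR.ne']
  have hcq : c - q = R • n := by rw [hndef, smul_inv_smul₀ hR.ne']
  refine ⟨fun i => n i, ?_, ⟨c, R, hR, hball, hd, hcq⟩, ?_⟩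
  · have := EuclideanSpace.norm_sq_eq n
    rw [hn1] at this
    simpa using this.symm
  intro φ a hφ h0 hp
  have A1 : ∀ e, 0 < ⟪n, e⟫ → 0 ≤ mkL a e := by
    intro e he
    have hdir := reg_dir (Ω := Ω) hR hball hd (e := e) (by rw [hcq, inner_smul_left]; simp only [conj_trivial]; positivity)
    refine deriv_nonneg_of_right (ray_deriv hφ hdir) (by simpa using h0) ?_
    have ht : Tendsto (fun t : ℝ => q + t • e) (𝓝[>] 0) (𝓝[Ω] q) := by
      refine tendsto_nhdsWithin_iff.2 ⟨?_, hdir⟩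
      have : Tendsto (fun t : ℝ => q + t • e) (𝓝 0) (𝓝 (q + (0:ℝ) • e)) :=
        (by fun_prop : Continuous fun t : ℝ => q + t • e).tendsto 0
      rw [zero_smul, add_zero] at this
      exact this.mono_left nhdsWithin_le_nhds
    exact ht.eventually hp
  have hnn : ⟪n, n⟫ = 1 := by rw [real_inner_self_eq_norm_sq, hn1]; norm_num
  have A2 : ∀ e, 0 ≤ ⟪n, e⟫ → 0 ≤ mkL a e := by
    intro e he
    have h1 : ∀ ε : ℝ, 0 < ε → 0 ≤ mkL a e + ε * mkL a n := by
      intro ε hε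
      have := A1 (e + ε • n) (by rw [inner_add_right, inner_smul_right, hnn]; linarith)
      rwa [map_add, map_smul, smul_eq_mul] at this
    have h2 : 0 ≤ mkL a n := A1 n (by rw [hnn]; norm_num)
    by_contra hlt
    push Not at hlt
    have := h1 (-(mkL a e) / (2 * (1 + mkL a n))) (by apply div_pos <;> linarith)
    have h3 : -(mkL a e) / (2 * (1 + mkL a n)) * mkL a n ≤ -(mkL a e) / 2 := by
      rw [div_mul_eq_mul_div, div_le_div_iff₀ (by linarith) (by norm_num)]
      nlinarith
    linarith
  refine ⟨mkL a n, A1 n (by rw [hnn]; norm_num), fun i => ?_⟩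
  set e := EuclideanSpace.single i (1:ℝ) with he
  have hin : ⟪n, e⟫ = n i := by rw [he]; simp [EuclideanSpace.inner_single_right]
  have hz : ⟪n, e - n i • n⟫ = 0 := by rw [inner_sub_right, inner_smul_right, hnn, hin]; ring
  have b1 := A2 (e - n i • n) hz.ge
  have b2 := A2 (-(e - n i • n)) (by rw [inner_neg_right, hz]; norm_num)
  rw [map_neg] at b2
  have b3 : mkL a (e - n i • n) = 0 := by linarith
  rw [map_sub, map_smul, smul_eq_mul, he, mkL_single] at b3
  linarith

namespace Ref
variable {Ω : Set (EuclideanSpace ℝ (Fin N))} {U : EuclideanSpace ℝ (Fin N) → ℝ}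
  {G : Fin N → EuclideanSpace ℝ (Fin N) → ℝ} {H : Fin N → Fin N → EuclideanSpace ℝ (Fin N) → ℝ} {m L : ℝ}

lemma U_nonneg (r : Ref Ω U G H m L) : ∀ x ∈ closure Ω, 0 ≤ U x := by
  intro x hx
  by_cases h : x ∈ Ω
  · exact min_principle r.hN r.ho r.hb r.nu.ch r.nu.sm2 
      (fun x hx => (r.lapU x hx).trans (by linarith [r.m0])) (fun x hx => (r.nu.b0 x hx).ge) x h
  · exact (r.nu.b0 x (by rw [r.ho.frontier_eq]; exact ⟨hx, h⟩)).ge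

/-- comparison on a subdomain -/
lemma cmpD (r : Ref Ω U G H m L) {D : Set (EuclideanSpace ℝ (Fin N))} (hD : IsOpen D) (hDΩ : D ⊆ Ω)
    {w : EuclideanSpace ℝ (Fin N) → ℝ} (hw : ContinuousOn w (closure Ω))
    (hw2 : ∀ x ∈ D, ContDiffAt ℝ 2 w x) {B M : ℝ} (hB : ∀ x ∈ D, |lap w x| ≤ B) (hB0 : 0 ≤ B)
    (hM : ∀ x ∈ frontier D, |w x| ≤ M) : ∀ x ∈ D, |w x| ≤ M + B / m * U x := by
  have hcl : closure D ⊆ closure Ω := closure_mono hDΩ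
  have hm := r.m0
  have aux : ∀ s : ℝ, (s = 1 ∨ s = -1) → ∀ x ∈ D, 0 ≤ (M + B / m * U x) + s * w x := by
    intro s hs
    have hs1 : |s| = 1 := by rcases hs with h | h <;> simp [h]
    refine min_principle r.hN hD (r.hb.subset hDΩ) ?_ ?_ ?_ ?_
    · exact ((continuousOn_const.add (continuousOn_const.mul r.nu.ch)).add (continuousOn_const.mul hw)).mono hcl
    · intro x hx
      exact (contDiffAt_const.add (contDiffAt_const.mul (r.nu.sm2 x (hDΩ hx)))).add (contDiffAt_const.mul (hw2 x hx))
    · intro x hx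
      have hU := r.nu.sm2 x (hDΩ hx)
      rw [lap_add (contDiffAt_const.add (contDiffAt_const.mul hU)) (contDiffAt_const.mul (hw2 x hx)),
        lap_add contDiffAt_const (contDiffAt_const.mul hU), lap_const, lap_const_mul _ hU, lap_const_mul _ (hw2 x hx)]
      have h1 := mul_le_mul_of_nonneg_left (r.lapU x (hDΩ hx)) (div_nonneg hB0 hm.le)
      have h2 : B / m * -m = -B := by field_simp
      have h3 : s * lap w x ≤ B := (le_abs_self _).trans (by rw [abs_mul, hs1, one_mul]; exact hB x hx)
      linarith
    · intro x hx
      have h1 := r.U_nonneg x (hcl (frontier_subset_closure hx))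
      have h2 : 0 ≤ B / m * U x := mul_nonneg (div_nonneg hB0 hm.le) h1
      have h3 : -M ≤ s * w x := by
        have : |s * w x| ≤ M := by rw [abs_mul, hs1, one_mul]; exact hM x hx
        exact (abs_le.1 this).1
      linarith
  intro x hx
  have h1 := aux 1 (Or.inl rfl) x hx
  have h2 := aux (-1) (Or.inr rfl) x hx
  rw [abs_le]; constructor <;> linarith

lemma mem_or (r : Ref Ω U G H m L) {x} (hx : x ∈ closure Ω) : x ∈ Ω ∨ x ∈ frontier Ω := by
  by_cases h : x ∈ Ω
  · exact Or.inl h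
  · exact Or.inr (by rw [r.ho.frontier_eq]; exact ⟨hx, h⟩)

lemma cmp1 (r : Ref Ω U G H m L) {w : EuclideanSpace ℝ (Fin N) → ℝ} (hw : ContinuousOn w (closure Ω))
    (hw2 : ∀ x ∈ Ω, ContDiffAt ℝ 2 w x) {B M : ℝ} (hB : ∀ x ∈ Ω, |lap w x| ≤ B) (hB0 : 0 ≤ B)
    (hM : ∀ x ∈ frontier Ω, |w x| ≤ M) : ∀ x ∈ closure Ω, |w x| ≤ M + B / m * U x := by
  intro x hx
  rcases r.mem_or hx with h | h
  · exact r.cmpD r.ho subset_rfl hw hw2 hB hB0 hM x h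
  · have h2 : 0 ≤ B / m * U x := mul_nonneg (div_nonneg hB0 r.m0.le) (r.U_nonneg x hx)
    linarith [hM x h]

/-- comparison near the boundary -/
lemma cmpη (r : Ref Ω U G H m L) {w : EuclideanSpace ℝ (Fin N) → ℝ} (hw : ContinuousOn w (closure Ω))
    (hw2 : ∀ x ∈ Ω, ContDiffAt ℝ 2 w x) {B M η : ℝ} (hB : ∀ x ∈ Ω, |lap w x| ≤ B) (hB0 : 0 ≤ B)
    (hη : 0 < η) (hM : ∀ x ∈ frontier Ω, |w x| ≤ M) (hM2 : ∀ x ∈ Ω, η ≤ U x → |w x| ≤ M) :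
    ∀ x ∈ closure Ω, |w x| ≤ M + B / m * η := by
  intro x hx
  have h2 : 0 ≤ B / m * η := mul_nonneg (div_nonneg hB0 r.m0.le) hη.le
  rcases r.mem_or hx with h | h
  swap
  · linarith [hM x h]
  rcases le_or_gt η (U x) with h3 | h3
  · linarith [hM2 x h h3]
  have hD : IsOpen {y ∈ Ω | U y < η} :=
    (r.nu.ch.mono subset_closure).isOpen_inter_preimage r.ho isOpen_Iio
  have := r.cmpD hD (fun y hy => hy.1) hw (fun y hy => hw2 y hy.1) (M := M) (fun y hy => hB y hy.1) hB0 ?_ x ⟨h, h3⟩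
  · have : B / m * U x ≤ B / m * η := mul_le_mul_of_nonneg_left h3.le (div_nonneg hB0 r.m0.le)
    linarith
  · intro y hy
    rw [hD.frontier_eq] at hy
    have hyc : y ∈ closure Ω := closure_mono (fun z hz => hz.1) hy.1
    rcases r.mem_or hyc with k | k
    · refine hM2 y k ?_
      by_contra hlt
      exact hy.2 ⟨k, not_le.1 hlt⟩
    · exact hM y k

lemma ball_lower (r : Ref Ω U G H m L) {c : EuclideanSpace ℝ (Fin N)} {R : ℝ} (hb : Metric.ball c R ⊆ Ω) :
    ∀ x ∈ Metric.ball c R, m / (2 * N) * (R ^ 2 - ‖x - c‖ ^ 2) ≤ U x := by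
  have hNR : (0:ℝ) < N := by exact_mod_cast r.hN
  have key := min_principle (w := fun x => U x + (m / (2 * N)) * (‖x - c‖ ^ 2 + (- R ^ 2))) r.hN
    (Metric.isOpen_ball (x := c) (ε := R)) Metric.isBounded_ball ?_ ?_ ?_ ?_
  · intro x hx
    have := key x hx
    linarith
  · exact (r.nu.ch.mono (closure_mono hb)).add (by fun_prop)
  · intro x hx
    exact (r.nu.sm2 x (hb hx)).add (contDiffAt_const.mul ((contDiff_normsq c).contDiffAt.add contDiffAt_const))
  · intro x hx
    have hq : ContDiffAt ℝ 2 (fun y => ‖y - c‖ ^ 2) x := (contDiff_normsq c).contDiffAt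
    rw [lap_add (r.nu.sm2 x (hb hx)) (contDiffAt_const.mul (hq.add contDiffAt_const)),
      lap_const_mul _ (hq.add contDiffAt_const), lap_add hq contDiffAt_const, lap_const, lap_normsq]
    have := r.lapU x (hb hx)
    have e : m / (2 * N) * (2 * N + 0) = m := by field_simp; ring
    linarith
  · intro x hx
    have h1 := r.U_nonneg x (closure_mono hb (frontier_subset_closure hx))
    have h2 : dist x c = R := by
      exact Metric.frontier_ball_subset_sphere hx
    rw [dist_eq_norm] at h2
    rw [h2]
    linarith

lemma U_pos (r : Ref Ω U G H m L) : ∀ x ∈ Ω, 0 < U x := by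
  intro x hx
  obtain ⟨R, hR, hb⟩ := Metric.isOpen_iff.1 r.ho x hx
  have := r.ball_lower hb x (Metric.mem_ball_self hR)
  have hNR : (0:ℝ) < N := by exact_mod_cast r.hN
  have hm := r.m0
  have h2 : 0 < m / (2 * N) * (R ^ 2 - ‖x - x‖ ^ 2) := by simp; positivity
  linarith

/-- Structure at a regular boundary point. -/
lemma reg_point (r : Ref Ω U G H m L) {q : EuclideanSpace ℝ (Fin N)} (hq : IsReg Ω q) :
    ∃ (ν : Fin N → ℝ) (s : ℝ), 0 < s ∧ s ≤ L * N ∧ ∑ i, ν i ^ 2 = 1 ∧ (∀ i, G i q = s * ν i) ∧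
      ∀ (φ : EuclideanSpace ℝ (Fin N) → ℝ) (a : Fin N → ℝ),
      HasFDerivWithinAt φ (mkL a) (closure Ω) q → φ q = 0 → (∀ᶠ x in 𝓝[Ω] q, 0 ≤ φ x) →
      ∃ t : ℝ, 0 ≤ t ∧ ∀ i, a i = t * ν i := by
  obtain ⟨ν, hν, ⟨c, R, hR, hball, hd, hcq⟩, hP⟩ := reg_normal hq
  have hqc := frontier_subset_closure hq.1
  have hNR : (0:ℝ) < N := by exact_mod_cast r.hN
  have hm := r.m0
  obtain ⟨s, hs0, hs⟩ := hP U (fun i => G i q) (r.nu.dh q hqc) (r.nu.b0 q hq.1)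
    (by filter_upwards [self_mem_nhdsWithin] with x hx using r.U_nonneg x (subset_closure hx))
  set n : EuclideanSpace ℝ (Fin N) := WithLp.toLp 2 ν with hn
  have hnn : ‖n‖ ^ 2 = 1 := by rw [EuclideanSpace.norm_sq_eq, ← hν]; simp [hn]
  have hn1 : ‖n‖ = 1 := by
    nlinarith [norm_nonneg n]
  have hsn : mkL (fun i => G i q) n = s := by
    rw [mkL_apply]
    calc ∑ i, G i q * n i = ∑ i, s * ν i ^ 2 := Finset.sum_congr rfl fun i _ => by rw [hs i]; simp [hn]; ring
      _ = s := by rw [← Finset.mul_sum, hν, mul_one]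
  have hspos : 0 < s := by
    have hdir := reg_dir (Ω := Ω) hR hball hd (e := n) (by
      rw [hcq, inner_smul_left, real_inner_self_eq_norm_sq, hnn]; simpa using hR)
    have hF := ray_deriv (r.nu.dh q hqc) hdir
    rw [hsn] at hF
    have h2 : HasDerivAt (fun t : ℝ => m / (2 * N) * (2 * R * t - t ^ 2)) (m / (2 * N) * (2 * R)) 0 := by
      have := (((hasDerivAt_id (0:ℝ)).const_mul (2 * R)).sub (hasDerivAt_pow 2 (0:ℝ))).const_mul (m / (2 * N))
      refine HasDerivAt.congr_deriv (this.congr_of_eventuallyEq (Eventually.of_forall fun t => ?_)) ?_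
      · simp
      · simp
    have := deriv_nonneg_of_right (hF.fun_sub h2.hasDerivWithinAt) (by simp [r.nu.b0 q hq.1]) ?_
    · have h3 : 0 < m / (2 * N) * (2 * R) := by positivity
      linarith
    · have hpos : 0 < R := hR
      filter_upwards [Ioo_mem_nhdsGT hpos] with t ht
      have e1 : q + t • n - c = (t - R) • n := by
        have : q - c = - (R • n) := by rw [← hcq]; abel
        rw [add_sub_right_comm, this, sub_smul]; abel
      have e2 : ‖q + t • n - c‖ = R - t := by
        rw [e1, norm_smul, hn1, mul_one, norm_eq_abs, abs_of_neg (by linarith [ht.2])]; ring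
      have := r.ball_lower hball (q + t • n) (by rw [Metric.mem_ball, dist_eq_norm, e2]; linarith [ht.1])
      rw [e2] at this
      have e3 : R ^ 2 - (R - t) ^ 2 = 2 * R * t - t ^ 2 := by ring
      rw [e3] at this
      linarith
  refine ⟨ν, s, hspos, ?_, hν, hs, hP⟩
  have hvi : ∀ i, |ν i| ≤ 1 := fun i => by
    rw [← sq_le_one_iff_abs_le_one, ← hν]
    exact Finset.single_le_sum (f := fun i => ν i ^ 2) (fun i _ => sq_nonneg (ν i)) (Finset.mem_univ i)
  calc s = ∑ i, G i q * ν i := by rw [← hsn, mkL_apply]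
    _ ≤ ∑ i : Fin N, L := Finset.sum_le_sum fun i _ => by
        calc G i q * ν i ≤ |G i q| * |ν i| := by rw [← abs_mul]; exact le_abs_self _
          _ ≤ L * 1 := mul_le_mul (r.bG i q hqc) (hvi i) (abs_nonneg _) (by linarith [r.L1])
          _ = L := mul_one L
    _ = L * N := by simp; ring

end Ref
end RP

section LP
open Filter Topology
variable {N : ℕ} {u v w : EuclideanSpace ℝ (Fin N) → ℝ}

section mk
variable {f k : EuclideanSpace ℝ (Fin N) → ℝ} {a b : Fin N → ℝ} {S : Set (EuclideanSpace ℝ (Fin N))}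
  {x : EuclideanSpace ℝ (Fin N)}

lemma hfd_add (hf : HasFDerivWithinAt f (mkL a) S x) (hk : HasFDerivWithinAt k (mkL b) S x) :
    HasFDerivWithinAt (fun y => f y + k y) (mkL fun i => a i + b i) S x := by
  refine HasFDerivWithinAt.congr_fderiv (hf.fun_add hk) ?_
  refine ContinuousLinearMap.ext fun y => ?_
  simp [mkL_apply, add_mul, Finset.sum_add_distrib]

lemma hfd_sub (hf : HasFDerivWithinAt f (mkL a) S x) (hk : HasFDerivWithinAt k (mkL b) S x) :
    HasFDerivWithinAt (fun y => f y - k y) (mkL fun i => a i - b i) S x := by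
  refine HasFDerivWithinAt.congr_fderiv (hf.fun_sub hk) ?_
  refine ContinuousLinearMap.ext fun y => ?_
  simp [mkL_apply, sub_mul, Finset.sum_sub_distrib]

lemma hfd_mul (hf : HasFDerivWithinAt f (mkL a) S x) (hk : HasFDerivWithinAt k (mkL b) S x) :
    HasFDerivWithinAt (fun y => f y * k y) (mkL fun i => f x * b i + k x * a i) S x := by
  refine HasFDerivWithinAt.congr_fderiv (hf.fun_mul hk) ?_
  refine ContinuousLinearMap.ext fun y => ?_
  simp [mkL_apply, add_mul, Finset.sum_add_distrib, Finset.mul_sum, mul_assoc]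

lemma hfd_cmul (c : ℝ) (hf : HasFDerivWithinAt f (mkL a) S x) :
    HasFDerivWithinAt (fun y => c * f y) (mkL fun i => c * a i) S x := by
  refine HasFDerivWithinAt.congr_fderiv (hf.const_mul c) ?_
  refine ContinuousLinearMap.ext fun y => ?_
  simp [mkL_apply, Finset.mul_sum, mul_assoc]

lemma hfd_const (c : ℝ) : HasFDerivWithinAt (fun _ => c) (mkL fun _ => 0) S x := by
  refine HasFDerivWithinAt.congr_fderiv (hasFDerivWithinAt_const c x S) ?_
  refine ContinuousLinearMap.ext fun y => ?_
  simp [mkL_apply]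

lemma hfd_sum (F : Fin N → EuclideanSpace ℝ (Fin N) → ℝ) (A : Fin N → Fin N → ℝ)
    (hf : ∀ j, HasFDerivWithinAt (F j) (mkL (A j)) S x) :
    HasFDerivWithinAt (fun y => ∑ j, F j y) (mkL fun i => ∑ j, A j i) S x := by
  refine HasFDerivWithinAt.congr_fderiv (HasFDerivWithinAt.fun_sum (u := Finset.univ) (fun j _ => hf j)) ?_
  refine ContinuousLinearMap.ext fun y => ?_
  simp only [mkL_apply, Finset.sum_mul, _root_.sum_apply]
  rw [Finset.sum_comm]
end mk

/-- normal-direction property at a boundary point -/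
def PN (Ω : Set (EuclideanSpace ℝ (Fin N))) (q : EuclideanSpace ℝ (Fin N)) (ν : Fin N → ℝ) : Prop :=
  ∀ (φ : EuclideanSpace ℝ (Fin N) → ℝ) (a : Fin N → ℝ),
      HasFDerivWithinAt φ (mkL a) (closure Ω) q → φ q = 0 → (∀ᶠ x in 𝓝[Ω] q, 0 ≤ φ x) →
      ∃ t : ℝ, 0 ≤ t ∧ ∀ i, a i = t * ν i

lemma sum_unit_abs {ν : Fin N → ℝ} (hν : ∑ i, ν i ^ 2 = 1) (i : Fin N) : |ν i| ≤ 1 := by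
  rw [← sq_le_one_iff_abs_le_one, ← hν]
  exact Finset.single_le_sum (f := fun i => ν i ^ 2) (fun i _ => sq_nonneg (ν i)) (Finset.mem_univ i)

lemma sum_unit_proj {ν a : Fin N → ℝ} (hν : ∑ i, ν i ^ 2 = 1) {t : ℝ} (h : ∀ i, a i = t * ν i) :
    t = ∑ i, a i * ν i := by
  calc t = t * ∑ i, ν i ^ 2 := by rw [hν, mul_one]
    _ = _ := by rw [Finset.mul_sum]; exact Finset.sum_congr rfl fun i _ => by rw [h i]; ring

/-- two-sided version of PN with explicit bound. -/
lemma PN.two {Ω : Set (EuclideanSpace ℝ (Fin N))} {q : EuclideanSpace ℝ (Fin N)} {ν : Fin N → ℝ}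
    (hP : PN Ω q ν) (hν : ∑ i, ν i ^ 2 = 1) {b z : EuclideanSpace ℝ (Fin N) → ℝ} {β ζ : Fin N → ℝ} {σ : ℝ}
    (hb : HasFDerivWithinAt b (mkL β) (closure Ω) q) (hz : HasFDerivWithinAt z (mkL ζ) (closure Ω) q)
    (hb0 : b q = 0) (hz0 : z q = 0) (hβ : ∀ i, β i = σ * ν i) (h : ∀ᶠ x in 𝓝[Ω] q, |z x| ≤ b x) :
    ∃ t : ℝ, |t| ≤ σ ∧ ∀ i, ζ i = t * ν i := by
  obtain ⟨t1, ht1, e1⟩ := hP _ _ (hfd_add hb hz) (by rw [hb0, hz0, add_zero])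
    (h.mono fun x hx => by linarith [neg_abs_le (z x)])
  obtain ⟨t2, ht2, e2⟩ := hP _ _ (hfd_sub hb hz) (by rw [hb0, hz0, sub_zero])
    (h.mono fun x hx => by linarith [le_abs_self (z x)])
  have f1 : ∀ i, ζ i = (t1 - σ) * ν i := fun i => by linarith [e1 i, hβ i]
  have f2 : ∀ i, ζ i = (σ - t2) * ν i := fun i => by linarith [e2 i, hβ i]
  have e := sum_unit_proj hν f1
  rw [← sum_unit_proj hν f2] at e
  exact ⟨t1 - σ, abs_le.2 ⟨by linarith, by linarith⟩, f1⟩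

lemma abs_sum_le_card {F : Fin N → ℝ} {c : ℝ} (h : ∀ i, |F i| ≤ c) : |∑ i, F i| ≤ N * c := by
  calc |∑ i, F i| ≤ ∑ i, |F i| := Finset.abs_sum_le_sum_abs _ _
    _ ≤ ∑ _i : Fin N, c := Finset.sum_le_sum fun i _ => h i
    _ = N * c := by simp

namespace Ref
variable {Ω : Set (EuclideanSpace ℝ (Fin N))} {U : EuclideanSpace ℝ (Fin N) → ℝ}
  {G : Fin N → EuclideanSpace ℝ (Fin N) → ℝ} {H : Fin N → Fin N → EuclideanSpace ℝ (Fin N) → ℝ} {m L : ℝ}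
  {h : EuclideanSpace ℝ (Fin N) → ℝ}
  {g : Fin N → EuclideanSpace ℝ (Fin N) → ℝ} {K : Fin N → Fin N → EuclideanSpace ℝ (Fin N) → ℝ} {A : ℝ}

lemma L1' (r : Ref Ω U G H m L) (n : Nice Ω h g K) (A0 : 0 ≤ A) (hA : ∀ x ∈ Ω, |lap h x| ≤ A) :
    ∀ x ∈ closure Ω, |h x| ≤ A / m * U x := by
  intro x hx
  have := r.cmp1 n.ch n.sm2 hA A0 (M := 0) (fun x hx => by rw [n.b0 x hx, abs_zero]) x hx
  linarith

lemma reg_grad (r : Ref Ω U G H m L) (n : Nice Ω h g K) (A0 : 0 ≤ A) (hA : ∀ x ∈ Ω, |lap h x| ≤ A)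
    {q : EuclideanSpace ℝ (Fin N)} (hq : q ∈ frontier Ω) {ν : Fin N → ℝ} {s : ℝ} (hP : PN Ω q ν)
    (hν : ∑ i, ν i ^ 2 = 1) (hs : ∀ i, G i q = s * ν i) :
    ∃ t, |t| ≤ A / m * s ∧ ∀ i, g i q = t * ν i := by
  have hqc := frontier_subset_closure hq
  refine hP.two hν (hfd_cmul (A / m) (r.nu.dh q hqc)) (n.dh q hqc) (by rw [r.nu.b0 q hq, mul_zero]) (n.b0 q hq)
    (fun i => by rw [hs i]; ring) ?_
  filter_upwards [self_mem_nhdsWithin] with x hx using r.L1' n A0 hA x (subset_closure hx)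

lemma bdry_grad (r : Ref Ω U G H m L) (n : Nice Ω h g K) (A0 : 0 ≤ A) (hA : ∀ x ∈ Ω, |lap h x| ≤ A)
    (j : Fin N) : ∀ p ∈ frontier Ω, g j p ^ 2 ≤ (A / m) ^ 2 * ∑ i, G i p ^ 2 := by
  refine reg_le r.ho ((n.cg j).pow 2) (continuousOn_const.mul (continuousOn_finsetSum _ fun i _ => (r.nu.cg i).pow 2)) ?_
  intro q hq
  obtain ⟨ν, s, hs0, hsL, hν, hs, hP⟩ := r.reg_point hq
  obtain ⟨t, ht, hg⟩ := r.reg_grad n A0 hA hq.1 hP hν hs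
  have e : ∑ i, G i q ^ 2 = s ^ 2 := by
    calc ∑ i, G i q ^ 2 = ∑ i, s ^ 2 * ν i ^ 2 := Finset.sum_congr rfl fun i _ => by rw [hs i]; ring
      _ = s ^ 2 := by rw [← Finset.mul_sum, hν, mul_one]
  rw [e, hg j, ← mul_pow]
  refine sq_le_sq.2 ?_
  have : 0 ≤ A / m * s := (abs_nonneg t).trans ht
  rw [abs_mul, abs_of_nonneg this]
  calc |t| * |ν j| ≤ |t| * 1 := mul_le_mul_of_nonneg_left (sum_unit_abs hν j) (abs_nonneg _)
    _ ≤ _ := by rw [mul_one]; exact ht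

lemma bdry_grad' (r : Ref Ω U G H m L) (n : Nice Ω h g K) (A0 : 0 ≤ A) (hA : ∀ x ∈ Ω, |lap h x| ≤ A)
    (j : Fin N) : ∀ p ∈ frontier Ω, |g j p| ≤ A / m * (L * N) := by
  refine reg_le r.ho (n.cg j).abs continuousOn_const ?_
  intro q hq
  obtain ⟨ν, s, hs0, hsL, hν, hs, hP⟩ := r.reg_point hq
  obtain ⟨t, ht, hg⟩ := r.reg_grad n A0 hA hq.1 hP hν hs
  rw [hg j, abs_mul]
  have hm := r.m0
  calc |t| * |ν j| ≤ |t| * 1 := mul_le_mul_of_nonneg_left (sum_unit_abs hν j) (abs_nonneg _)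
    _ ≤ A / m * s := by rw [mul_one]; exact ht
    _ ≤ _ := mul_le_mul_of_nonneg_left hsL (by positivity)

lemma bdry_z (r : Ref Ω U G H m L) (n : Nice Ω h g K) (A0 : 0 ≤ A) (hA : ∀ x ∈ Ω, |lap h x| ≤ A)
    (i j : Fin N) : ∀ p ∈ frontier Ω, G i p * g j p - G j p * g i p = 0 := by
  have key : ∀ p ∈ frontier Ω, |G i p * g j p - G j p * g i p| ≤ 0 := by
    refine reg_le r.ho (((r.nu.cg i).mul (n.cg j)).sub ((r.nu.cg j).mul (n.cg i))).abs continuousOn_const ?_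
    intro q hq
    obtain ⟨ν, s, hs0, hsL, hν, hs, hP⟩ := r.reg_point hq
    obtain ⟨t, ht, hg⟩ := r.reg_grad n A0 hA hq.1 hP hν hs
    rw [hs i, hs j, hg i, hg j]
    have : s * ν i * (t * ν j) - s * ν j * (t * ν i) = 0 := by ring
    rw [this, abs_zero]
  exact fun p hp => abs_nonpos_iff.1 (key p hp)

/-- the constant in `Psi` -/
noncomputable def cP (N : ℕ) (m L : ℝ) : ℝ := (N * (2 * L * L + 2 * (N * (L * L))) + 1) / m

noncomputable def Psi (U : EuclideanSpace ℝ (Fin N) → ℝ) (G : Fin N → EuclideanSpace ℝ (Fin N) → ℝ) (m L : ℝ)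
    (x : EuclideanSpace ℝ (Fin N)) : ℝ := ∑ i, G i x ^ 2 + cP N m L * U x

lemma lap_sq (n : Nice Ω h g K) (ho : IsOpen Ω) (i : Fin N) {x} (hx : x ∈ Ω) (c : ℝ) :
    lap (fun y => (g i y - c) ^ 2) x = 2 * (g i x - c) * pd i (lap h) x + 2 * ∑ k, K i k x * K i k x := by
  have h1 := n.gsm2 ho i hx
  have h2 : ContDiffAt ℝ 2 (fun y => g i y - c) x := h1.sub contDiffAt_const
  have e : (fun y => (g i y - c) ^ 2) = fun y => (g i y - c) * (g i y - c) := by funext y; ring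
  rw [e, lap_mul h2 h2, lap_sub h1 contDiffAt_const, lap_const, n.lapg ho i hx]
  have : ∀ k, pd k (fun y => g i y - c) x = K i k x := fun k => by
    rw [pd_sub (h1.differentiableAt (by norm_num)) (differentiableAt_const c), pd_const, sub_zero, n.pdg ho i k hx]
  simp only [this]
  ring

lemma cP_nonneg (r : Ref Ω U G H m L) : 0 ≤ cP N m L := by
  have := r.m0
  have := r.L1
  unfold cP; positivity

lemma lap_sq_le (r : Ref Ω U G H m L) (i : Fin N) {x} (hx : x ∈ Ω) {c b : ℝ} (hc : |G i x - c| ≤ b) :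
    lap (fun y => (G i y - c) ^ 2) x ≤ 2 * b * L + 2 * (N * (L * L)) := by
  have hL := r.L1
  rw [lap_sq r.nu r.ho i hx]
  have h1 : 2 * (G i x - c) * pd i (lap U) x ≤ 2 * b * L := by
    have : (G i x - c) * pd i (lap U) x ≤ b * L := by
      refine (le_abs_self _).trans ?_
      rw [abs_mul]
      exact mul_le_mul hc (r.bl' i x hx) (abs_nonneg _) ((abs_nonneg _).trans hc)
    linarith
  have h2 : ∑ k, H i k x * H i k x ≤ N * (L * L) := by
    refine (le_abs_self _).trans (abs_sum_le_card fun k => ?_)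
    rw [abs_mul]
    have := r.bH i k x (subset_closure hx)
    exact mul_le_mul this this (abs_nonneg _) (by linarith)
  linarith

lemma lap_sumsq_le (r : Ref Ω U G H m L) {x} (hx : x ∈ Ω) {c : Fin N → ℝ} {b : ℝ} (hc : ∀ i, |G i x - c i| ≤ b) :
    lap (fun y => ∑ i, (G i y - c i) ^ 2) x ≤ N * (2 * b * L + 2 * (N * (L * L))) := by
  rw [lap_sum Finset.univ (fun i y => (G i y - c i) ^ 2) (fun i _ => ((r.nu.gsm2 r.ho i hx).sub contDiffAt_const).pow 2)]
  calc _ ≤ ∑ _i : Fin N, (2 * b * L + 2 * (N * (L * L))) := Finset.sum_le_sum fun i _ => r.lap_sq_le i hx (hc i)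
    _ = _ := by simp; ring

lemma sumsq_sm (r : Ref Ω U G H m L) {x} (hx : x ∈ Ω) (c : Fin N → ℝ) :
    ContDiffAt ℝ 2 (fun y => ∑ i, (G i y - c i) ^ 2) x :=
  ContDiffAt.sum fun i _ => ((r.nu.gsm2 r.ho i hx).sub contDiffAt_const).pow 2

lemma Psi_eq : (Psi U G m L) = fun y => ∑ i, (G i y - (fun _ => (0:ℝ)) i) ^ 2 + cP N m L * U y := by
  funext y; simp [Psi]

lemma Psi_sm (r : Ref Ω U G H m L) {x} (hx : x ∈ Ω) : ContDiffAt ℝ 2 (Psi U G m L) x := by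
  rw [Psi_eq]
  exact (r.sumsq_sm hx _).add (contDiffAt_const.mul (r.nu.sm2 x hx))

lemma Psi_lap (r : Ref Ω U G H m L) {x} (hx : x ∈ Ω) : lap (Psi U G m L) x ≤ -1 := by
  rw [Psi_eq, lap_add (r.sumsq_sm hx _) (contDiffAt_const.mul (r.nu.sm2 x hx)), lap_const_mul _ (r.nu.sm2 x hx)]
  have h1 := r.lap_sumsq_le hx (c := fun _ => 0) (b := L) (fun i => by simpa using r.bG i x (subset_closure hx))
  have h2 := mul_le_mul_of_nonneg_left (r.lapU x hx) r.cP_nonneg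
  have hm := r.m0
  have e : cP N m L * -m = -(N * (2 * L * L + 2 * (N * (L * L))) + 1) := by unfold cP; field_simp
  linarith

lemma Psi_cont (r : Ref Ω U G H m L) : ContinuousOn (Psi U G m L) (closure Ω) :=
  (continuousOn_finsetSum _ fun i _ => (r.nu.cg i).pow 2).add (continuousOn_const.mul r.nu.ch)

lemma L2' (r : Ref Ω U G H m L) (n : Nice Ω h g K) (A0 : 0 ≤ A) (hA : ∀ x ∈ Ω, |lap h x| ≤ A)
    (hA' : ∀ i, ∀ x ∈ Ω, |pd i (lap h) x| ≤ A) {τ : ℝ} (hτ : 0 < τ) (hτL : τ ≤ L * N) (j : Fin N) :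
    ∀ x ∈ closure Ω, |g j x| ≤ (L * N + 1 / m) * A * (Psi U G m L x / τ + τ) := by
  have hm := r.m0
  have hL := r.L1
  have hNR : (0:ℝ) < N := by exact_mod_cast r.hN
  set C := L * N + 1 / m with hC
  have hC0 : 0 ≤ C := by positivity
  have hCτ : τ ≤ C := hτL.trans (by rw [hC]; linarith [show 0 ≤ 1 / m by positivity])
  have hbd : ∀ x ∈ frontier Ω, |g j x| ≤ C * A * (Psi U G m L x / τ + τ) := by
    intro x hx
    have h1 := r.bdry_grad n A0 hA j x hx
    have hU := r.nu.b0 x hx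
    set P := ∑ i, G i x ^ 2 with hPdef
    have hP0 : 0 ≤ P := Finset.sum_nonneg fun i _ => sq_nonneg _
    have hPs : Psi U G m L x = P := by simp [Psi, hU, hPdef]
    rw [hPs]
    have h2 : P ≤ (P / τ + τ) ^ 2 := by
      have : (P / τ + τ) ^ 2 = (P / τ) ^ 2 + 2 * P + τ ^ 2 := by field_simp; ring
      nlinarith [sq_nonneg (P / τ), sq_nonneg τ]
    have h3 : g j x ^ 2 ≤ (A / m * (P / τ + τ)) ^ 2 := by
      rw [mul_pow]
      exact h1.trans (mul_le_mul_of_nonneg_left h2 (sq_nonneg _))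
    have h4 := abs_le_of_sq_le_sq h3 (by positivity)
    refine h4.trans ?_
    refine mul_le_mul_of_nonneg_right ?_ (by positivity)
    have : A / m = 1 / m * A := by ring
    rw [this]
    refine mul_le_mul_of_nonneg_right ?_ A0
    rw [hC]; linarith [show 0 ≤ L * N by positivity]
  have aux : ∀ s : ℝ, (s = 1 ∨ s = -1) → ∀ x ∈ Ω, 0 ≤ (C * A / τ * Psi U G m L x + C * A * τ) + s * g j x := by
    intro s hs
    have hs1 : |s| = 1 := by rcases hs with h | h <;> simp [h]
    refine min_principle r.hN r.ho r.hb ?_ ?_ ?_ ?_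
    · exact ((continuousOn_const.mul r.Psi_cont).add continuousOn_const).add (continuousOn_const.mul (n.cg j))
    · intro x hx
      exact ((contDiffAt_const.mul (r.Psi_sm hx)).add contDiffAt_const).add (contDiffAt_const.mul (n.gsm2 r.ho j hx))
    · intro x hx
      rw [lap_add ((contDiffAt_const.mul (r.Psi_sm hx)).add contDiffAt_const) (contDiffAt_const.mul (n.gsm2 r.ho j hx)),
        lap_add (contDiffAt_const.mul (r.Psi_sm hx)) contDiffAt_const, lap_const, lap_const_mul _ (r.Psi_sm hx),
        lap_const_mul _ (n.gsm2 r.ho j hx), n.lapg r.ho j hx]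
      have h1 := mul_le_mul_of_nonneg_left (r.Psi_lap hx) (show 0 ≤ C * A / τ by positivity)
      have h3 : s * pd j (lap h) x ≤ A := (le_abs_self _).trans (by rw [abs_mul, hs1, one_mul]; exact hA' j x hx)
      have h4 : A ≤ C * A / τ := by rw [le_div_iff₀ hτ]; nlinarith
      linarith
    · intro x hx
      have h1 : |s * g j x| ≤ C * A * (Psi U G m L x / τ + τ) := by rw [abs_mul, hs1, one_mul]; exact hbd x hx
      have h2 := neg_abs_le (s * g j x)
      have h3 : C * A * (Psi U G m L x / τ + τ) = C * A / τ * Psi U G m L x + C * A * τ := by ring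
      linarith
  intro x hx
  rcases r.mem_or hx with hx | hx
  · have h1 := aux 1 (Or.inl rfl) x hx
    have h2 := aux (-1) (Or.inr rfl) x hx
    have h3 : C * A * (Psi U G m L x / τ + τ) = C * A / τ * Psi U G m L x + C * A * τ := by ring
    rw [h3, abs_le]; constructor <;> linarith
  · exact hbd x hx

end Ref
end LP

section LP4
open Filter Topology
variable {N : ℕ} {u v w : EuclideanSpace ℝ (Fin N) → ℝ}

/-- linear algebra: a symmetric matrix with almost normal rows -/
lemma alg_hess {ν : Fin N → ℝ} (hν : ∑ i, ν i ^ 2 = 1) {K : Fin N → Fin N → ℝ} (hK : ∀ i j, K i j = K j i)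
    {a A : ℝ} (h : ∀ i j k, |ν i * K j k - ν j * K i k| ≤ a) (ht : |∑ i, K i i| ≤ A) (j k : Fin N) :
    |K j k| ≤ A + (N + 1) * (N * a + N * (N * a)) := by
  have hν1 := sum_unit_abs hν
  have mul1 : ∀ (x : ℝ) i c, |x| ≤ c → |ν i * x| ≤ c := fun x i c hx => by
    rw [abs_mul]
    calc |ν i| * |x| ≤ 1 * |x| := mul_le_mul_of_nonneg_right (hν1 i) (abs_nonneg _)
      _ ≤ c := by rw [one_mul]; exact hx
  set W : Fin N → ℝ := fun k => ∑ i, ν i * K i k with hW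
  set κ : ℝ := ∑ k, ν k * W k with hκ
  have s1 : ∀ j k, |K j k - ν j * W k| ≤ N * a := by
    intro j k
    have : K j k - ν j * W k = ∑ i, ν i * (ν i * K j k - ν j * K i k) := by
      have e : K j k = ∑ i, ν i ^ 2 * K j k := by rw [← Finset.sum_mul, hν, one_mul]
      rw [hW]; simp only
      rw [Finset.mul_sum]
      nth_rewrite 1 [e]
      rw [← Finset.sum_sub_distrib]
      exact Finset.sum_congr rfl fun i _ => by ring
    rw [this]
    exact abs_sum_le_card fun i => mul1 _ _ _ (h i j k)
  have s2 : ∀ j, |W j - ν j * κ| ≤ N * (N * a) := by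
    intro j
    have : W j - ν j * κ = ∑ k, ν k * (K j k - ν j * W k) := by
      rw [hκ, Finset.mul_sum]
      have : W j = ∑ i, ν i * K j i := Finset.sum_congr rfl fun i _ => by rw [hK i j]
      rw [this, ← Finset.sum_sub_distrib]
      exact Finset.sum_congr rfl fun i _ => by ring
    rw [this]
    exact abs_sum_le_card fun i => mul1 _ _ _ (s1 j i)
  have s3 : ∀ j k, |K j k - ν j * (ν k * κ)| ≤ N * a + N * (N * a) := by
    intro j k
    have : K j k - ν j * (ν k * κ) = (K j k - ν j * W k) + ν j * (W k - ν k * κ) := by ring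
    rw [this]
    exact (abs_add_le _ _).trans (add_le_add (s1 j k) (mul1 _ _ _ (s2 k)))
  set c := N * a + N * (N * a) with hc
  have s4 : |κ| ≤ A + N * c := by
    have : κ = (∑ i, K i i) - ∑ i, (K i i - ν i * (ν i * κ)) := by
      rw [Finset.sum_sub_distrib]
      have : ∑ i, ν i * (ν i * κ) = κ := by
        calc ∑ i, ν i * (ν i * κ) = ∑ i, ν i ^ 2 * κ := Finset.sum_congr rfl fun i _ => by ring
          _ = κ := by rw [← Finset.sum_mul, hν, one_mul]
      rw [this]; ring
    rw [this]
    exact (abs_sub _ _).trans (add_le_add ht (abs_sum_le_card fun i => s3 i i))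
  have s5 := mul1 _ j _ (mul1 _ k _ s4)
  have : K j k = (K j k - ν j * (ν k * κ)) + ν j * (ν k * κ) := by ring
  rw [this]
  refine (abs_add_le _ _).trans ?_
  have := s3 j k
  linarith

namespace Ref
variable {Ω : Set (EuclideanSpace ℝ (Fin N))} {U : EuclideanSpace ℝ (Fin N) → ℝ}
  {G : Fin N → EuclideanSpace ℝ (Fin N) → ℝ} {H : Fin N → Fin N → EuclideanSpace ℝ (Fin N) → ℝ} {m L : ℝ}
  {h : EuclideanSpace ℝ (Fin N) → ℝ}
  {g : Fin N → EuclideanSpace ℝ (Fin N) → ℝ} {K : Fin N → Fin N → EuclideanSpace ℝ (Fin N) → ℝ} {A B : ℝ}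

lemma abs_mul_le' {a b c d : ℝ} (h1 : |a| ≤ c) (h2 : |b| ≤ d) : |a * b| ≤ c * d := by
  rw [abs_mul]
  exact mul_le_mul h1 h2 (abs_nonneg _) ((abs_nonneg _).trans h1)

lemma lap_Gg (r : Ref Ω U G H m L) (n : Nice Ω h g K) {Gb Kb : ℝ} {x} (hx : x ∈ Ω)
    (hA' : ∀ i, |pd i (lap h) x| ≤ A) (hK : ∀ i j, |K i j x| ≤ Kb) (hg : ∀ i, |g i x| ≤ Gb) (i j : Fin N) :
    |lap (fun y => G i y * g j y) x| ≤ L * A + Gb * L + 2 * (N * (L * Kb)) := by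
  have hx' := subset_closure hx
  rw [lap_mul (r.nu.gsm2 r.ho i hx) (n.gsm2 r.ho j hx), n.lapg r.ho j hx, r.nu.lapg r.ho i hx]
  have h1 : |G i x * pd j (lap h) x| ≤ L * A := abs_mul_le' (r.bG i x hx') (hA' j)
  have h2 : |g j x * pd i (lap U) x| ≤ Gb * L := abs_mul_le' (hg j) (r.bl' i x hx)
  have h3 : |∑ k, pd k (G i) x * pd k (g j) x| ≤ N * (L * Kb) := by
    refine abs_sum_le_card fun k => ?_
    rw [n.pdg r.ho j k hx, r.nu.pdg r.ho i k hx]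
    exact abs_mul_le' (r.bH i k x hx') (hK j k)
  have h4 : |2 * ∑ k, pd k (G i) x * pd k (g j) x| ≤ 2 * (N * (L * Kb)) := by
    rw [abs_mul, abs_two]; linarith
  exact (abs_add_le _ _).trans (add_le_add ((abs_add_le _ _).trans (add_le_add h1 h2)) h4)

noncomputable def c3 (N : ℕ) (m L : ℝ) : ℝ := (L * N + 1 / m) * (7 / 2 + cP N m L / 2)
noncomputable def cQ (N : ℕ) (L : ℝ) : ℝ := N * (2 * (2 * L) * L + 2 * (N * (L * L)))
noncomputable def c4 (N : ℕ) (m L : ℝ) (A Kb : ℝ) : ℝ :=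
  2 * (L * A + c3 N m L * A * (L * N) * L + 2 * (N * (L * Kb)))
noncomputable def al (N : ℕ) (m L : ℝ) (A Kb θ : ℝ) : ℝ :=
  2 * θ * (c4 N m L A Kb + 16 * c3 N m L * A * cQ N L) + 16 * c3 N m L * A / θ

lemma c3_nonneg (r : Ref Ω U G H m L) : 0 ≤ c3 N m L := by
  have := r.m0
  have := r.L1
  have := r.cP_nonneg
  unfold c3; positivity

/-- bounds in the local region -/
lemma local_bounds (r : Ref Ω U G H m L) (n : Nice Ω h g K) (A0 : 0 ≤ A) (hA : ∀ x ∈ Ω, |lap h x| ≤ A)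
    (hA' : ∀ i, ∀ x ∈ Ω, |pd i (lap h) x| ≤ A) {c : Fin N → ℝ} {s : ℝ} (hs0 : 0 < s) (hsL : s ≤ L * N)
    (hc : ∑ i, c i ^ 2 = s ^ 2) {x} (hx : x ∈ closure Ω) (hQ : ∑ i, (G i x - c i) ^ 2 ≤ s ^ 2 / 4)
    (hU : U x ≤ s ^ 2 / 2) :
    s ^ 2 / 4 ≤ ∑ i, G i x ^ 2 ∧ (∀ i, |G i x| ≤ 2 * s) ∧ ∀ i, |g i x| ≤ c3 N m L * A * s := by
  have h1 : ∑ i, G i x ^ 2 ≤ 2 * ∑ i, (G i x - c i) ^ 2 + 2 * ∑ i, c i ^ 2 := by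
    rw [Finset.mul_sum, Finset.mul_sum, ← Finset.sum_add_distrib]
    exact Finset.sum_le_sum fun i _ => by nlinarith [sq_nonneg (G i x - 2 * c i)]
  have h2 : ∑ i, c i ^ 2 ≤ 2 * ∑ i, (G i x - c i) ^ 2 + 2 * ∑ i, G i x ^ 2 := by
    rw [Finset.mul_sum, Finset.mul_sum, ← Finset.sum_add_distrib]
    exact Finset.sum_le_sum fun i _ => by nlinarith [sq_nonneg (c i - 2 * G i x)]
  have h3 : ∑ i, G i x ^ 2 ≤ 5 / 2 * s ^ 2 := by linarith
  have hcP := r.cP_nonneg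
  refine ⟨by linarith, fun i => ?_, fun i => ?_⟩
  · have : G i x ^ 2 ≤ (2 * s) ^ 2 := by
      have := Finset.single_le_sum (f := fun i => G i x ^ 2) (fun i _ => sq_nonneg (G i x)) (Finset.mem_univ i)
      nlinarith
    exact abs_le_of_sq_le_sq this (by linarith)
  · have h4 := r.L2' n A0 hA hA' hs0 hsL i x hx
    refine h4.trans ?_
    have hPsi : Psi U G m L x ≤ (5 / 2 + cP N m L / 2) * s ^ 2 := by
      unfold Psi
      have := mul_le_mul_of_nonneg_left hU hcP
      linarith
    have h5 : Psi U G m L x / s + s ≤ (7 / 2 + cP N m L / 2) * s := by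
      have : Psi U G m L x / s ≤ (5 / 2 + cP N m L / 2) * s := by
        rw [div_le_iff₀ hs0]; linarith
      linarith
    have hm := r.m0
    have hL := r.L1
    calc _ ≤ (L * N + 1 / m) * A * ((7 / 2 + cP N m L / 2) * s) := mul_le_mul_of_nonneg_left h5 (by positivity)
      _ = _ := by unfold c3; ring

/-- key boundary tangential estimate -/
lemma z_reg (r : Ref Ω U G H m L) (n : Nice Ω h g K) (A0 : 0 ≤ A) (hA : ∀ x ∈ Ω, |lap h x| ≤ A)
    (hA' : ∀ i, ∀ x ∈ Ω, |pd i (lap h) x| ≤ A) {Kb : ℝ} (hK : ∀ i j, ∀ x ∈ closure Ω, |K i j x| ≤ Kb)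
    (Kb0 : 0 ≤ Kb)
    {q : EuclideanSpace ℝ (Fin N)} (hq : q ∈ frontier Ω) {ν : Fin N → ℝ} {s : ℝ} (hP : PN Ω q ν) (hs0 : 0 < s)
    (hsL : s ≤ L * N)
    (hν : ∑ i, ν i ^ 2 = 1) (hs : ∀ i, G i q = s * ν i) {θ : ℝ} (hθ : 0 < θ) (hθ1 : θ ≤ 1) (i j : Fin N) :
    ∃ t, |t| ≤ al N m L A Kb θ * s ∧ ∀ k, (G i q * K j k q + g j q * H i k q) -
      (G j q * K i k q + g i q * H j k q) = t * ν k := by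
  have hqc := frontier_subset_closure hq
  have hL := r.L1
  have hNR : (0:ℝ) < N := by exact_mod_cast r.hN
  have hC3 := r.c3_nonneg
  set C3 := c3 N m L with hC3d
  set β : ℝ := 16 * C3 * A with hβ
  set P := c4 N m L A Kb with hPd
  set α := al N m L A Kb θ with hα
  set κ : ℝ := 1 / (θ * s ^ 2) with hκ
  have hβ0 : 0 ≤ β := by positivity
  have hCQ0 : 0 ≤ cQ N L := by unfold cQ; positivity
  have hP0 : 0 ≤ P := by rw [hPd]; unfold c4; positivity
  have hα' : α = 2 * θ * (P + β * cQ N L) + 16 * C3 * A / θ := by rw [hα]; unfold al; rw [← hPd, ← hC3d]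
  have hα0 : 0 ≤ α := by rw [hα']; positivity
  have hκ0 : 0 < κ := by positivity
  have hκs : κ * s ^ 2 = 1 / θ := by rw [hκ]; field_simp
  set c : Fin N → ℝ := fun i => G i q with hcd
  have hc : ∑ i, c i ^ 2 = s ^ 2 := by
    calc ∑ i, c i ^ 2 = ∑ i, s ^ 2 * ν i ^ 2 := Finset.sum_congr rfl fun i _ => by rw [hcd]; simp only; rw [hs i]; ring
      _ = s ^ 2 := by rw [← Finset.mul_sum, hν, mul_one]
  set Q : EuclideanSpace ℝ (Fin N) → ℝ := fun y => ∑ i, (G i y - c i) ^ 2 with hQd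
  have hQc : ContinuousOn Q (closure Ω) := continuousOn_finsetSum _ fun i _ => ((r.nu.cg i).sub continuousOn_const).pow 2
  have hQ0 : ∀ y, 0 ≤ Q y := fun y => Finset.sum_nonneg fun i _ => sq_nonneg _
  have hQq : Q q = 0 := by rw [hQd]; simp [hcd]
  have hUq : U q = 0 := r.nu.b0 q hq
  set z : EuclideanSpace ℝ (Fin N) → ℝ := fun y => G i y * g j y - G j y * g i y with hz
  set b : EuclideanSpace ℝ (Fin N) → ℝ := fun y => β * Q y + α * (U y - κ * (U y * U y)) with hb
  have hzc : ContinuousOn z (closure Ω) := ((r.nu.cg i).mul (n.cg j)).sub ((r.nu.cg j).mul (n.cg i))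
  have hbc : ContinuousOn b (closure Ω) := (continuousOn_const.mul hQc).add
    (continuousOn_const.mul (r.nu.ch.sub (continuousOn_const.mul (r.nu.ch.mul r.nu.ch))))
  set D : Set (EuclideanSpace ℝ (Fin N)) := (Ω ∩ Q ⁻¹' Set.Iio (s ^ 2 / 4)) ∩ (Ω ∩ U ⁻¹' Set.Iio (θ * s ^ 2 / 2)) with hD
  have hDo : IsOpen D := ((hQc.mono subset_closure).isOpen_inter_preimage r.ho isOpen_Iio).inter
    ((r.nu.ch.mono subset_closure).isOpen_inter_preimage r.ho isOpen_Iio)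
  have hDΩ : D ⊆ Ω := fun x hx => hx.1.1
  have hDcl : closure D ⊆ closure Ω := closure_mono hDΩ
  have hDQ : ∀ x ∈ closure D, Q x ≤ s ^ 2 / 4 :=
    Nice.closure_le' (Ω := D) (hQc.mono hDcl) continuousOn_const fun x hx => le_of_lt hx.1.2
  have hDU : ∀ x ∈ closure D, U x ≤ θ * s ^ 2 / 2 :=
    Nice.closure_le' (Ω := D) (r.nu.ch.mono hDcl) continuousOn_const fun x hx => le_of_lt hx.2.2
  have hloc : ∀ x ∈ closure D, s ^ 2 / 4 ≤ ∑ i, G i x ^ 2 ∧ (∀ i, |G i x| ≤ 2 * s) ∧ ∀ i, |g i x| ≤ C3 * A * s :=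
    fun x hx => r.local_bounds n A0 hA hA' hs0 hsL hc (hDcl hx) (hDQ x hx) ((hDU x hx).trans (by nlinarith [sq_nonneg s]))
  have hzS : ∀ x ∈ closure D, |z x| ≤ 4 * C3 * A * s ^ 2 := by
    intro x hx
    obtain ⟨-, h1, h2⟩ := hloc x hx
    have := (abs_sub (G i x * g j x) (G j x * g i x)).trans
      (add_le_add (abs_mul_le' (h1 i) (h2 j)) (abs_mul_le' (h1 j) (h2 i)))
    calc |z x| ≤ _ := this
      _ = _ := by ring
  have hUk : ∀ x ∈ closure D, κ * U x ≤ 1 / 2 := by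
    intro x hx
    calc κ * U x ≤ κ * (θ * s ^ 2 / 2) := mul_le_mul_of_nonneg_left (hDU x hx) hκ0.le
      _ = 1 / 2 := by rw [hκ]; field_simp
  have hUb : ∀ x ∈ closure D, U x / 2 ≤ U x - κ * (U x * U x) := by
    intro x hx
    have := mul_le_mul_of_nonneg_right (hUk x hx) (r.U_nonneg x (hDcl hx))
    linarith
  have main : ∀ σ : ℝ, (σ = 1 ∨ σ = -1) → ∀ x ∈ D, 0 ≤ b x + σ * z x := by
    intro σ hσ
    have hσ1 : |σ| = 1 := by rcases hσ with h | h <;> simp [h]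
    refine min_principle r.hN hDo (r.hb.subset hDΩ) ((hbc.add (continuousOn_const.mul hzc)).mono hDcl) ?_ ?_ ?_
    · intro x hx
      have hx' := hDΩ hx
      have hU2 := r.nu.sm2 x hx'
      exact ((contDiffAt_const.mul (r.sumsq_sm hx' c)).add (contDiffAt_const.mul (hU2.sub (contDiffAt_const.mul (hU2.mul hU2))))).add
        (contDiffAt_const.mul (((r.nu.gsm2 r.ho i hx').mul (n.gsm2 r.ho j hx')).sub ((r.nu.gsm2 r.ho j hx').mul (n.gsm2 r.ho i hx'))))
    · intro x hx
      have hx' := hDΩ hx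
      have hxc := subset_closure hx
      have hU2 := r.nu.sm2 x hx'
      have hQ2 := r.sumsq_sm hx' c
      have hz1 := (r.nu.gsm2 r.ho i hx').mul (n.gsm2 r.ho j hx')
      have hz2 := (r.nu.gsm2 r.ho j hx').mul (n.gsm2 r.ho i hx')
      have hUU := contDiffAt_const (c := κ) |>.mul (hU2.mul hU2)
      rw [lap_add ((contDiffAt_const.mul hQ2).add (contDiffAt_const.mul (hU2.sub hUU))) (contDiffAt_const.mul (hz1.sub hz2)),
        lap_add (contDiffAt_const.mul hQ2) (contDiffAt_const.mul (hU2.sub hUU)), lap_const_mul _ hQ2,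
        lap_const_mul _ (hU2.sub hUU), lap_sub hU2 hUU, lap_const_mul _ (hU2.mul hU2), lap_mul hU2 hU2,
        lap_const_mul _ (hz1.sub hz2), lap_sub hz1 hz2]
      obtain ⟨l1, l2, l3⟩ := hloc x hxc
      have e1 : lap Q x ≤ cQ N L := r.lap_sumsq_le hx' (b := 2 * L) fun i => by
        have := (abs_sub (G i x) (c i)).trans (add_le_add (r.bG i x (subset_closure hx')) (r.bG i q hqc))
        linarith
      have e2 : |lap (fun y => G i y * g j y) x - lap (fun y => G j y * g i y) x| ≤ P := by
        have hgb : ∀ i, |g i x| ≤ C3 * A * (L * N) := fun i => (l3 i).trans (mul_le_mul_of_nonneg_left hsL (by positivity))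
        have k1 := r.lap_Gg n hx' (fun i => hA' i x hx') (fun i j => hK i j x (subset_closure hx')) hgb i j
        have k2 := r.lap_Gg n hx' (fun i => hA' i x hx') (fun i j => hK i j x (subset_closure hx')) hgb j i
        refine (abs_sub _ _).trans ((add_le_add k1 k2).trans (le_of_eq ?_))
        rw [hPd]; unfold c4; ring
      have e2' : σ * (lap (fun y => G i y * g j y) x - lap (fun y => G j y * g i y) x) ≤ P :=
        (le_abs_self _).trans (by rw [abs_mul, hσ1, one_mul]; exact e2)
      have e3 : s ^ 2 / 4 ≤ ∑ k, pd k U x * pd k U x := by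
        refine l1.trans (le_of_eq (Finset.sum_congr rfl fun k _ => ?_))
        rw [r.nu.gi k x hx']; ring
      have e4 : lap U x * (1 - 2 * (κ * U x)) ≤ 0 :=
        mul_nonpos_of_nonpos_of_nonneg (by linarith [r.lapU x hx', r.m0]) (by linarith [hUk x hxc])
      have e5 : lap U x - κ * (U x * lap U x + U x * lap U x + 2 * ∑ k, pd k U x * pd k U x) ≤ - (1 / (2 * θ)) := by
        have := mul_le_mul_of_nonneg_left e3 hκ0.le
        have t : κ * (s ^ 2 / 4) = 1 / (4 * θ) := by rw [← mul_div_assoc, hκs]; field_simp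
        have t2 : 1 / (2 * θ) = 2 * (1 / (4 * θ)) := by field_simp; norm_num
        rw [t2]
        rw [t] at this
        linarith
      have e6 := mul_le_mul_of_nonneg_left e5 hα0
      have e7 : P + β * cQ N L ≤ α * (1 / (2 * θ)) := by
        rw [hα']
        have : (2 * θ * (P + β * cQ N L) + 16 * C3 * A / θ) * (1 / (2 * θ)) = P + β * cQ N L + 8 * C3 * A / θ ^ 2 := by
          field_simp; ring
        rw [this]
        have : 0 ≤ 8 * C3 * A / θ ^ 2 := by positivity
        linarith
      have e8 := mul_le_mul_of_nonneg_left e1 hβ0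
      linarith
    · intro x hx
      have hxc := frontier_subset_closure hx
      have hxO := hDcl hxc
      have hU0 := r.U_nonneg x hxO
      have hz' : -|z x| ≤ σ * z x := by
        have := neg_abs_le (σ * z x); rwa [abs_mul, hσ1, one_mul] at this
      have b1 : β * Q x + α * (U x / 2) ≤ b x := by
        have := mul_le_mul_of_nonneg_left (hUb x hxc) hα0
        rw [hb]; simp only; linarith
      have b2 : 0 ≤ β * Q x := mul_nonneg hβ0 (hQ0 x)
      have b3 : 0 ≤ α * (U x / 2) := mul_nonneg hα0 (by linarith)
      rcases r.mem_or hxO with k | k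
      · by_cases kQ : Q x < s ^ 2 / 4
        · have kU : θ * s ^ 2 / 2 ≤ U x := by
            by_contra hlt
            rw [hDo.frontier_eq] at hx
            exact hx.2 ⟨⟨k, kQ⟩, ⟨k, not_le.1 hlt⟩⟩
          have : 4 * C3 * A * s ^ 2 ≤ α * (U x / 2) := by
            calc 4 * C3 * A * s ^ 2 = (16 * C3 * A / θ) * (θ * s ^ 2 / 2 / 2) := by field_simp; ring
              _ ≤ α * (U x / 2) := by
                refine mul_le_mul ?_ (by linarith) (by positivity) hα0
                rw [hα']; have : 0 ≤ 2 * θ * (P + β * cQ N L) := by positivity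
                linarith
          linarith [hzS x hxc]
        · have : 4 * C3 * A * s ^ 2 ≤ β * Q x := by
            calc 4 * C3 * A * s ^ 2 = β * (s ^ 2 / 4) := by rw [hβ]; ring
              _ ≤ β * Q x := mul_le_mul_of_nonneg_left (not_lt.1 kQ) hβ0
          linarith [hzS x hxc]
      · have : z x = 0 := r.bdry_z n A0 hA i j x k
        rw [this, mul_zero]
        linarith
  have hdQ : HasFDerivWithinAt Q (mkL fun _ => ∑ _l : Fin N, (0:ℝ)) (closure Ω) q := by
    refine hfd_sum (fun l y => (G l y - c l) ^ 2) (fun _ _ => 0) fun l => ?_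
    have h1 := hfd_sub (r.nu.dg l q hqc) (hfd_const (c l))
    have h2 := hfd_mul h1 h1
    refine HasFDerivWithinAt.congr_fderiv (f' := mkL fun k => (G l q - c l) * (H l k q - 0) + (G l q - c l) * (H l k q - 0)) ?_ ?_
    · convert h2 using 2; ring
    · congr 1; funext k; simp [hcd]
  have hdU := r.nu.dh q hqc
  have hdb := hfd_add (hfd_cmul β hdQ) (hfd_cmul α (hfd_sub hdU (hfd_cmul κ (hfd_mul hdU hdU))))
  have hdz := hfd_sub (hfd_mul (r.nu.dg i q hqc) (n.dg j q hqc)) (hfd_mul (r.nu.dg j q hqc) (n.dg i q hqc))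
  refine hP.two hν hdb hdz (by rw [hQq, hUq]; ring) (r.bdry_z n A0 hA i j q hq) (fun k => ?_) ?_
  · rw [hUq, hs k]; simp; ring
  · have c1 : ∀ᶠ x in 𝓝[Ω] q, Q x < s ^ 2 / 4 :=
      ((hQc q hqc).mono subset_closure).eventually_lt_const (by rw [hQq]; positivity)
    have c2 : ∀ᶠ x in 𝓝[Ω] q, U x < θ * s ^ 2 / 2 :=
      ((r.nu.ch q hqc).mono subset_closure).eventually_lt_const (by rw [hUq]; positivity)
    filter_upwards [c1, c2, self_mem_nhdsWithin] with x h1 h2 h3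
    have hxD : x ∈ D := ⟨⟨h3, h1⟩, ⟨h3, h2⟩⟩
    have k1 := main 1 (Or.inl rfl) x hxD
    have k2 := main (-1) (Or.inr rfl) x hxD
    change |z x| ≤ b x
    rw [abs_le]; constructor <;> linarith

lemma hess_bdry (r : Ref Ω U G H m L) (n : Nice Ω h g K) (A0 : 0 ≤ A) (hA : ∀ x ∈ Ω, |lap h x| ≤ A)
    (hA' : ∀ i, ∀ x ∈ Ω, |pd i (lap h) x| ≤ A) {Kb : ℝ} (hK : ∀ i j, ∀ x ∈ closure Ω, |K i j x| ≤ Kb)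
    (Kb0 : 0 ≤ Kb) {θ : ℝ} (hθ : 0 < θ) (hθ1 : θ ≤ 1) (j k : Fin N) : ∀ p ∈ frontier Ω,
    |K j k p| ≤ A + (N + 1) * (N * (al N m L A Kb θ + 2 * (A / m * L)) + N * (N * (al N m L A Kb θ + 2 * (A / m * L)))) := by
  refine reg_le r.ho (n.cH j k).abs continuousOn_const ?_
  intro q hq
  have hqc := frontier_subset_closure hq.1
  obtain ⟨ν, s, hs0, hsL, hν, hs, hP⟩ := r.reg_point hq
  obtain ⟨t, ht, hg⟩ := r.reg_grad n A0 hA hq.1 hP hν hs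
  refine alg_hess hν (K := fun i j => K i j q) (fun i j => n.Hsymm i j q hqc) ?_ ?_ j k
  · intro i j k
    obtain ⟨t', ht', hz⟩ := r.z_reg n A0 hA hA' hK Kb0 hq.1 hP hs0 hsL hν hs hθ hθ1 i j
    have e := hz k
    rw [hs i, hs j, hg i, hg j] at e
    have e1 : s * (ν i * K j k q - ν j * K i k q) = t' * ν k - t * (ν j * H i k q - ν i * H j k q) := by linarith
    have e2 : |t' * ν k - t * (ν j * H i k q - ν i * H j k q)| ≤ al N m L A Kb θ * s * 1 + A / m * s * (1 * L + 1 * L) := by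
      refine (abs_sub _ _).trans (add_le_add (abs_mul_le' ht' (sum_unit_abs hν k)) (abs_mul_le' ht ?_))
      exact (abs_sub _ _).trans (add_le_add (abs_mul_le' (sum_unit_abs hν j) (r.bH i k q hqc))
        (abs_mul_le' (sum_unit_abs hν i) (r.bH j k q hqc)))
    rw [← e1, abs_mul, abs_of_pos hs0] at e2
    refine le_of_mul_le_mul_left (e2.trans (le_of_eq ?_)) hs0
    ring
  · have : ∀ x ∈ closure Ω, |∑ i, K i i x| ≤ A :=
      Nice.closure_le' (continuousOn_finsetSum _ fun i _ => n.cH i i).abs continuousOn_const fun x hx => by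
        rw [n.trace hx]; exact hA x hx
    exact this q hqc

end Ref
end LP4

section LP5
open Filter Topology
variable {N : ℕ} {u v w : EuclideanSpace ℝ (Fin N) → ℝ}

lemma half_bound {ι : Type*} (f : ι → ℝ) {k D : ℝ} (hk : ∀ i, f i ≤ k) (hD : 0 ≤ D)
    (h : ∀ k, 0 ≤ k → (∀ i, f i ≤ k) → ∀ i, f i ≤ D + k / 2) : ∀ i, f i ≤ 2 * D := by
  intro i
  have : Nonempty ι := ⟨i⟩
  have hb : BddAbove (Set.range f) := ⟨k, by rintro _ ⟨j, rfl⟩; exact hk j⟩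
  have h1 := h (max 0 (⨆ j, f j)) (le_max_left _ _) (fun j => (le_ciSup hb j).trans (le_max_right _ _))
  have h2 : (⨆ j, f j) ≤ D + max 0 (⨆ j, f j) / 2 := ciSup_le h1
  have h3 : max 0 (⨆ j, f j) ≤ 2 * D := by
    rcases le_total 0 (⨆ j, f j) with h | h
    · rw [max_eq_right h] at h2 ⊢; linarith
    · rw [max_eq_left h]; linarith
  linarith [h1 i]

namespace Ref
variable {Ω : Set (EuclideanSpace ℝ (Fin N))} {U : EuclideanSpace ℝ (Fin N) → ℝ}
  {G : Fin N → EuclideanSpace ℝ (Fin N) → ℝ} {H : Fin N → Fin N → EuclideanSpace ℝ (Fin N) → ℝ} {m L : ℝ}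

lemma int_radius (r : Ref Ω U G H m L) {η : ℝ} (hη : 0 < η) :
    ∃ ρ : ℝ, 0 < ρ ∧ ∀ x ∈ Ω, η ≤ U x → Metric.closedBall x ρ ⊆ Ω := by
  have hcl : IsCompact (closure Ω) := r.hb.isCompact_closure
  have hK : IsCompact (closure Ω ∩ U ⁻¹' Set.Ici η) :=
    hcl.of_isClosed_subset (r.nu.ch.preimage_isClosed_of_isClosed isClosed_closure isClosed_Ici) Set.inter_subset_left
  have hsub : closure Ω ∩ U ⁻¹' Set.Ici η ⊆ Ω := by
    rintro x ⟨hx, hx2⟩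
    rcases r.mem_or hx with k | k
    · exact k
    · have := r.nu.b0 x k
      simp only [Set.mem_preimage, Set.mem_Ici] at hx2
      linarith
  obtain ⟨ρ, hρ, h⟩ := hK.exists_cthickening_subset_open r.ho hsub
  exact ⟨ρ, hρ, fun x hx hx2 => (Metric.closedBall_subset_cthickening (E := closure Ω ∩ U ⁻¹' Set.Ici η)
    ⟨subset_closure hx, hx2⟩ ρ).trans h⟩

lemma grad_lemma (r : Ref Ω U G H m L) {η : ℝ} (hη : 0 < η) : ∃ C : ℝ, 0 ≤ C ∧
    ∀ (h : EuclideanSpace ℝ (Fin N) → ℝ) (g : Fin N → EuclideanSpace ℝ (Fin N) → ℝ)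
      (K : Fin N → Fin N → EuclideanSpace ℝ (Fin N) → ℝ) (A0 A1 : ℝ), Nice Ω h g K → 0 ≤ A0 → 0 ≤ A1 →
      (∀ x ∈ Ω, |lap h x| ≤ A0) → (∀ i, ∀ x ∈ Ω, |pd i (lap h) x| ≤ A1) →
      ∀ j, ∀ x ∈ closure Ω, |g j x| ≤ C * A0 + η * A1 := by
  have hm := r.m0
  have hL := r.L1
  obtain ⟨ρ, hρ, hball⟩ := r.int_radius (η := η * m) (by positivity)
  refine ⟨L * N / m + (N * (L / m) / ρ + ρ / 2), by positivity, ?_⟩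
  intro h g K A0 A1 n hA0 hA1 h0 h1 j x hx
  have hh : ∀ x ∈ closure Ω, |h x| ≤ A0 / m * L := fun x hx => (r.L1' n hA0 h0 x hx).trans
    (mul_le_mul_of_nonneg_left ((le_abs_self _).trans (r.bU x hx)) (by positivity))
  have key := r.cmpη (n.cg j) (fun x hx => n.gsm2 r.ho j hx) (B := A1) (η := η * m)
    (M := (L * N / m + (N * (L / m) / ρ + ρ / 2)) * A0)
    (fun x hx => by rw [n.lapg r.ho j hx]; exact h1 j x hx) hA1 (by positivity) ?_ ?_ x hx
  · refine key.trans (le_of_eq ?_)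
    field_simp
  · intro x hx
    refine (r.bdry_grad' n hA0 h0 j x hx).trans ?_
    have e : (L * N / m + (N * (L / m) / ρ + ρ / 2)) * A0 = A0 / m * (L * N) + (N * (L / m) / ρ + ρ / 2) * A0 := by ring
    rw [e]
    have : 0 ≤ (N * (L / m) / ρ + ρ / 2) * A0 := by positivity
    linarith
  · intro x hx hxU
    have hb := hball x hx hxU
    rw [n.gi j x hx]
    refine (grad_est r.hN j hρ (fun y hy => n.sm2 y (hb hy)) (fun y hy => hh y (subset_closure (hb hy)))
      (fun y hy => h0 y (hb hy))).trans ?_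
    have e : (L * N / m + (N * (L / m) / ρ + ρ / 2)) * A0 = L * N / m * A0 + (N * (A0 / m * L) / ρ + A0 * ρ / 2) := by ring
    rw [e]
    have : 0 ≤ L * N / m * A0 := by positivity
    linarith

lemma al_eq (A Kb θ : ℝ) : al N m L A Kb θ = A * al N m L 1 0 θ + 8 * θ * N * L * Kb := by
  unfold al c4; ring

lemma hess_lemma (r : Ref Ω U G H m L) {η : ℝ} (hη : 0 < η) : ∃ C : ℝ, 0 ≤ C ∧
    ∀ (h : EuclideanSpace ℝ (Fin N) → ℝ) (g : Fin N → EuclideanSpace ℝ (Fin N) → ℝ)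
      (K : Fin N → Fin N → EuclideanSpace ℝ (Fin N) → ℝ) (A B : ℝ), Nice Ω h g K → 0 ≤ A → 0 ≤ B →
      (∀ x ∈ Ω, |lap h x| ≤ A) → (∀ i, ∀ x ∈ Ω, |pd i (lap h) x| ≤ A) →
      (∀ i j, ∀ x ∈ Ω, |pd j (pd i (lap h)) x| ≤ B) →
      ∀ i j, ∀ x ∈ closure Ω, |K i j x| ≤ C * A + η * B := by
  have hm := r.m0
  have hL := r.L1
  have hNR : (0:ℝ) < N := by exact_mod_cast r.hN
  obtain ⟨C1, hC1, hg⟩ := r.grad_lemma (η := 1) one_pos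
  obtain ⟨ρ, hρ, hball⟩ := r.int_radius (η := η * m / 2) (by positivity)
  set cN : ℝ := (N + 1) * (N + N * N) with hcN
  have hcN0 : 0 < cN := by positivity
  set θ : ℝ := min 1 (1 / (16 * cN * N * L)) with hθd
  have hθ : 0 < θ := by rw [hθd]; positivity
  have hθ1 : θ ≤ 1 := min_le_left _ _
  have hθ2 : cN * (8 * θ * N * L) ≤ 1 / 2 := by
    have : θ ≤ 1 / (16 * cN * N * L) := min_le_right _ _
    rw [le_div_iff₀ (by positivity)] at this
    linarith
  set a1 := al N m L 1 0 θ with ha1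
  have ha10 : 0 ≤ a1 := by
    have := r.c3_nonneg
    rw [ha1]; unfold al c4 cQ; positivity
  set Cb := 1 + cN * (a1 + 2 * (L / m)) with hCb
  set Ci := N * (C1 + 1) / ρ + ρ / 2 with hCi
  have hCb0 : 0 ≤ Cb := by positivity
  have hCi0 : 0 ≤ Ci := by positivity
  refine ⟨2 * (Cb + Ci), by positivity, ?_⟩
  intro h g K A B n hA hB h0 h1 h2
  obtain ⟨k, -, hk⟩ := n.bdd r.hb
  have key := half_bound (ι := Fin N × Fin N × closure Ω) (fun p => |K p.1 p.2.1 p.2.2|) (k := k) (D := (Cb + Ci) * A + η / 2 * B)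
    (fun p => (hk p.2.2 p.2.2.2).2.2 p.1 p.2.1) (by positivity) ?_
  · intro i j x hx
    have := key (i, j, ⟨x, hx⟩)
    simp only at this
    linarith
  · intro Kb hKb hK
    have hK' : ∀ i j, ∀ x ∈ closure Ω, |K i j x| ≤ Kb := fun i j x hx => hK (i, j, ⟨x, hx⟩)
    rintro ⟨i, j, x, hx⟩
    simp only
    have := r.cmpη (n.cH i j) (fun x hx => n.Hsm2 r.ho i j hx) (B := B) (η := η * m / 2)
      (M := (Cb + Ci) * A + Kb / 2)
      (fun x hx => by rw [n.lapH r.ho i j hx]; exact h2 i j x hx) hB (by positivity) ?_ ?_ x hx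
    · refine this.trans (le_of_eq ?_)
      field_simp
      ring
    · intro p hp
      refine (r.hess_bdry n hA h0 h1 hK' hKb hθ hθ1 i j p hp).trans ?_
      rw [al_eq]
      have e : A + (N + 1) * (N * (A * al N m L 1 0 θ + 8 * θ * N * L * Kb + 2 * (A / m * L)) +
        N * (N * (A * al N m L 1 0 θ + 8 * θ * N * L * Kb + 2 * (A / m * L)))) = Cb * A + cN * (8 * θ * N * L) * Kb := by
        rw [hCb, hcN, ha1]; ring
      rw [e]
      have e2 := mul_le_mul_of_nonneg_right hθ2 hKb
      have e3 : 0 ≤ Ci * A := by positivity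
      linarith
    · intro y hy hyU
      have hb := hball y hy hyU
      rw [← n.pdg r.ho i j hy]
      refine (grad_est r.hN j hρ (fun z hz => n.gsm2 r.ho i (hb hz)) (M := (C1 + 1) * A) (A := A)
        (fun z hz => ?_) (fun z hz => ?_)).trans ?_
      · have := hg h g K A A n hA hA h0 h1 i z (subset_closure (hb hz))
        linarith
      · rw [n.lapg r.ho i (hb hz)]; exact h1 i z (hb hz)
      · have e : N * ((C1 + 1) * A) / ρ + A * ρ / 2 = Ci * A := by rw [hCi]; ring
        rw [e]
        have : 0 ≤ Cb * A := by positivity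
        linarith

end Ref
end LP5

section LP6
open Filter Topology
variable {N : ℕ}

namespace Ref
variable {Ω : Set (EuclideanSpace ℝ (Fin N))} {U : EuclideanSpace ℝ (Fin N) → ℝ}
  {G : Fin N → EuclideanSpace ℝ (Fin N) → ℝ} {H : Fin N → Fin N → EuclideanSpace ℝ (Fin N) → ℝ} {m L : ℝ}

lemma sysG (r : Ref Ω U G H m L) {M : ℝ} (hM : 0 ≤ M) : ∃ C : ℝ, 0 ≤ C ∧
    ∀ (h h' : EuclideanSpace ℝ (Fin N) → ℝ) (g g' : Fin N → EuclideanSpace ℝ (Fin N) → ℝ)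
      (K K' : Fin N → Fin N → EuclideanSpace ℝ (Fin N) → ℝ) (δ : ℝ), Nice Ω h g K → Nice Ω h' g' K' → 0 ≤ δ →
      (∀ x ∈ Ω, |lap h x| ≤ M * δ) → (∀ x ∈ Ω, |lap h' x| ≤ M * δ) →
      (∀ i, ∀ x ∈ Ω, |pd i (lap h) x| ≤ M * (δ + |g' i x|)) →
      (∀ i, ∀ x ∈ Ω, |pd i (lap h') x| ≤ M * (δ + |g i x|)) →
      ∀ j, ∀ x ∈ closure Ω, |g j x| ≤ C * δ ∧ |g' j x| ≤ C * δ := by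
  obtain ⟨C, hC, hg⟩ := r.grad_lemma (η := 1 / (2 * (M + 1))) (by positivity)
  have hη : 1 / (2 * (M + 1)) * M ≤ 1 / 2 := by
    rw [div_mul_eq_mul_div, div_le_div_iff₀ (by positivity) (by norm_num)]; linarith
  refine ⟨2 * (C * M + 1 / 2), by positivity, ?_⟩
  intro h h' g g' K K' δ n n' hδ l0 l0' l1 l1'
  obtain ⟨k, -, hk⟩ := n.bdd r.hb
  obtain ⟨k', -, hk'⟩ := n'.bdd r.hb
  have key := half_bound (ι := Fin N × closure Ω) (fun p => max |g p.1 p.2| |g' p.1 p.2|) (k := max k k')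
    (D := (C * M + 1 / 2) * δ) (fun p => max_le_max ((hk p.2 p.2.2).2.1 p.1) ((hk' p.2 p.2.2).2.1 p.1)) (by positivity) ?_
  · intro j x hx
    have := key (j, ⟨x, hx⟩)
    simp only [max_le_iff] at this
    constructor <;> linarith [this.1, this.2]
  · intro k hk0 hk
    simp only [max_le_iff] at hk
    have hk1 : ∀ i, ∀ x ∈ closure Ω, |g i x| ≤ k := fun i x hx => (hk (i, ⟨x, hx⟩)).1
    have hk2 : ∀ i, ∀ x ∈ closure Ω, |g' i x| ≤ k := fun i x hx => (hk (i, ⟨x, hx⟩)).2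
    rintro ⟨j, x, hx⟩
    have e : C * (M * δ) + 1 / (2 * (M + 1)) * (M * (δ + k)) ≤ (C * M + 1 / 2) * δ + k / 2 := by
      have := mul_le_mul_of_nonneg_right hη (add_nonneg hδ hk0)
      linarith
    refine max_le ?_ ?_
    · refine (hg h g K (M * δ) (M * (δ + k)) n (by positivity) (by positivity) l0 (fun i x hx => (l1 i x hx).trans ?_) j x hx).trans e
      exact mul_le_mul_of_nonneg_left (by linarith [hk2 i x (subset_closure hx)]) hM
    · refine (hg h' g' K' (M * δ) (M * (δ + k)) n' (by positivity) (by positivity) l0' (fun i x hx => (l1' i x hx).trans ?_) j x hx).trans e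
      exact mul_le_mul_of_nonneg_left (by linarith [hk1 i x (subset_closure hx)]) hM

lemma sysK (r : Ref Ω U G H m L) {M : ℝ} (hM : 0 ≤ M) : ∃ C : ℝ, 0 ≤ C ∧
    ∀ (h h' : EuclideanSpace ℝ (Fin N) → ℝ) (g g' : Fin N → EuclideanSpace ℝ (Fin N) → ℝ)
      (K K' : Fin N → Fin N → EuclideanSpace ℝ (Fin N) → ℝ) (δ : ℝ), Nice Ω h g K → Nice Ω h' g' K' → 0 ≤ δ →
      (∀ x ∈ Ω, |lap h x| ≤ M * δ) → (∀ x ∈ Ω, |lap h' x| ≤ M * δ) →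
      (∀ i, ∀ x ∈ Ω, |pd i (lap h) x| ≤ M * δ) →
      (∀ i, ∀ x ∈ Ω, |pd i (lap h') x| ≤ M * δ) →
      (∀ i j, ∀ x ∈ Ω, |pd j (pd i (lap h)) x| ≤ M * (δ + |K' i j x|)) →
      (∀ i j, ∀ x ∈ Ω, |pd j (pd i (lap h')) x| ≤ M * (δ + |K i j x|)) →
      ∀ i j, ∀ x ∈ closure Ω, |K i j x| ≤ C * δ ∧ |K' i j x| ≤ C * δ := by
  obtain ⟨C, hC, hg⟩ := r.hess_lemma (η := 1 / (2 * (M + 1))) (by positivity)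
  have hη : 1 / (2 * (M + 1)) * M ≤ 1 / 2 := by
    rw [div_mul_eq_mul_div, div_le_div_iff₀ (by positivity) (by norm_num)]; linarith
  refine ⟨2 * (C * M + 1 / 2), by positivity, ?_⟩
  intro h h' g g' K K' δ n n' hδ l0 l0' l1 l1' l2 l2'
  obtain ⟨k, -, hk⟩ := n.bdd r.hb
  obtain ⟨k', -, hk'⟩ := n'.bdd r.hb
  have key := half_bound (ι := Fin N × Fin N × closure Ω) (fun p => max |K p.1 p.2.1 p.2.2| |K' p.1 p.2.1 p.2.2|) (k := max k k')
    (D := (C * M + 1 / 2) * δ) (fun p => max_le_max ((hk p.2.2 p.2.2.2).2.2 p.1 p.2.1) ((hk' p.2.2 p.2.2.2).2.2 p.1 p.2.1)) (by positivity) ?_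
  · intro i j x hx
    have := key (i, j, ⟨x, hx⟩)
    simp only [max_le_iff] at this
    constructor <;> linarith [this.1, this.2]
  · intro k hk0 hk
    simp only [max_le_iff] at hk
    have hk1 : ∀ i j, ∀ x ∈ closure Ω, |K i j x| ≤ k := fun i j x hx => (hk (i, j, ⟨x, hx⟩)).1
    have hk2 : ∀ i j, ∀ x ∈ closure Ω, |K' i j x| ≤ k := fun i j x hx => (hk (i, j, ⟨x, hx⟩)).2
    rintro ⟨i, j, x, hx⟩
    have e : C * (M * δ) + 1 / (2 * (M + 1)) * (M * (δ + k)) ≤ (C * M + 1 / 2) * δ + k / 2 := by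
      have := mul_le_mul_of_nonneg_right hη (add_nonneg hδ hk0)
      linarith
    refine max_le ?_ ?_
    · refine (hg h g K (M * δ) (M * (δ + k)) n (by positivity) (by positivity) l0 l1 (fun i j x hx => (l2 i j x hx).trans ?_) i j x hx).trans e
      exact mul_le_mul_of_nonneg_left (by linarith [hk2 i j x (subset_closure hx)]) hM
    · refine (hg h' g' K' (M * δ) (M * (δ + k)) n' (by positivity) (by positivity) l0' l1' (fun i j x hx => (l2' i j x hx).trans ?_) i j x hx).trans e
      exact mul_le_mul_of_nonneg_left (by linarith [hk1 i j x (subset_closure hx)]) hM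
end Ref

/-- Solutions with classical derivative data. -/
structure Sol (Ω : Set (EuclideanSpace ℝ (Fin N))) (lam mu : ℝ) (u v : EuclideanSpace ℝ (Fin N) → ℝ)
    (g k : Fin N → EuclideanSpace ℝ (Fin N) → ℝ) (H K : Fin N → Fin N → EuclideanSpace ℝ (Fin N) → ℝ) (E C : ℝ) : Prop where
  ho : IsOpen Ω
  nu : Nice Ω u g H
  nv : Nice Ω v k K
  eu : ∀ x ∈ Ω, lap u x = -(mu * exp (v x))
  ev : ∀ x ∈ Ω, lap v x = -(lam * exp (u x))
  l0 : 0 ≤ lam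
  l1 : lam ≤ E
  m0 : 0 ≤ mu
  m1 : mu ≤ E
  bu : ∀ x ∈ closure Ω, u x ≤ C
  bv : ∀ x ∈ closure Ω, v x ≤ C

namespace Sol
variable {Ω : Set (EuclideanSpace ℝ (Fin N))} {lam mu lam' mu' E C : ℝ} {u v u' v' : EuclideanSpace ℝ (Fin N) → ℝ}
  {g k g' k' : Fin N → EuclideanSpace ℝ (Fin N) → ℝ} {H K H' K' : Fin N → Fin N → EuclideanSpace ℝ (Fin N) → ℝ}

lemma symm (s : Sol Ω lam mu u v g k H K E C) : Sol Ω mu lam v u k g K H E C :=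
  ⟨s.ho, s.nv, s.nu, s.ev, s.eu, s.m0, s.m1, s.l0, s.l1, s.bv, s.bu⟩

lemma F_le (s : Sol Ω lam mu u v g k H K E C) {x} (hx : x ∈ closure Ω) : |mu * exp (v x)| ≤ E * exp C := by
  rw [abs_of_nonneg (mul_nonneg s.m0 (exp_pos _).le)]
  exact mul_le_mul s.m1 (exp_le_exp.2 (s.bv x hx)) (exp_pos _).le (s.m0.trans s.m1)

lemma lev (s : Sol Ω lam mu u v g k H K E C) {x} (hx : x ∈ Ω) : lap u =ᶠ[𝓝 x] fun y => -(mu * exp (v y)) := by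
  filter_upwards [s.ho.mem_nhds hx] with y hy using s.eu y hy

lemma d1 (s : Sol Ω lam mu u v g k H K E C) {x} (hx : x ∈ Ω) (i : Fin N) :
    pd i (lap u) x = -(mu * exp (v x) * k i x) := by
  have hv := (s.nv.sm2 x hx).diff2
  rw [pd_congr (s.lev hx), pd_neg, pd_const_mul mu hv.exp, pd_comp (Real.hasDerivAt_exp _) hv, s.nv.gi i x hx]
  ring

lemma d2 (s : Sol Ω lam mu u v g k H K E C) {x} (hx : x ∈ Ω) (i j : Fin N) :
    pd j (pd i (lap u)) x = -(mu * exp (v x) * (k i x * k j x + K i j x)) := by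
  have hv := (s.nv.sm2 x hx).diff2
  have e : pd i (lap u) =ᶠ[𝓝 x] fun y => -(mu * (exp (v y) * k i y)) := by
    filter_upwards [s.ho.mem_nhds hx] with y hy
    rw [s.d1 hy i]; ring
  have hk : DifferentiableAt ℝ (k i) x := (s.nv.gsm2 s.ho i hx).differentiableAt (by norm_num)
  rw [pd_congr e, pd_neg, pd_const_mul mu (hv.exp.fun_mul hk), pd_mul hv.exp hk, pd_comp (Real.hasDerivAt_exp _) hv,
    ← s.nv.gi j x hx, s.nv.pdg s.ho i j hx]
  ring

lemma lsm (s : Sol Ω lam mu u v g k H K E C) {x} (hx : x ∈ Ω) : ContDiffAt ℝ 2 (lap u) x :=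
  ((contDiffAt_const.mul (s.nv.sm2 x hx).exp).neg).congr_of_eventuallyEq (s.lev hx)

lemma q0 (s : Sol Ω lam mu u v g k H K E C) (s' : Sol Ω lam' mu' u' v' g' k' H' K' E C) {x} (hx : x ∈ Ω) :
    lap (fun y => u y - u' y) x = lap u x - lap u' x := lap_sub (s.nu.sm2 x hx) (s'.nu.sm2 x hx)

lemma q1 (s : Sol Ω lam mu u v g k H K E C) (s' : Sol Ω lam' mu' u' v' g' k' H' K' E C) {x} (hx : x ∈ Ω) (i : Fin N) :
    pd i (lap (fun y => u y - u' y)) x = pd i (lap u) x - pd i (lap u') x := by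
  have e : lap (fun y => u y - u' y) =ᶠ[𝓝 x] fun y => lap u y - lap u' y := by
    filter_upwards [s.ho.mem_nhds hx] with y hy using s.q0 s' hy
  rw [pd_congr e, pd_sub (s.lsm hx).diff2 (s'.lsm hx).diff2]

lemma q2 (s : Sol Ω lam mu u v g k H K E C) (s' : Sol Ω lam' mu' u' v' g' k' H' K' E C) {x} (hx : x ∈ Ω) (i j : Fin N) :
    pd j (pd i (lap (fun y => u y - u' y))) x = pd j (pd i (lap u)) x - pd j (pd i (lap u')) x := by
  have e : pd i (lap (fun y => u y - u' y)) =ᶠ[𝓝 x] fun y => pd i (lap u) y - pd i (lap u') y := by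
    filter_upwards [s.ho.mem_nhds hx] with y hy using s.q1 s' hy i
  rw [pd_congr e, pd_sub (s.lsm hx).pd_diff (s'.lsm hx).pd_diff]

end Sol

lemma exp_lip {a b C : ℝ} (ha : a ≤ C) (hb : b ≤ C) : |exp a - exp b| ≤ exp C * |a - b| := by
  wlog h : b ≤ a generalizing a b
  · rw [abs_sub_comm, abs_sub_comm a b]; exact this hb ha (not_le.1 h).le
  rw [abs_of_nonneg (sub_nonneg.2 (exp_le_exp.2 h)), abs_of_nonneg (sub_nonneg.2 h)]
  have h1 : exp a - exp b = exp a * (1 - exp (b - a)) := by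
    rw [mul_sub, mul_one, ← exp_add]; congr 2; ring
  rw [h1]
  have h2 := add_one_le_exp (b - a)
  have h3 : exp (b - a) ≤ 1 := exp_le_one_iff.2 (by linarith)
  exact mul_le_mul (exp_le_exp.2 ha) (by linarith) (by linarith) (exp_pos _).le

lemma F_diff {mu mu' a b E C δ : ℝ} (ha : a ≤ C) (hb : b ≤ C) (hm' : |mu'| ≤ E) (hm : |mu - mu'| ≤ δ) (hab : |a - b| ≤ δ) :
    |mu * exp a - mu' * exp b| ≤ (1 + E) * exp C * δ := by
  have e : mu * exp a - mu' * exp b = (mu - mu') * exp a + mu' * (exp a - exp b) := by ring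
  rw [e]
  have h1 : |(mu - mu') * exp a| ≤ δ * exp C := Ref.abs_mul_le' hm (by rw [abs_of_pos (exp_pos _)]; exact exp_le_exp.2 ha)
  have h2 : |mu' * (exp a - exp b)| ≤ E * (exp C * δ) :=
    Ref.abs_mul_le' hm' ((exp_lip ha hb).trans (mul_le_mul_of_nonneg_left hab (exp_pos _).le))
  refine (abs_add_le _ _).trans ((add_le_add h1 h2).trans (le_of_eq ?_))
  ring

lemma prod_diff {F F' a a' e f c d : ℝ} (h1 : |F - F'| ≤ e) (h2 : |F'| ≤ f) (h3 : |a| ≤ c) (h4 : |a - a'| ≤ d) :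
    |F * a - F' * a'| ≤ e * c + f * d := by
  have e : F * a - F' * a' = (F - F') * a + F' * (a - a') := by ring
  rw [e]
  exact (abs_add_le _ _).trans (add_le_add (Ref.abs_mul_le' h1 h3) (Ref.abs_mul_le' h2 h4))

lemma abs_neg_sub_neg (a b : ℝ) : |-a - -b| = |a - b| := by
  rw [← abs_neg]; congr 1; ring

namespace Ref
variable {Ω : Set (EuclideanSpace ℝ (Fin N))} {U : EuclideanSpace ℝ (Fin N) → ℝ}
  {G : Fin N → EuclideanSpace ℝ (Fin N) → ℝ} {Hh : Fin N → Fin N → EuclideanSpace ℝ (Fin N) → ℝ} {m L : ℝ}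

lemma sol_bound (r : Ref Ω U G Hh m L) (E C0 : ℝ) (hE : 0 ≤ E) : ∃ C : ℝ, 0 ≤ C ∧ ∀ lam mu u v g k H K,
    Sol Ω lam mu u v g k H K E C0 → (∀ x ∈ closure Ω, (∀ i, |g i x| ≤ C ∧ |k i x| ≤ C) ∧
      ∀ i j, |H i j x| ≤ C ∧ |K i j x| ≤ C) := by
  set M := E * exp C0 with hM
  have hM0 : 0 ≤ M := by positivity
  obtain ⟨C1, hC1, h1⟩ := r.sysG hM0
  have hM2 : 0 ≤ M * (1 + C1 + C1 * C1) := by positivity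
  obtain ⟨C2, hC2, h2⟩ := r.sysK hM2
  refine ⟨C1 + C2, by positivity, ?_⟩
  have A0 : ∀ lam mu u v g k H K, Sol Ω lam mu u v g k H K E C0 → ∀ x ∈ Ω, |lap u x| ≤ M := by
    intro lam mu u v g k H K s x hx
    rw [s.eu x hx, abs_neg]; exact s.F_le (subset_closure hx)
  have A1 : ∀ lam mu u v g k H K, Sol Ω lam mu u v g k H K E C0 → ∀ i, ∀ x ∈ Ω, |pd i (lap u) x| ≤ M * |k i x| := by
    intro lam mu u v g k H K s i x hx
    rw [s.d1 hx, abs_neg]; exact abs_mul_le' (s.F_le (subset_closure hx)) le_rfl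
  have hG : ∀ lam mu u v g k H K, Sol Ω lam mu u v g k H K E C0 → ∀ j, ∀ x ∈ closure Ω, |g j x| ≤ C1 ∧ |k j x| ≤ C1 := by
    intro lam mu u v g k H K s
    have := h1 u v g k H K 1 s.nu s.nv zero_le_one (fun x hx => by rw [mul_one]; exact A0 _ _ _ _ _ _ _ _ s x hx)
      (fun x hx => by rw [mul_one]; exact A0 _ _ _ _ _ _ _ _ s.symm x hx)
      (fun i x hx => (A1 _ _ _ _ _ _ _ _ s i x hx).trans (mul_le_mul_of_nonneg_left (by linarith) hM0))
      (fun i x hx => (A1 _ _ _ _ _ _ _ _ s.symm i x hx).trans (mul_le_mul_of_nonneg_left (by linarith) hM0))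
    simpa using this
  have B1 : ∀ lam mu u v g k H K, Sol Ω lam mu u v g k H K E C0 → ∀ i, ∀ x ∈ Ω, |pd i (lap u) x| ≤ M * (1 + C1 + C1 * C1) * 1 := by
    intro lam mu u v g k H K s i x hx
    refine (A1 _ _ _ _ _ _ _ _ s i x hx).trans ?_
    rw [mul_one]
    refine mul_le_mul_of_nonneg_left ?_ hM0
    have := (hG _ _ _ _ _ _ _ _ s i x (subset_closure hx)).2
    nlinarith
  have B0 : ∀ lam mu u v g k H K, Sol Ω lam mu u v g k H K E C0 → ∀ x ∈ Ω, |lap u x| ≤ M * (1 + C1 + C1 * C1) * 1 := by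
    intro lam mu u v g k H K s x hx
    refine (A0 _ _ _ _ _ _ _ _ s x hx).trans ?_
    rw [mul_one]
    refine le_mul_of_one_le_right hM0 ?_
    nlinarith
  have B2 : ∀ lam mu u v g k H K, Sol Ω lam mu u v g k H K E C0 → ∀ i j, ∀ x ∈ Ω,
      |pd j (pd i (lap u)) x| ≤ M * (1 + C1 + C1 * C1) * (1 + |K i j x|) := by
    intro lam mu u v g k H K s i j x hx
    rw [s.d2 hx, abs_neg]
    have a := fun i => (hG _ _ _ _ _ _ _ _ s i x (subset_closure hx)).2
    have := abs_mul_le' (s.F_le (subset_closure hx)) ((abs_add_le (k i x * k j x) (K i j x)).trans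
      (add_le_add_left (abs_mul_le' (a i) (a j)) _))
    refine this.trans ?_
    rw [mul_assoc M, ← hM]
    refine mul_le_mul_of_nonneg_left ?_ hM0
    nlinarith [abs_nonneg (K i j x), mul_nonneg hC1 hC1, mul_nonneg hC1 (abs_nonneg (K i j x)),
      mul_nonneg (mul_nonneg hC1 hC1) (abs_nonneg (K i j x))]
  intro lam mu u v g k H K s x hx
  refine ⟨fun i => ?_, fun i j => ?_⟩
  · have := hG _ _ _ _ _ _ _ _ s i x hx
    constructor <;> linarith [this.1, this.2]
  · have := h2 u v g k H K 1 s.nu s.nv zero_le_one (B0 _ _ _ _ _ _ _ _ s) (B0 _ _ _ _ _ _ _ _ s.symm)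
      (B1 _ _ _ _ _ _ _ _ s) (B1 _ _ _ _ _ _ _ _ s.symm) (B2 _ _ _ _ _ _ _ _ s) (B2 _ _ _ _ _ _ _ _ s.symm) i j x hx
    rw [mul_one] at this
    constructor <;> linarith [this.1, this.2]

end Ref
end LP6

section LP7
open Filter Topology
variable {N : ℕ}

/-- Closeness of parameters and of the functions. -/
structure Close (Ω : Set (EuclideanSpace ℝ (Fin N))) (lam mu lam' mu' : ℝ) (u v u' v' : EuclideanSpace ℝ (Fin N) → ℝ)
    (δ : ℝ) : Prop where
  d0 : 0 ≤ δ
  cl : |lam - lam'| ≤ δ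
  cm : |mu - mu'| ≤ δ
  cu : ∀ x ∈ closure Ω, |u x - u' x| ≤ δ
  cv : ∀ x ∈ closure Ω, |v x - v' x| ≤ δ

lemma Close.symm {Ω : Set (EuclideanSpace ℝ (Fin N))} {lam mu lam' mu' : ℝ} {u v u' v' : EuclideanSpace ℝ (Fin N) → ℝ}
    {δ : ℝ} (c : Close Ω lam mu lam' mu' u v u' v' δ) : Close Ω mu lam mu' lam' v u v' u' δ :=
  ⟨c.d0, c.cm, c.cl, c.cv, c.cu⟩

namespace Ref
variable {Ω : Set (EuclideanSpace ℝ (Fin N))} {U : EuclideanSpace ℝ (Fin N) → ℝ}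
  {G : Fin N → EuclideanSpace ℝ (Fin N) → ℝ} {Hh : Fin N → Fin N → EuclideanSpace ℝ (Fin N) → ℝ} {m L : ℝ}

lemma sol_diff (r : Ref Ω U G Hh m L) (E C0 : ℝ) (hE : 0 ≤ E) : ∃ C : ℝ, 0 ≤ C ∧
    ∀ lam mu lam' mu' u v u' v' g k g' k' H K H' K' δ,
    Sol Ω lam mu u v g k H K E C0 → Sol Ω lam' mu' u' v' g' k' H' K' E C0 →
    Close Ω lam mu lam' mu' u v u' v' δ →
    (∀ x ∈ closure Ω, (∀ i, |g i x - g' i x| ≤ C * δ) ∧ ∀ i j, |H i j x - H' i j x| ≤ C * δ) ∧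
    (∀ x ∈ Ω, |lap (fun y => u y - u' y) x| ≤ C * δ) ∧
    ∀ i, ∀ x ∈ Ω, |pd i (lap (fun y => u y - u' y)) x| ≤ C * δ := by
  obtain ⟨C, hC, hb⟩ := r.sol_bound E C0 hE
  set e := (1 + E) * exp C0 with he
  have he0 : 0 ≤ e := by positivity
  have hfe : E * exp C0 ≤ e := by rw [he]; nlinarith [exp_pos C0]
  obtain ⟨C1, hC1, h1⟩ := r.sysG (M := e * (1 + C)) (by positivity)
  set M := e * (1 + C + C * C + 2 * C * C1 + C1) with hM
  have hM0 : 0 ≤ M := by positivity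
  obtain ⟨C2, hC2, h2⟩ := r.sysK hM0
  have A0 : ∀ lam mu lam' mu' u v u' v' g k g' k' H K H' K' δ, Sol Ω lam mu u v g k H K E C0 →
      Sol Ω lam' mu' u' v' g' k' H' K' E C0 → Close Ω lam mu lam' mu' u v u' v' δ → ∀ x ∈ closure Ω,
      |mu * exp (v x) - mu' * exp (v' x)| ≤ e * δ := by
    intro lam mu lam' mu' u v u' v' g k g' k' H K H' K' δ s s' c x hx
    exact F_diff (s.bv x hx) (s'.bv x hx) (by rw [abs_of_nonneg s'.m0]; exact s'.m1) c.cm (c.cv x hx)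
  have A1 : ∀ lam mu lam' mu' u v u' v' g k g' k' H K H' K' δ, Sol Ω lam mu u v g k H K E C0 →
      Sol Ω lam' mu' u' v' g' k' H' K' E C0 → Close Ω lam mu lam' mu' u v u' v' δ → ∀ x ∈ Ω,
      |lap (fun y => u y - u' y) x| ≤ e * δ := by
    intro lam mu lam' mu' u v u' v' g k g' k' H K H' K' δ s s' c x hx
    rw [s.q0 s' hx, s.eu x hx, s'.eu x hx, abs_neg_sub_neg]
    exact A0 _ _ _ _ _ _ _ _ _ _ _ _ _ _ _ _ _ s s' c x (subset_closure hx)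
  have A2 : ∀ lam mu lam' mu' u v u' v' g k g' k' H K H' K' δ, Sol Ω lam mu u v g k H K E C0 →
      Sol Ω lam' mu' u' v' g' k' H' K' E C0 → Close Ω lam mu lam' mu' u v u' v' δ → ∀ i, ∀ x ∈ Ω,
      |pd i (lap (fun y => u y - u' y)) x| ≤ e * (C * δ + |k i x - k' i x|) := by
    intro lam mu lam' mu' u v u' v' g k g' k' H K H' K' δ s s' c i x hx
    have hx' := subset_closure hx
    rw [s.q1 s' hx, s.d1 hx, s'.d1 hx, abs_neg_sub_neg]
    refine (prod_diff (A0 _ _ _ _ _ _ _ _ _ _ _ _ _ _ _ _ _ s s' c x hx') ((s'.F_le hx').trans hfe)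
      ((hb _ _ _ _ _ _ _ _ s x hx').1 i).2 le_rfl).trans (le_of_eq (by ring))
  have hG : ∀ lam mu lam' mu' u v u' v' g k g' k' H K H' K' δ, Sol Ω lam mu u v g k H K E C0 →
      Sol Ω lam' mu' u' v' g' k' H' K' E C0 → Close Ω lam mu lam' mu' u v u' v' δ → ∀ i, ∀ x ∈ closure Ω,
      |g i x - g' i x| ≤ C1 * δ ∧ |k i x - k' i x| ≤ C1 * δ := by
    intro lam mu lam' mu' u v u' v' g k g' k' H K H' K' δ s s' c
    have hd := c.d0
    have e1 : e * δ ≤ e * (1 + C) * δ := by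
      have : 0 ≤ e * C * δ := by positivity
      linarith
    have e2 : ∀ a : ℝ, e * (C * δ + |a|) ≤ e * (1 + C) * (δ + |a|) := by
      intro a
      have : 0 ≤ e * δ := by positivity
      have : 0 ≤ e * C * |a| := by positivity
      linarith
    refine h1 _ _ _ _ _ _ δ (s.nu.sub s'.nu) (s.nv.sub s'.nv) hd
      (fun x hx => (A1 _ _ _ _ _ _ _ _ _ _ _ _ _ _ _ _ _ s s' c x hx).trans e1)
      (fun x hx => (A1 _ _ _ _ _ _ _ _ _ _ _ _ _ _ _ _ _ s.symm s'.symm c.symm x hx).trans e1)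
      (fun i x hx => (A2 _ _ _ _ _ _ _ _ _ _ _ _ _ _ _ _ _ s s' c i x hx).trans (e2 _))
      (fun i x hx => (A2 _ _ _ _ _ _ _ _ _ _ _ _ _ _ _ _ _ s.symm s'.symm c.symm i x hx).trans (e2 _))
  have B1 : ∀ lam mu lam' mu' u v u' v' g k g' k' H K H' K' δ, Sol Ω lam mu u v g k H K E C0 →
      Sol Ω lam' mu' u' v' g' k' H' K' E C0 → Close Ω lam mu lam' mu' u v u' v' δ → ∀ x ∈ Ω,
      |lap (fun y => u y - u' y) x| ≤ M * δ := by
    intro lam mu lam' mu' u v u' v' g k g' k' H K H' K' δ s s' c x hx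
    refine (A1 _ _ _ _ _ _ _ _ _ _ _ _ _ _ _ _ _ s s' c x hx).trans (mul_le_mul_of_nonneg_right ?_ c.d0)
    refine le_mul_of_one_le_right he0 ?_
    have : 0 ≤ C + C * C + 2 * C * C1 + C1 := by positivity
    linarith
  have B2 : ∀ lam mu lam' mu' u v u' v' g k g' k' H K H' K' δ, Sol Ω lam mu u v g k H K E C0 →
      Sol Ω lam' mu' u' v' g' k' H' K' E C0 → Close Ω lam mu lam' mu' u v u' v' δ → ∀ i, ∀ x ∈ Ω,
      |pd i (lap (fun y => u y - u' y)) x| ≤ M * δ := by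
    intro lam mu lam' mu' u v u' v' g k g' k' H K H' K' δ s s' c i x hx
    refine (A2 _ _ _ _ _ _ _ _ _ _ _ _ _ _ _ _ _ s s' c i x hx).trans ?_
    have := (hG _ _ _ _ _ _ _ _ _ _ _ _ _ _ _ _ _ s s' c i x (subset_closure hx)).2
    rw [hM, mul_assoc e]
    refine mul_le_mul_of_nonneg_left ?_ he0
    have hd := c.d0
    have : 0 ≤ (1 + C * C + 2 * C * C1) * δ := by positivity
    linarith
  have B3 : ∀ lam mu lam' mu' u v u' v' g k g' k' H K H' K' δ, Sol Ω lam mu u v g k H K E C0 →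
      Sol Ω lam' mu' u' v' g' k' H' K' E C0 → Close Ω lam mu lam' mu' u v u' v' δ → ∀ i j, ∀ x ∈ Ω,
      |pd j (pd i (lap (fun y => u y - u' y))) x| ≤ M * (δ + |K i j x - K' i j x|) := by
    intro lam mu lam' mu' u v u' v' g k g' k' H K H' K' δ s s' c i j x hx
    have hx' := subset_closure hx
    have a := fun i => ((hb _ _ _ _ _ _ _ _ s x hx').1 i).2
    have a' := fun i => ((hb _ _ _ _ _ _ _ _ s' x hx').1 i).2
    have aK := ((hb _ _ _ _ _ _ _ _ s x hx').2 i j).2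
    have dk := fun i => (hG _ _ _ _ _ _ _ _ _ _ _ _ _ _ _ _ _ s s' c i x hx').2
    rw [s.q2 s' hx, s.d2 hx, s'.d2 hx, abs_neg_sub_neg]
    have p1 := prod_diff (dk i) (a' i) (a j) (dk j)
    have p2 : |(k i x * k j x + K i j x) - (k' i x * k' j x + K' i j x)| ≤ C1 * δ * C + C * (C1 * δ) + |K i j x - K' i j x| := by
      rw [show (k i x * k j x + K i j x) - (k' i x * k' j x + K' i j x) = (k i x * k j x - k' i x * k' j x) + (K i j x - K' i j x) by ring]
      exact (abs_add_le _ _).trans (add_le_add_left p1 _)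
    have p3 : |k i x * k j x + K i j x| ≤ C * C + C :=
      (abs_add_le _ _).trans (add_le_add (abs_mul_le' (a i) (a j)) aK)
    refine (prod_diff (A0 _ _ _ _ _ _ _ _ _ _ _ _ _ _ _ _ _ s s' c x hx') ((s'.F_le hx').trans hfe) p3 p2).trans ?_
    rw [show e * δ * (C * C + C) + e * (C1 * δ * C + C * (C1 * δ) + |K i j x - K' i j x|) =
      e * (δ * (C * C + C) + 2 * C * C1 * δ + |K i j x - K' i j x|) by ring, hM, mul_assoc e]
    refine mul_le_mul_of_nonneg_left ?_ he0
    have hd := c.d0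
    have : 0 ≤ (1 + C1) * δ := by positivity
    have : 0 ≤ (C + C * C + 2 * C * C1 + C1) * |K i j x - K' i j x| := by positivity
    linarith
  refine ⟨C1 + C2 + M, by positivity, ?_⟩
  intro lam mu lam' mu' u v u' v' g k g' k' H K H' K' δ s s' c
  have hd := c.d0
  have q1 := mul_nonneg hC1 hd
  have q2 := mul_nonneg hC2 hd
  have q3 := mul_nonneg hM0 hd
  refine ⟨fun x hx => ⟨fun i => ?_, fun i j => ?_⟩, fun x hx => ?_, fun i x hx => ?_⟩
  · linarith [(hG _ _ _ _ _ _ _ _ _ _ _ _ _ _ _ _ _ s s' c i x hx).1]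
  · have := (h2 _ _ _ _ _ _ δ (s.nu.sub s'.nu) (s.nv.sub s'.nv) hd
      (B1 _ _ _ _ _ _ _ _ _ _ _ _ _ _ _ _ _ s s' c) (B1 _ _ _ _ _ _ _ _ _ _ _ _ _ _ _ _ _ s.symm s'.symm c.symm)
      (B2 _ _ _ _ _ _ _ _ _ _ _ _ _ _ _ _ _ s s' c) (B2 _ _ _ _ _ _ _ _ _ _ _ _ _ _ _ _ _ s.symm s'.symm c.symm)
      (B3 _ _ _ _ _ _ _ _ _ _ _ _ _ _ _ _ _ s s' c) (B3 _ _ _ _ _ _ _ _ _ _ _ _ _ _ _ _ _ s.symm s'.symm c.symm) i j x hx).1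
    linarith
  · linarith [B1 _ _ _ _ _ _ _ _ _ _ _ _ _ _ _ _ _ s s' c x hx]
  · linarith [B2 _ _ _ _ _ _ _ _ _ _ _ _ _ _ _ _ _ s s' c i x hx]

end Ref
end LP7

section LP8
open Filter Topology
variable {N : ℕ}

lemma mkL_norm_le {a : Fin N → ℝ} {A : ℝ} (h : ∀ i, |a i| ≤ A) (y : EuclideanSpace ℝ (Fin N)) :
    |mkL a y| ≤ N * (A * ‖y‖) := by
  rw [mkL_apply]
  exact abs_sum_le_card fun i => Ref.abs_mul_le' (h i) (abs_coord_le y i)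

lemma mkL_opNorm_le {a : Fin N → ℝ} {A : ℝ} (hA : 0 ≤ A) (h : ∀ i, |a i| ≤ A) : ‖mkL a‖ ≤ N * A :=
  ContinuousLinearMap.opNorm_le_bound _ (by positivity) fun y => by
    rw [norm_eq_abs, mul_assoc]; exact mkL_norm_le h y

lemma seg_bound {S : Set (EuclideanSpace ℝ (Fin N))} {f : EuclideanSpace ℝ (Fin N) → ℝ} {a : Fin N → EuclideanSpace ℝ (Fin N) → ℝ}
    {T : Set (EuclideanSpace ℝ (Fin N))} {A : ℝ} (hA : 0 ≤ A) (hT : Convex ℝ T) (hTS : T ⊆ S)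
    (hf : ∀ z ∈ S, HasFDerivWithinAt f (mkL fun i => a i z) S z) (ha : ∀ z ∈ T, ∀ i, |a i z| ≤ A)
    {x y : EuclideanSpace ℝ (Fin N)} (hx : x ∈ T) (hy : y ∈ T) : |f y - f x| ≤ N * A * ‖y - x‖ := by
  rw [← norm_eq_abs]
  exact hT.norm_image_sub_le_of_norm_hasFDerivWithin_le (fun z hz => (hf z (hTS hz)).mono hTS)
    (fun z hz => mkL_opNorm_le hA (ha z hz)) hx hy

lemma loc_closure_le {Ω : Set (EuclideanSpace ℝ (Fin N))} {f k : EuclideanSpace ℝ (Fin N) → ℝ} {p : EuclideanSpace ℝ (Fin N)} {ρ : ℝ}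
    (hf : ContinuousOn f (closure Ω)) (hk : ContinuousOn k (closure Ω)) (e : ∀ x ∈ Ω, dist x p < ρ → f x ≤ k x) :
    ∀ x ∈ closure Ω, dist x p < ρ → f x ≤ k x := by
  intro x hx hd
  have : (𝓝[Ω] x).NeBot := mem_closure_iff_nhdsWithin_neBot.1 hx
  refine le_of_tendsto_of_tendsto ((hf x hx).mono subset_closure) ((hk x hx).mono subset_closure) ?_
  filter_upwards [self_mem_nhdsWithin, mem_nhdsWithin_of_mem_nhds (Metric.isOpen_ball.mem_nhds hd)] with y hy hy' using e y hy hy'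

lemma loc_lip {Ω : Set (EuclideanSpace ℝ (Fin N))} {f : EuclideanSpace ℝ (Fin N) → ℝ} {p : EuclideanSpace ℝ (Fin N)} {ρ B : ℝ}
    (hf : ContinuousOn f (closure Ω)) (e : ∀ x ∈ Ω, dist x p < ρ → ∀ y ∈ Ω, dist y p < ρ → |f x - f y| ≤ B * ‖x - y‖) :
    ∀ x ∈ closure Ω, dist x p < ρ → ∀ y ∈ closure Ω, dist y p < ρ → |f x - f y| ≤ B * ‖x - y‖ := by
  intro x hx hxp y hy hyp
  refine loc_closure_le (f := fun x => |f x - f y|) (k := fun x => B * ‖x - y‖) (hf.sub continuousOn_const).abs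
    (by fun_prop) (fun x hx hxp => ?_) x hx hxp
  exact loc_closure_le (f := fun y => |f x - f y|) (k := fun y => B * ‖x - y‖) (continuousOn_const.sub hf).abs
    (by fun_prop) (fun y hy hyp => e x hx hxp y hy hyp) y hy hyp

namespace Ref
variable {Ω : Set (EuclideanSpace ℝ (Fin N))} {U : EuclideanSpace ℝ (Fin N) → ℝ}
  {G : Fin N → EuclideanSpace ℝ (Fin N) → ℝ} {Hh : Fin N → Fin N → EuclideanSpace ℝ (Fin N) → ℝ} {m L : ℝ}

lemma no_exit (r : Ref Ω U G Hh m L) {p x e : EuclideanSpace ℝ (Fin N)} {ρ : ℝ} (hx : x ∈ Ω)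
    (hm : ∀ z ∈ Ω, dist z p < ρ → 0 ≤ mkL (fun i => G i z) e)
    (hρ : ∀ t ∈ Set.Icc (0:ℝ) 1, dist (x + t • e) p < ρ) : ∀ t ∈ Set.Icc (0:ℝ) 1, x + t • e ∈ Ω := by
  by_contra hcon
  push Not at hcon
  set T := {t | t ∈ Set.Icc (0:ℝ) 1 ∧ x + t • e ∉ Ω} with hT
  have hTe : T.Nonempty := hcon
  have hcont : Continuous fun t : ℝ => x + t • e := by fun_prop
  have hTc : IsClosed T := isClosed_Icc.inter (r.ho.isClosed_compl.preimage hcont)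
  have hbb : BddBelow T := ⟨0, fun t ht => ht.1.1⟩
  set t0 := sInf T with ht0
  have h0 : t0 ∈ T := hTc.csInf_mem hTe hbb
  have hin : ∀ t ∈ Set.Ico 0 t0, x + t • e ∈ Ω := by
    intro t ht
    by_contra h
    exact absurd (csInf_le hbb ⟨⟨ht.1, ht.2.le.trans h0.1.2⟩, h⟩) (not_le.2 ht.2)
  have ht0pos : 0 < t0 := by
    rcases h0.1.1.lt_or_eq with h | h
    · exact h
    · exact absurd (by rw [← h]; simpa using hx) h0.2
  have hcl : ∀ t ∈ Set.Icc 0 t0, x + t • e ∈ closure Ω := by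
    have : Set.Icc 0 t0 ⊆ closure (Set.Ico 0 t0) := by rw [closure_Ico ht0pos.ne]
    intro t ht
    exact map_mem_closure (f := fun t : ℝ => x + t • e) hcont (this ht) hin
  have hfr : U (x + t0 • e) = 0 := by
    rcases r.mem_or (hcl t0 ⟨ht0pos.le, le_rfl⟩) with h | h
    · exact absurd h h0.2
    · exact r.nu.b0 _ h
  have hline : ∀ t : ℝ, HasDerivAt (fun t : ℝ => x + t • e) e t := fun t => by
    simpa using ((hasDerivAt_id t).smul_const e).const_add x
  have hder : ∀ t ∈ Set.Ioo 0 t0, HasDerivAt (fun t : ℝ => U (x + t • e)) (mkL (fun i => G i (x + t • e)) e) t := by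
    intro t ht
    have hz := hin t ⟨ht.1.le, ht.2⟩
    have := ((r.nu.dh _ (subset_closure hz)).hasFDerivAt (mem_of_superset (r.ho.mem_nhds hz) subset_closure))
    exact this.comp_hasDerivAt t (hline t)
  have hmono : MonotoneOn (fun t : ℝ => U (x + t • e)) (Set.Icc 0 t0) := by
    refine monotoneOn_of_deriv_nonneg (convex_Icc _ _) (r.nu.ch.comp hcont.continuousOn hcl) ?_ ?_
    · rw [interior_Icc]; intro t ht
      exact (hder t ht).differentiableAt.differentiableWithinAt
    · rw [interior_Icc]; intro t ht
      rw [(hder t ht).deriv]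
      exact hm _ (hin t ⟨ht.1.le, ht.2⟩) (hρ t ⟨ht.1.le, ht.2.le.trans h0.1.2⟩)
  have := hmono ⟨le_rfl, ht0pos.le⟩ ⟨ht0pos.le, le_rfl⟩ ht0pos.le
  simp only [zero_smul, add_zero, hfr] at this
  linarith [r.U_pos x hx]

/-- Local Lipschitz estimate near a boundary point with nonzero gradient. -/
lemma lip_reg (r : Ref Ω U G Hh m L) {p : EuclideanSpace ℝ (Fin N)} (hp : p ∈ closure Ω) (i0 : Fin N) (hi0 : G i0 p ≠ 0) :
    ∃ ρ : ℝ, 0 < ρ ∧ ∀ (f : EuclideanSpace ℝ (Fin N) → ℝ) (a : Fin N → EuclideanSpace ℝ (Fin N) → ℝ) (A : ℝ), 0 ≤ A →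
      (∀ z ∈ closure Ω, HasFDerivWithinAt f (mkL fun i => a i z) (closure Ω) z) → (∀ z ∈ closure Ω, ∀ i, |a i z| ≤ A) →
      ∀ x ∈ closure Ω, dist x p < ρ → ∀ y ∈ closure Ω, dist y p < ρ → |f x - f y| ≤ 10 * N * A * ‖x - y‖ := by
  have hNR : (0:ℝ) < N := by exact_mod_cast r.hN
  set w : EuclideanSpace ℝ (Fin N) := WithLp.toLp 2 (fun i => G i p) with hw
  have hwi : ∀ i, w i = G i p := fun i => rfl
  have hwpos : 0 < ‖w‖ := by
    refine norm_pos_iff.2 fun h => hi0 ?_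
    rw [← hwi, h]; rfl
  have hinner : ∀ y, mkL (fun i => G i p) y = inner ℝ w y := by
    intro y; rw [mkL_apply, PiLp.inner_apply]
    refine Finset.sum_congr rfl fun i _ => ?_
    rw [hwi]; simp [mul_comm]
  set ε := ‖w‖ / (2 * N) with hε
  have hε0 : 0 < ε := by positivity
  have hev : ∀ᶠ z in 𝓝[closure Ω] p, ∀ i, |G i z - G i p| ≤ ε := by
    rw [eventually_all]; intro i
    have := Metric.tendsto_nhds.1 (r.nu.cg i p hp) ε hε0
    filter_upwards [this] with z hz
    rw [Real.dist_eq] at hz; exact hz.le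
  obtain ⟨ρ0, hρ0, hball⟩ := Metric.mem_nhdsWithin_iff.1 hev
  have hdiff : ∀ z ∈ Ω, dist z p < ρ0 → ∀ y, |mkL (fun i => G i z) y - inner ℝ w y| ≤ ‖w‖ / 2 * ‖y‖ := by
    intro z hz hzp y
    have h1 : ∀ i, |G i z - G i p| ≤ ε := hball ⟨hzp, subset_closure hz⟩
    have h2 := mkL_norm_le (a := fun i => G i z - G i p) h1 y
    have e1 : mkL (fun i => G i z - G i p) y = mkL (fun i => G i z) y - inner ℝ w y := by
      rw [← hinner, mkL_apply, mkL_apply, mkL_apply, ← Finset.sum_sub_distrib]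
      exact Finset.sum_congr rfl fun i _ => by ring
    rw [e1] at h2
    refine h2.trans (le_of_eq ?_)
    rw [hε]; field_simp
  refine ⟨ρ0 / 12, by positivity, ?_⟩
  intro f a A hA hf ha
  refine loc_lip (fun z hz => (hf z hz).continuousWithinAt) ?_
  intro x hx hxp y hy hyp
  set κ := 4 * ‖x - y‖ / ‖w‖ with hκ
  have hκ0 : 0 ≤ κ := by positivity
  have hκw : ‖κ • w‖ = 4 * ‖x - y‖ := by
    rw [norm_smul, norm_eq_abs, abs_of_nonneg hκ0, hκ]; field_simp
  have hxy : ‖x - y‖ < ρ0 / 6 := by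
    rw [← dist_eq_norm]
    have := dist_triangle_right x y p
    linarith
  have main : ∀ z ∈ Ω, dist z p < ρ0 / 12 → ∀ e : EuclideanSpace ℝ (Fin N), ‖e - κ • w‖ ≤ ‖x - y‖ →
      |f (z + e) - f z| ≤ N * A * (5 * ‖x - y‖) := by
    intro z hz hzp e he
    have hen : ‖e‖ ≤ 5 * ‖x - y‖ := by
      have := norm_add_le (e - κ • w) (κ • w)
      rw [sub_add_cancel, hκw] at this
      linarith
    have hin := r.no_exit (p := p) (x := z) (e := e) (ρ := ρ0) hz ?_ ?_
    · have hT : segment ℝ z (z + e) ⊆ closure Ω := by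
        rw [segment_eq_image']
        rintro _ ⟨t, ht, rfl⟩
        simp only [add_sub_cancel_left]
        exact subset_closure (hin t ht)
      have := seg_bound hA (convex_segment z (z + e)) hT hf (fun q hq => ha q (hT hq)) (left_mem_segment ℝ z (z + e))
        (right_mem_segment ℝ z (z + e))
      rw [add_sub_cancel_left] at this
      exact this.trans (mul_le_mul_of_nonneg_left hen (by positivity))
    · intro q hq hqp
      have d1 := abs_le.1 (hdiff q hq hqp e)
      have e1 : inner ℝ w e = inner ℝ w (e - κ • w) + κ * ‖w‖ ^ 2 := by
        rw [inner_sub_right, inner_smul_right, real_inner_self_eq_norm_sq]; ring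
      have e2 := abs_le.1 (abs_real_inner_le_norm w (e - κ • w))
      have e3 : κ * ‖w‖ ^ 2 = 4 * ‖x - y‖ * ‖w‖ := by rw [hκ]; field_simp
      have e4 : ‖w‖ * ‖e - κ • w‖ ≤ ‖w‖ * ‖x - y‖ := mul_le_mul_of_nonneg_left he hwpos.le
      have e5 : ‖w‖ / 2 * ‖e‖ ≤ ‖w‖ / 2 * (5 * ‖x - y‖) := mul_le_mul_of_nonneg_left hen (by positivity)
      have e6 : 0 ≤ ‖w‖ * ‖x - y‖ := by positivity
      nlinarith [d1.1, e2.1]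
    · intro t ht
      have : dist (z + t • e) z ≤ ‖e‖ := by
        rw [dist_eq_norm, add_sub_cancel_left, norm_smul, norm_eq_abs, abs_of_nonneg ht.1]
        exact mul_le_of_le_one_left (norm_nonneg _) ht.2
      have := dist_triangle (z + t • e) z p
      linarith
  have m1 := main x hx hxp ((y - x) + κ • w) (by rw [add_sub_cancel_right, norm_sub_rev])
  have m2 := main y hy hyp (κ • w) (by simp)
  rw [show x + ((y - x) + κ • w) = y + κ • w by abel] at m1
  have := abs_le.1 m1
  have := abs_le.1 m2
  rw [abs_le]; constructor <;> linarith

end Ref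
end LP8

section LP9
open Filter Topology
variable {N : ℕ}

lemma hfd_bound {S : Set (EuclideanSpace ℝ (Fin N))} {f : EuclideanSpace ℝ (Fin N) → ℝ} {l : EuclideanSpace ℝ (Fin N) →L[ℝ] ℝ}
    {p : EuclideanSpace ℝ (Fin N)} (h : HasFDerivWithinAt f l S p) :
    ∃ C : ℝ, 0 ≤ C ∧ ∃ ρ : ℝ, 0 < ρ ∧ ∀ x ∈ S, dist x p < ρ → |f x - f p| ≤ C * ‖x - p‖ := by
  obtain ⟨C, hC, hb⟩ := h.isBigO_sub.exists_nonneg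
  obtain ⟨ρ, hρ, hball⟩ := Metric.mem_nhdsWithin_iff.1 hb.bound
  exact ⟨C, hC, ρ, hρ, fun x hx hd => hball ⟨hd, hx⟩⟩

namespace Ref
variable {Ω : Set (EuclideanSpace ℝ (Fin N))} {U : EuclideanSpace ℝ (Fin N) → ℝ}
  {G : Fin N → EuclideanSpace ℝ (Fin N) → ℝ} {Hh : Fin N → Fin N → EuclideanSpace ℝ (Fin N) → ℝ} {m L : ℝ}

/-- Quadratic bound for `Psi` at a degenerate boundary point. -/
lemma Psi_quad (r : Ref Ω U G Hh m L) {p : EuclideanSpace ℝ (Fin N)} (hp : p ∈ frontier Ω) (h0 : ∀ i, G i p = 0) :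
    ∃ C : ℝ, 0 ≤ C ∧ ∃ ρ : ℝ, 0 < ρ ∧ ∀ x ∈ closure Ω, dist x p < ρ → Psi U G m L x ≤ C * ‖x - p‖ ^ 2 := by
  have hpc := frontier_subset_closure hp
  have hNR : (0:ℝ) < N := by exact_mod_cast r.hN
  have hcP := r.cP_nonneg
  choose c hc ρ hρ hb using fun i => hfd_bound (r.nu.dg i p hpc)
  set C := ∑ i, c i with hCdef
  have hC : 0 ≤ C := Finset.sum_nonneg fun i _ => hc i
  have hcC : ∀ i, c i ≤ C := fun i => Finset.single_le_sum (fun i _ => hc i) (Finset.mem_univ i)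
  obtain ⟨ρ0, hρ0, hρi⟩ : ∃ ρ0 : ℝ, 0 < ρ0 ∧ ∀ i, ρ0 ≤ ρ i := by
    have : Nonempty (Fin N) := ⟨⟨0, r.hN⟩⟩
    obtain ⟨i, hi⟩ := Finite.exists_min ρ
    exact ⟨ρ i, hρ i, hi⟩
  have hG : ∀ i, ∀ x ∈ closure Ω, dist x p < ρ0 → |G i x| ≤ C * ‖x - p‖ := by
    intro i x hx hd
    have := hb i x hx (hd.trans_le (hρi i))
    rw [h0 i, sub_zero] at this
    exact this.trans (mul_le_mul_of_nonneg_right (hcC i) (norm_nonneg _))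
  have hU : ∀ x ∈ closure Ω, dist x p < ρ0 / 2 → U x ≤ 2 * N * C * ‖x - p‖ ^ 2 := by
    intro x hx hd
    rcases r.mem_or hx with hx | hx
    · have hpc' : p ∉ Ω := by rw [r.ho.frontier_eq] at hp; exact hp.2
      have hne : Ω ≠ Set.univ := fun h => hpc' (h ▸ Set.mem_univ p)
      obtain ⟨y, hy, hdist⟩ := exists_mem_frontier_infDist_compl_eq_dist hx hne
      have hyp : dist x y ≤ dist x p := by
        rw [← hdist]; exact Metric.infDist_le_dist_of_mem hpc'
      have hball : Metric.ball x (dist x y) ⊆ Ω := by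
        rw [← hdist]; exact Metric.ball_infDist_compl_subset
      have hxy : dist x y ≠ 0 := by
        intro h; rw [dist_eq_zero] at h
        rw [r.ho.frontier_eq] at hy; exact hy.2 (h ▸ hx)
      have hcb : Metric.closedBall x (dist x y) ⊆ closure Ω := by
        rw [← closure_ball x hxy]; exact closure_mono hball
      have hz : ∀ z ∈ Metric.closedBall x (dist x y), ∀ i, |G i z| ≤ C * (2 * ‖x - p‖) := by
        intro z hz i
        have e1 : dist z p ≤ 2 * dist x p := by
          have := dist_triangle z x p
          rw [Metric.mem_closedBall] at hz
          linarith
        refine (hG i z (hcb hz) (by linarith)).trans (mul_le_mul_of_nonneg_left ?_ hC)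
        rw [← dist_eq_norm, ← dist_eq_norm]; exact e1
      have := seg_bound (A := C * (2 * ‖x - p‖)) (by positivity) (convex_closedBall x (dist x y)) hcb r.nu.dh hz
        (x := y) (y := x) (by rw [Metric.mem_closedBall, dist_comm]) (Metric.mem_closedBall_self dist_nonneg)
      rw [r.nu.b0 y hy, sub_zero] at this
      have h3 : ‖x - y‖ ≤ ‖x - p‖ := by rw [← dist_eq_norm, ← dist_eq_norm]; exact hyp
      calc U x ≤ _ := (le_abs_self _).trans this
        _ ≤ N * (C * (2 * ‖x - p‖)) * ‖x - p‖ := mul_le_mul_of_nonneg_left h3 (by positivity)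
        _ = _ := by ring
    · rw [r.nu.b0 x hx]; positivity
  refine ⟨N * C ^ 2 + cP N m L * (2 * N * C), by positivity, ρ0 / 2, by positivity, ?_⟩
  intro x hx hd
  have h1 : ∑ i, G i x ^ 2 ≤ N * (C * ‖x - p‖) ^ 2 := by
    calc ∑ i, G i x ^ 2 ≤ ∑ _i : Fin N, (C * ‖x - p‖) ^ 2 :=
          Finset.sum_le_sum fun i _ => by
            rw [← sq_abs]; exact pow_le_pow_left₀ (abs_nonneg _) (hG i x hx (by linarith)) 2
      _ = _ := by simp
  have h2 := mul_le_mul_of_nonneg_left (hU x hx hd) hcP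
  calc Psi U G m L x = ∑ i, G i x ^ 2 + cP N m L * U x := rfl
    _ ≤ N * (C * ‖x - p‖) ^ 2 + cP N m L * (2 * N * C * ‖x - p‖ ^ 2) := add_le_add h1 h2
    _ = _ := by ring

lemma lip_point (r : Ref Ω U G Hh m L) {p : EuclideanSpace ℝ (Fin N)} (hp : p ∈ closure Ω) :
    ∃ C : ℝ, 0 ≤ C ∧ ∃ ρ : ℝ, 0 < ρ ∧ ∀ (h : EuclideanSpace ℝ (Fin N) → ℝ) (g : Fin N → EuclideanSpace ℝ (Fin N) → ℝ)
      (K : Fin N → Fin N → EuclideanSpace ℝ (Fin N) → ℝ) (A : ℝ), Nice Ω h g K → 0 ≤ A →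
      (∀ x ∈ closure Ω, (∀ i, |g i x| ≤ A) ∧ ∀ i j, |K i j x| ≤ A) →
      (∀ x ∈ Ω, |lap h x| ≤ A) → (∀ i, ∀ x ∈ Ω, |pd i (lap h) x| ≤ A) →
      ∀ x ∈ closure Ω, dist x p < ρ → |h x - h p| ≤ C * A * ‖x - p‖ ∧ ∀ j, |g j x - g j p| ≤ C * A * ‖x - p‖ := by
  have hNR : (0:ℝ) < N := by exact_mod_cast r.hN
  have hm := r.m0
  have hL := r.L1
  rcases r.mem_or hp with hpΩ | hpf
  · obtain ⟨ρ, hρ, hball⟩ := Metric.isOpen_iff.1 r.ho p hpΩ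
    refine ⟨N, hNR.le, ρ, hρ, fun h g K A n hA hb _ _ x hx hd => ⟨?_, fun j => ?_⟩⟩
    · exact seg_bound hA (convex_ball p ρ) (hball.trans subset_closure) n.dh
        (fun z hz => (hb z (subset_closure (hball hz))).1) (Metric.mem_ball_self hρ) hd
    · exact seg_bound hA (convex_ball p ρ) (hball.trans subset_closure) (n.dg j)
        (fun z hz => (hb z (subset_closure (hball hz))).2 j) (Metric.mem_ball_self hρ) hd
  · obtain ⟨C0, hC0, ρ0, hρ0, hU⟩ := hfd_bound (r.nu.dh p hp)
    have hh : ∀ (h : EuclideanSpace ℝ (Fin N) → ℝ) (g : Fin N → EuclideanSpace ℝ (Fin N) → ℝ)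
        (K : Fin N → Fin N → EuclideanSpace ℝ (Fin N) → ℝ) (A : ℝ), Nice Ω h g K → 0 ≤ A →
        (∀ x ∈ Ω, |lap h x| ≤ A) → ∀ x ∈ closure Ω, dist x p < ρ0 → |h x - h p| ≤ C0 / m * A * ‖x - p‖ := by
      intro h g K A n hA h1 x hx hd
      rw [n.b0 p hpf, sub_zero]
      have e1 := r.L1' n hA h1 x hx
      have e2 := hU x hx hd
      rw [r.nu.b0 p hpf, sub_zero] at e2
      have e3 := (le_abs_self _).trans e2
      calc |h x| ≤ A / m * U x := e1
        _ ≤ A / m * (C0 * ‖x - p‖) := mul_le_mul_of_nonneg_left e3 (by positivity)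
        _ = _ := by ring
    by_cases hdeg : ∀ i, G i p = 0
    · obtain ⟨C1, hC1, ρ1, hρ1, hP⟩ := r.Psi_quad hpf hdeg
      refine ⟨C0 / m + (L * N + 1 / m) * (C1 + 1), by positivity, min ρ0 (min ρ1 (L * N)), by positivity, ?_⟩
      intro h g K A n hA hb l0 l1 x hx hd
      rw [lt_min_iff, lt_min_iff] at hd
      have q0 : 0 ≤ (L * N + 1 / m) * (C1 + 1) * A * ‖x - p‖ := by positivity
      have q1 : 0 ≤ C0 / m * A * ‖x - p‖ := by positivity
      refine ⟨by linarith [hh h g K A n hA l0 x hx hd.1], fun j => ?_⟩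
      have hgp : g j p = 0 := by
        have h2 : g j p ^ 2 ≤ 0 := (r.bdry_grad n hA l0 j p hpf).trans_eq (by simp [hdeg])
        exact (pow_eq_zero_iff two_ne_zero).1 (le_antisymm h2 (sq_nonneg _))
      rcases (norm_nonneg (x - p)).eq_or_lt with hz | hz
      · rw [eq_comm, norm_eq_zero, sub_eq_zero] at hz
        subst hz; simp
      have e1 := r.L2' n hA l0 l1 hz (by rw [← dist_eq_norm]; exact hd.2.2.le) j x hx
      have e2 := hP x hx hd.2.1
      have e3 : Psi U G m L x / ‖x - p‖ + ‖x - p‖ ≤ (C1 + 1) * ‖x - p‖ := by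
        have : Psi U G m L x / ‖x - p‖ ≤ C1 * ‖x - p‖ := by
          rw [div_le_iff₀ hz]; linarith
        linarith
      have e4 := mul_le_mul_of_nonneg_left e3 (show 0 ≤ (L * N + 1 / m) * A by positivity)
      rw [hgp, sub_zero]
      linarith
    · push Not at hdeg
      obtain ⟨i0, hi0⟩ := hdeg
      obtain ⟨ρ1, hρ1, hR⟩ := r.lip_reg hp i0 hi0
      refine ⟨C0 / m + 10 * N, by positivity, min ρ0 ρ1, by positivity, ?_⟩
      intro h g K A n hA hb l0 l1 x hx hd
      rw [lt_min_iff] at hd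
      have q0 : 0 ≤ 10 * N * A * ‖x - p‖ := by positivity
      have q1 : 0 ≤ C0 / m * A * ‖x - p‖ := by positivity
      refine ⟨by linarith [hh h g K A n hA l0 x hx hd.1], fun j => ?_⟩
      have := hR (g j) (K j) A hA (n.dg j) (fun z hz => (hb z hz).2 j) x hx hd.2 p hp (by rw [dist_self]; exact hρ1)
      linarith

end Ref
end LP9

section LP10
open Filter Topology
variable {N : ℕ}

lemma lim_fderiv {f : ℕ → EuclideanSpace ℝ (Fin N) → ℝ} {F : EuclideanSpace ℝ (Fin N) → ℝ}
    {l : ℕ → EuclideanSpace ℝ (Fin N) →L[ℝ] ℝ} {l0 : EuclideanSpace ℝ (Fin N) →L[ℝ] ℝ} {S : Set (EuclideanSpace ℝ (Fin N))}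
    {p : EuclideanSpace ℝ (Fin N)} (hl : Tendsto l atTop (𝓝 l0)) (hf : ∀ n, HasFDerivWithinAt (f n) (l n) S p)
    (hF : ∀ x ∈ S, Tendsto (fun n => f n x) atTop (𝓝 (F x))) (hp : p ∈ S) {ρ : ℝ} (hρ : 0 < ρ)
    (hc : ∀ ε > 0, ∃ n0, ∀ n ≥ n0, ∀ k ≥ n0, ∀ x ∈ S, dist x p < ρ → |(f n x - f k x) - (f n p - f k p)| ≤ ε * ‖x - p‖) :
    HasFDerivWithinAt F l0 S p := by
  rw [hasFDerivWithinAt_iff_isLittleO, Asymptotics.isLittleO_iff]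
  intro c hc0
  obtain ⟨n0, hn0⟩ := hc (c / 3) (by positivity)
  obtain ⟨n1, hn1⟩ := Metric.tendsto_atTop.1 hl (c / 3) (by positivity)
  set n := max n0 n1
  have h1 := (hasFDerivWithinAt_iff_isLittleO.1 (hf n)).def (show 0 < c / 3 by positivity)
  have h2 := hn1 n (le_max_right _ _)
  rw [dist_eq_norm] at h2
  filter_upwards [h1, self_mem_nhdsWithin, mem_nhdsWithin_of_mem_nhds (Metric.ball_mem_nhds p hρ)] with x hx hxS hxρ
  have h3 : |(f n x - F x) - (f n p - F p)| ≤ c / 3 * ‖x - p‖ := by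
    refine le_of_tendsto (((tendsto_const_nhds.sub (hF x hxS)).sub (tendsto_const_nhds.sub (hF p hp))).abs) ?_
    filter_upwards [eventually_ge_atTop n0] with k hk
    exact hn0 n (le_max_left _ _) k hk x hxS hxρ
  have h4 : |(l n - l0) (x - p)| ≤ c / 3 * ‖x - p‖ := by
    rw [← norm_eq_abs]
    exact ((l n - l0).le_opNorm _).trans (mul_le_mul_of_nonneg_right h2.le (norm_nonneg _))
  rw [norm_eq_abs] at hx ⊢
  rw [sub_apply] at h4
  rw [abs_le] at hx h3 h4 ⊢
  constructor <;> linarith [hx.1, hx.2, h3.1, h3.2, h4.1, h4.2]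

lemma unif_lim {f : ℕ → EuclideanSpace ℝ (Fin N) → ℝ} {S : Set (EuclideanSpace ℝ (Fin N))} (hc : ∀ n, ContinuousOn (f n) S)
    (h : ∀ ε > 0, ∃ n0, ∀ n ≥ n0, ∀ k ≥ n0, ∀ x ∈ S, |f n x - f k x| ≤ ε) :
    ∃ F : EuclideanSpace ℝ (Fin N) → ℝ, ContinuousOn F S ∧ ∀ x ∈ S, Tendsto (fun n => f n x) atTop (𝓝 (F x)) := by
  have hl : ∀ x : S, ∃ a, Tendsto (fun n => f n x) atTop (𝓝 a) := by
    intro x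
    refine cauchySeq_tendsto_of_complete (Metric.cauchySeq_iff.2 fun ε hε => ?_)
    obtain ⟨n0, hn⟩ := h (ε / 2) (by positivity)
    refine ⟨n0, fun n hn1 k hk => ?_⟩
    rw [Real.dist_eq]
    linarith [hn n hn1 k hk x x.2]
  choose a ha using hl
  classical
  refine ⟨fun x => if hx : x ∈ S then a ⟨x, hx⟩ else 0, ?_, ?_⟩
  swap
  · intro x hx
    simp only [hx, dite_true]
    exact ha ⟨x, hx⟩
  · have : TendstoUniformlyOn f (fun x => if hx : x ∈ S then a ⟨x, hx⟩ else 0) atTop S := by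
      refine Metric.tendstoUniformlyOn_iff.2 fun ε hε => ?_
      obtain ⟨n0, hn⟩ := h (ε / 2) (by positivity)
      filter_upwards [eventually_ge_atTop n0] with n hn1 x hx
      simp only [hx, dite_true]
      have h3 : |f n x - a ⟨x, hx⟩| ≤ ε / 2 := by
        refine le_of_tendsto ((tendsto_const_nhds.sub (ha ⟨x, hx⟩)).abs) ?_
        filter_upwards [eventually_ge_atTop n0] with k hk
        exact hn n hn1 k hk x hx
      rw [dist_comm, Real.dist_eq]
      linarith
    exact this.continuousOn (Frequently.of_forall hc)

lemma contDiffOn_mkL {n : WithTop ℕ∞} {S : Set (EuclideanSpace ℝ (Fin N))} {a : Fin N → EuclideanSpace ℝ (Fin N) → ℝ}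
    (h : ∀ i, ContDiffOn ℝ n (a i) S) : ContDiffOn ℝ n (fun x => mkL fun i => a i x) S := by
  unfold mkL
  exact ContDiffOn.sum fun i _ => (h i).smul contDiffOn_const

lemma tendsto_mkL {a : ℕ → Fin N → ℝ} {b : Fin N → ℝ} (h : ∀ i, Tendsto (fun n => a n i) atTop (𝓝 (b i))) :
    Tendsto (fun n => mkL (a n)) atTop (𝓝 (mkL b)) := by
  unfold mkL
  exact tendsto_finsetSum _ fun i _ => (h i).smul_const _

lemma contDiffOn_two {S : Set (EuclideanSpace ℝ (Fin N))} {u : EuclideanSpace ℝ (Fin N) → ℝ}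
    {g : Fin N → EuclideanSpace ℝ (Fin N) → ℝ} {H : Fin N → Fin N → EuclideanSpace ℝ (Fin N) → ℝ}
    (hu : ∀ x ∈ S, HasFDerivWithinAt u (mkL fun i => g i x) S x)
    (hg : ∀ i, ∀ x ∈ S, HasFDerivWithinAt (g i) (mkL fun j => H i j x) S x)
    (hH : ∀ i j, ContinuousOn (H i j) S) : ContDiffOn ℝ 2 u S := by
  have h1 : ∀ i, ContDiffOn ℝ 1 (g i) S := by
    intro i
    have : ContDiffOn ℝ (0 + 1) (g i) S := by
      rw [contDiffOn_succ_iff_hasFDerivWithinAt (by simp)]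
      intro x hx
      refine ⟨S, by rw [Set.insert_eq_of_mem hx]; exact self_mem_nhdsWithin, by simp, _, hg i, ?_⟩
      exact contDiffOn_mkL fun j => contDiffOn_zero.2 (hH i j)
    simpa using this
  have : ContDiffOn ℝ (1 + 1) u S := by
    rw [contDiffOn_succ_iff_hasFDerivWithinAt (by simp)]
    intro x hx
    refine ⟨S, by rw [Set.insert_eq_of_mem hx]; exact self_mem_nhdsWithin, by simp, _, hu, contDiffOn_mkL h1⟩
  rwa [one_add_one_eq_two] at this

namespace Ref
variable {Ω : Set (EuclideanSpace ℝ (Fin N))} {U : EuclideanSpace ℝ (Fin N) → ℝ}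
  {G : Fin N → EuclideanSpace ℝ (Fin N) → ℝ} {Hh : Fin N → Fin N → EuclideanSpace ℝ (Fin N) → ℝ} {m L : ℝ}

lemma lim_cont (r : Ref Ω U G Hh m L) {E C0 : ℝ} (hE : 0 ≤ E) {lam mu : ℕ → ℝ} {u v : ℕ → EuclideanSpace ℝ (Fin N) → ℝ}
    {g k : ℕ → Fin N → EuclideanSpace ℝ (Fin N) → ℝ} {H K : ℕ → Fin N → Fin N → EuclideanSpace ℝ (Fin N) → ℝ}
    (s : ∀ n, Sol Ω (lam n) (mu n) (u n) (v n) (g n) (k n) (H n) (K n) E C0) {uS : EuclideanSpace ℝ (Fin N) → ℝ}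
    (hu : ∀ x ∈ closure Ω, Tendsto (fun n => u n x) atTop (𝓝 (uS x))) : ContinuousOn uS (closure Ω) := by
  obtain ⟨C, hC, hb⟩ := r.sol_bound E C0 hE
  intro p hp
  obtain ⟨C1, hC1, ρ, hρ, hl⟩ := r.lip_point hp
  set M := E * exp C0 with hM
  have hM0 : 0 ≤ M := by positivity
  set A := C + M + M * C with hA
  have hA0 : 0 ≤ A := by positivity
  have key : ∀ n, ∀ x ∈ closure Ω, dist x p < ρ → |u n x - u n p| ≤ C1 * A * ‖x - p‖ := by
    intro n x hx hd
    have q : 0 ≤ M * C := by positivity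
    refine (hl (u n) (g n) (H n) A (s n).nu hA0 (fun x hx => ⟨fun i => ?_, fun i j => ?_⟩) (fun x hx => ?_) (fun i x hx => ?_) x hx hd).1
    · linarith [((hb _ _ _ _ _ _ _ _ (s n) x hx).1 i).1]
    · linarith [((hb _ _ _ _ _ _ _ _ (s n) x hx).2 i j).1]
    · rw [(s n).eu x hx, abs_neg]
      linarith [(s n).F_le (subset_closure hx)]
    · rw [(s n).d1 hx, abs_neg]
      have := abs_mul_le' ((s n).F_le (subset_closure hx)) ((hb _ _ _ _ _ _ _ _ (s n) x (subset_closure hx)).1 i).2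
      linarith
  have key' : ∀ x ∈ closure Ω, dist x p < ρ → |uS x - uS p| ≤ C1 * A * ‖x - p‖ := by
    intro x hx hd
    exact le_of_tendsto ((hu x hx).sub (hu p hp)).abs (Eventually.of_forall fun n => key n x hx hd)
  have : Tendsto (fun x => C1 * A * ‖x - p‖) (𝓝[closure Ω] p) (𝓝 0) := by
    have h : Continuous fun x : EuclideanSpace ℝ (Fin N) => C1 * A * ‖x - p‖ := by fun_prop
    have := (h.tendsto p).mono_left (nhdsWithin_le_nhds (s := closure Ω))
    simpa using this
  refine tendsto_iff_dist_tendsto_zero.2 (squeeze_zero' (Eventually.of_forall fun _ => dist_nonneg) ?_ this)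
  filter_upwards [self_mem_nhdsWithin, mem_nhdsWithin_of_mem_nhds (Metric.ball_mem_nhds p hρ)] with x hx hxρ
  rw [Real.dist_eq]; exact key' x hx hxρ

lemma unif_cauchy {f : ℕ → EuclideanSpace ℝ (Fin N) → ℝ} {F : EuclideanSpace ℝ (Fin N) → ℝ} {S : Set (EuclideanSpace ℝ (Fin N))}
    (h : TendstoUniformlyOn f F atTop S) {ε : ℝ} (hε : 0 < ε) :
    ∃ n0, ∀ n ≥ n0, ∀ k ≥ n0, ∀ x ∈ S, |f n x - f k x| ≤ ε := by
  obtain ⟨n0, hn⟩ := eventually_atTop.1 (Metric.tendstoUniformlyOn_iff.1 h (ε / 2) (by positivity))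
  refine ⟨n0, fun n h1 k h2 x hx => ?_⟩
  have a := hn n h1 x hx
  have b := hn k h2 x hx
  rw [← Real.dist_eq]
  have := dist_triangle_left (f n x) (f k x) (F x)
  linarith

lemma seq_close (r : Ref Ω U G Hh m L) {E C0 : ℝ} (hE : 0 ≤ E) {lam mu : ℕ → ℝ} {u v : ℕ → EuclideanSpace ℝ (Fin N) → ℝ}
    {g k : ℕ → Fin N → EuclideanSpace ℝ (Fin N) → ℝ} {H K : ℕ → Fin N → Fin N → EuclideanSpace ℝ (Fin N) → ℝ}
    (s : ∀ n, Sol Ω (lam n) (mu n) (u n) (v n) (g n) (k n) (H n) (K n) E C0) {uS vS : EuclideanSpace ℝ (Fin N) → ℝ}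
    {lamS muS : ℝ} (hlam : Tendsto lam atTop (𝓝 lamS)) (hmu : Tendsto mu atTop (𝓝 muS))
    (hum : ∀ x ∈ closure Ω, Monotone fun n => u n x) (hvm : ∀ x ∈ closure Ω, Monotone fun n => v n x)
    (hu : ∀ x ∈ closure Ω, Tendsto (fun n => u n x) atTop (𝓝 (uS x)))
    (hv : ∀ x ∈ closure Ω, Tendsto (fun n => v n x) atTop (𝓝 (vS x))) {δ : ℝ} (hδ : 0 < δ) :
    ∃ n0, ∀ n ≥ n0, ∀ k ≥ n0, Close Ω (lam n) (mu n) (lam k) (mu k) (u n) (v n) (u k) (v k) δ := by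
  have hcl : IsCompact (closure Ω) := r.hb.isCompact_closure
  have Uu := Monotone.tendstoUniformlyOn_of_forall_tendsto hcl (fun n => (s n).nu.ch) hum (r.lim_cont hE s hu) hu
  have Uv := Monotone.tendstoUniformlyOn_of_forall_tendsto hcl (fun n => (s n).nv.ch) hvm (r.lim_cont hE (fun n => (s n).symm) hv) hv
  obtain ⟨n1, h1⟩ := unif_cauchy Uu hδ
  obtain ⟨n2, h2⟩ := unif_cauchy Uv hδ
  obtain ⟨n3, h3⟩ := Metric.cauchySeq_iff.1 hlam.cauchySeq δ hδ
  obtain ⟨n4, h4⟩ := Metric.cauchySeq_iff.1 hmu.cauchySeq δ hδ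
  refine ⟨max (max n1 n2) (max n3 n4), fun n hn k hk => ?_⟩
  simp only [ge_iff_le, max_le_iff] at hn hk
  exact ⟨hδ.le, (h3 n hn.2.1 k hk.2.1).le, (h4 n hn.2.2 k hk.2.2).le, h1 n hn.1.1 k hk.1.1, h2 n hn.1.2 k hk.1.2⟩

lemma seq_limit (r : Ref Ω U G Hh m L) {E C0 : ℝ} (hE : 0 ≤ E) {lam mu : ℕ → ℝ} {u v : ℕ → EuclideanSpace ℝ (Fin N) → ℝ}
    {g k : ℕ → Fin N → EuclideanSpace ℝ (Fin N) → ℝ} {H K : ℕ → Fin N → Fin N → EuclideanSpace ℝ (Fin N) → ℝ}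
    (s : ∀ n, Sol Ω (lam n) (mu n) (u n) (v n) (g n) (k n) (H n) (K n) E C0) {uS vS : EuclideanSpace ℝ (Fin N) → ℝ}
    {lamS muS : ℝ} (hlam : Tendsto lam atTop (𝓝 lamS)) (hmu : Tendsto mu atTop (𝓝 muS))
    (hum : ∀ x ∈ closure Ω, Monotone fun n => u n x) (hvm : ∀ x ∈ closure Ω, Monotone fun n => v n x)
    (hu : ∀ x ∈ closure Ω, Tendsto (fun n => u n x) atTop (𝓝 (uS x)))
    (hv : ∀ x ∈ closure Ω, Tendsto (fun n => v n x) atTop (𝓝 (vS x))) :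
    ContDiffOn ℝ 2 uS (closure Ω) ∧ (∀ x ∈ Ω, -lap uS x = muS * exp (vS x)) ∧ ∀ x ∈ frontier Ω, uS x = 0 := by
  obtain ⟨C, hC, hd⟩ := r.sol_diff E C0 hE
  have hcl := fun δ (hδ : (0:ℝ) < δ) => r.seq_close hE s hlam hmu hum hvm hu hv hδ
  have small : ∀ D : ℝ, 0 ≤ D → ∀ ε > 0, ∃ δ : ℝ, 0 < δ ∧ D * δ ≤ ε := by
    intro D hD ε hε
    refine ⟨ε / (D + 1), by positivity, ?_⟩
    rw [mul_div_assoc', div_le_iff₀ (by positivity)]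
    nlinarith
  have cg : ∀ i, ∀ ε > 0, ∃ n0, ∀ n ≥ n0, ∀ q ≥ n0, ∀ x ∈ closure Ω, |g n i x - g q i x| ≤ ε := by
    intro i ε hε
    obtain ⟨δ, hδ, hδε⟩ := small C hC ε hε
    obtain ⟨n0, hn⟩ := hcl δ hδ
    refine ⟨n0, fun n h1 q h2 x hx => ?_⟩
    exact (((hd _ _ _ _ _ _ _ _ _ _ _ _ _ _ _ _ _ (s n) (s q) (hn n h1 q h2)).1 x hx).1 i).trans hδε
  have cH : ∀ i j, ∀ ε > 0, ∃ n0, ∀ n ≥ n0, ∀ q ≥ n0, ∀ x ∈ closure Ω, |H n i j x - H q i j x| ≤ ε := by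
    intro i j ε hε
    obtain ⟨δ, hδ, hδε⟩ := small C hC ε hε
    obtain ⟨n0, hn⟩ := hcl δ hδ
    refine ⟨n0, fun n h1 q h2 x hx => ?_⟩
    exact (((hd _ _ _ _ _ _ _ _ _ _ _ _ _ _ _ _ _ (s n) (s q) (hn n h1 q h2)).1 x hx).2 i j).trans hδε
  choose gS hgc hgS using fun i => unif_lim (fun n => (s n).nu.cg i) (cg i)
  choose HS hHc hHS using fun i j => unif_lim (fun n => (s n).nu.cH i j) (cH i j)
  have lip : ∀ p ∈ closure Ω, ∃ ρ : ℝ, 0 < ρ ∧ ∀ ε > 0, ∃ n0, ∀ n ≥ n0, ∀ q ≥ n0, ∀ x ∈ closure Ω, dist x p < ρ →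
      |(u n x - u q x) - (u n p - u q p)| ≤ ε * ‖x - p‖ ∧ ∀ j, |(g n j x - g q j x) - (g n j p - g q j p)| ≤ ε * ‖x - p‖ := by
    intro p hp
    obtain ⟨C1, hC1, ρ, hρ, hl⟩ := r.lip_point hp
    refine ⟨ρ, hρ, fun ε hε => ?_⟩
    obtain ⟨δ, hδ, hδε⟩ := small (C1 * C) (by positivity) ε hε
    obtain ⟨n0, hn⟩ := hcl δ hδ
    refine ⟨n0, fun n h1 q h2 x hx hxp => ?_⟩
    obtain ⟨e1, e2, e3⟩ := hd _ _ _ _ _ _ _ _ _ _ _ _ _ _ _ _ _ (s n) (s q) (hn n h1 q h2)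
    have := hl _ _ _ (C * δ) ((s n).nu.sub (s q).nu) (by positivity) e1 e2 e3 x hx hxp
    have e4 : C1 * (C * δ) * ‖x - p‖ ≤ ε * ‖x - p‖ := mul_le_mul_of_nonneg_right (by linarith) (norm_nonneg _)
    exact ⟨this.1.trans e4, fun j => (this.2 j).trans e4⟩
  have Du : ∀ x ∈ closure Ω, HasFDerivWithinAt uS (mkL fun i => gS i x) (closure Ω) x := by
    intro p hp
    obtain ⟨ρ, hρ, hl⟩ := lip p hp
    refine lim_fderiv (tendsto_mkL fun i => hgS i p hp) (fun n => (s n).nu.dh p hp) hu hp hρ fun ε hε => ?_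
    obtain ⟨n0, hn⟩ := hl ε hε
    exact ⟨n0, fun n h1 q h2 x hx hxp => (hn n h1 q h2 x hx hxp).1⟩
  have Dg : ∀ i, ∀ x ∈ closure Ω, HasFDerivWithinAt (gS i) (mkL fun j => HS i j x) (closure Ω) x := by
    intro i p hp
    obtain ⟨ρ, hρ, hl⟩ := lip p hp
    refine lim_fderiv (tendsto_mkL fun j => hHS i j p hp) (fun n => (s n).nu.dg i p hp) (hgS i) hp hρ fun ε hε => ?_
    obtain ⟨n0, hn⟩ := hl ε hε
    exact ⟨n0, fun n h1 q h2 x hx hxp => (hn n h1 q h2 x hx hxp).2 i⟩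
  have hnb : ∀ x ∈ Ω, closure Ω ∈ 𝓝 x := fun x hx => mem_of_superset (r.ho.mem_nhds hx) subset_closure
  refine ⟨contDiffOn_two Du Dg hHc, fun x hx => ?_, fun x hx => ?_⟩
  · have hxc := subset_closure hx
    have p1 : ∀ i, pd i uS =ᶠ[𝓝 x] gS i := by
      intro i
      filter_upwards [r.ho.mem_nhds hx] with y hy
      show fderiv ℝ uS y _ = _
      rw [((Du y (subset_closure hy)).hasFDerivAt (hnb y hy)).fderiv, mkL_single]
    have p2 : lap uS x = ∑ i, HS i i x := by
      rw [lap_eq]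
      refine Finset.sum_congr rfl fun i _ => ?_
      rw [pd_congr (p1 i)]
      show fderiv ℝ (gS i) x _ = _
      rw [((Dg i x hxc).hasFDerivAt (hnb x hx)).fderiv, mkL_single]
    have t1 : Tendsto (fun n => ∑ i, H n i i x) atTop (𝓝 (∑ i, HS i i x)) := tendsto_finsetSum _ fun i _ => hHS i i x hxc
    have t2 : Tendsto (fun n => -(mu n * exp (v n x))) atTop (𝓝 (-(muS * exp (vS x)))) :=
      (hmu.mul ((continuous_exp.tendsto _).comp (hv x hxc))).neg
    have e : (fun n => ∑ i, H n i i x) = fun n => -(mu n * exp (v n x)) := by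
      funext n
      rw [(s n).nu.trace hx, (s n).eu x hx]
    rw [e] at t1
    rw [p2, tendsto_nhds_unique t1 t2, neg_neg]
  · have := hu x (frontier_subset_closure hx)
    have e : (fun n => u n x) = fun _ => 0 := funext fun n => (s n).nu.b0 x hx
    rw [e] at this
    exact tendsto_nhds_unique this tendsto_const_nhds

end Ref
end LP10

section LP11
open Filter Topology
variable {N : ℕ} {Ω : Set (EuclideanSpace ℝ (Fin N))}

lemma to_sol (hN : 0 < N) (ho : IsOpen Ω) {lam mu E C : ℝ} {u v : EuclideanSpace ℝ (Fin N) → ℝ}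
    (hl : 0 ≤ lam) (hl1 : lam ≤ E) (hm : 0 ≤ mu) (hm1 : mu ≤ E) (h : IsGelfandSolution Ω lam mu u v)
    (bu : ∀ x ∈ Ω, u x ≤ C) (bv : ∀ x ∈ Ω, v x ≤ C) :
    ∃ q : ((Fin N → EuclideanSpace ℝ (Fin N) → ℝ) × (Fin N → EuclideanSpace ℝ (Fin N) → ℝ)) ×
      ((Fin N → Fin N → EuclideanSpace ℝ (Fin N) → ℝ) × (Fin N → Fin N → EuclideanSpace ℝ (Fin N) → ℝ)),
      Sol Ω lam mu u v q.1.1 q.1.2 q.2.1 q.2.2 E C := by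
  obtain ⟨h1, h2, h3, h4, h5, h6⟩ := h
  obtain ⟨su, sv⟩ := gelfand_smooth hN ho (h1.mono subset_closure) (h2.mono subset_closure) h3 h4
  obtain ⟨g, H, nu⟩ := exists_nice ho h1 su h5
  obtain ⟨k, K, nv⟩ := exists_nice ho h2 sv h6
  exact ⟨((g, k), (H, K)), ho, nu, nv, fun x hx => by linarith [h3 x hx], fun x hx => by linarith [h4 x hx], hl, hl1, hm, hm1,
    Nice.closure_le' nu.ch continuousOn_const bu, Nice.closure_le' nv.ch continuousOn_const bv⟩

lemma to_ref (hN : 0 < N) (hb : Bornology.IsBounded Ω) {lam mu E C : ℝ} {u v : EuclideanSpace ℝ (Fin N) → ℝ}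
    {g k : Fin N → EuclideanSpace ℝ (Fin N) → ℝ} {H K : Fin N → Fin N → EuclideanSpace ℝ (Fin N) → ℝ}
    (s : Sol Ω lam mu u v g k H K E C) (hm : 0 < mu) (hv : ∀ x ∈ Ω, 0 ≤ v x) : ∃ L, Ref Ω u g H mu L := by
  obtain ⟨L1, h1, b1⟩ := s.nu.bdd hb
  obtain ⟨L2, h2, b2⟩ := s.nv.bdd hb
  have hE : 0 ≤ E := s.m0.trans s.m1
  have q1 : 0 ≤ E * exp C := by positivity
  have q2 : 0 ≤ E * exp C * L2 := by positivity
  refine ⟨1 + L1 + E * exp C + E * exp C * L2, hN, s.ho, hb, s.nu, hm, fun x hx => ?_, by linarith, fun x hx => ?_,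
    fun i x hx => ?_, fun i j x hx => ?_, fun x hx => ?_, fun i x hx => ?_⟩
  · rw [s.eu x hx, neg_le_neg_iff]
    exact le_mul_of_one_le_right hm.le (one_le_exp (hv x hx))
  · linarith [(b1 x hx).1]
  · linarith [(b1 x hx).2.1 i]
  · linarith [(b1 x hx).2.2 i j]
  · rw [s.eu x hx, abs_neg]
    linarith [s.F_le (subset_closure hx)]
  · rw [s.d1 hx, abs_neg]
    have := Ref.abs_mul_le' (s.F_le (subset_closure hx)) ((b2 x (subset_closure hx)).2.1 i)
    linarith

lemma part_two (hN : 0 < N) (hN3 : N ≤ 3) (ho : IsOpen Ω) (hb : Bornology.IsBounded Ω)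
    (lamStar muStar : ℝ) (hl : 0 < lamStar) (hm : 0 < muStar)
    (u v : ℕ → EuclideanSpace ℝ (Fin N) → ℝ) (uStar vStar : EuclideanSpace ℝ (Fin N) → ℝ)
    (hs : ∀ n : ℕ, 1 ≤ n → IsStableGelfandSolution Ω ((1 - 1 / (n : ℝ)) * lamStar)
            ((1 - 1 / (n : ℝ)) * muStar) (u n) (v n))
    (hum : ∀ x ∈ closure Ω, Monotone fun n => u n x)
    (hvm : ∀ x ∈ closure Ω, Monotone fun n => v n x)
    (hu : ∀ x ∈ closure Ω, Filter.Tendsto (fun n => u n x) Filter.atTop (nhds (uStar x)))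
    (hv : ∀ x ∈ closure Ω, Filter.Tendsto (fun n => v n x) Filter.atTop (nhds (vStar x))) :
    ContDiffOn ℝ (⊤ : ℕ∞) uStar Ω ∧ ContDiffOn ℝ (⊤ : ℕ∞) vStar Ω ∧
          IsGelfandSolution Ω lamStar muStar uStar vStar := by
  set t : ℕ → ℝ := fun n => 1 - 1 / ((n + 2 : ℕ) : ℝ) with ht
  have ht0 : ∀ n, 0 < t n := by
    intro n
    have h2 : (1:ℝ) < ((n + 2 : ℕ) : ℝ) := by exact_mod_cast (by omega : 1 < n + 2)
    have : 1 / ((n + 2 : ℕ) : ℝ) < 1 := by rw [div_lt_one (by linarith)]; exact h2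
    simp only [ht]; linarith
  have ht1 : ∀ n, t n ≤ 1 := by
    intro n
    have : 0 ≤ 1 / ((n + 2 : ℕ) : ℝ) := by positivity
    simp only [ht]; linarith
  have htl : Tendsto t atTop (𝓝 1) := by
    have h1 : Tendsto (fun n : ℕ => 1 / ((n + 2 : ℕ) : ℝ)) atTop (𝓝 0) :=
      (tendsto_one_div_atTop_nhds_zero_nat (𝕜 := ℝ)).comp (tendsto_add_atTop_nat 2)
    have h2 := (tendsto_const_nhds (x := (1:ℝ))).sub h1
    rw [sub_zero] at h2
    exact h2
  have hst : ∀ n, IsStableGelfandSolution Ω (t n * lamStar) (t n * muStar) (u (n + 2)) (v (n + 2)) :=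
    fun n => hs (n + 2) (by omega)
  have hln : ∀ n, 0 < t n * lamStar := fun n => mul_pos (ht0 n) hl
  have hmn : ∀ n, 0 < t n * muStar := fun n => mul_pos (ht0 n) hm
  set E := lamStar + muStar + lamStar / muStar + muStar / lamStar with hE
  have e1 : 0 < lamStar / muStar := by positivity
  have e2 : 0 < muStar / lamStar := by positivity
  have hE0 : 0 < E := by positivity
  have hlE : ∀ n, t n * lamStar ≤ E := fun n => by
    have := mul_le_of_le_one_left hl.le (ht1 n)
    linarith
  have hmE : ∀ n, t n * muStar ≤ E := fun n => by
    have := mul_le_of_le_one_left hm.le (ht1 n)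
    linarith
  obtain ⟨C, hC⟩ := part_one hN hN3 ho hb E hE0
  have hnn : ∀ n, (∀ x ∈ Ω, 0 ≤ u (n + 2) x) ∧ ∀ x ∈ Ω, 0 ≤ v (n + 2) x :=
    fun n => gelfand_nonneg hN ho hb (hln n).le (hmn n).le (hst n).1
  have hbd : ∀ n, ∀ x ∈ Ω, u (n + 2) x + v (n + 2) x ≤ C := by
    intro n x hx
    refine hC _ _ (hln n) (hmn n) (hlE n) (hmE n) ?_ _ _ (hst n) x hx x hx
    rw [mul_div_mul_left _ _ (ht0 n).ne', mul_div_mul_left _ _ (ht0 n).ne']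
    linarith
  choose q hq using fun n => to_sol (C := C) hN ho (hln n).le (hlE n) (hmn n).le (hmE n) (hst n).1
    (fun x hx => by linarith [hbd n x hx, (hnn n).2 x hx]) (fun x hx => by linarith [hbd n x hx, (hnn n).1 x hx])
  obtain ⟨L, r⟩ := to_ref hN hb (hq 0) (hmn 0) (hnn 0).2
  have tl : Tendsto (fun n => t n * lamStar) atTop (𝓝 lamStar) := by simpa using htl.mul_const lamStar
  have tm : Tendsto (fun n => t n * muStar) atTop (𝓝 muStar) := by simpa using htl.mul_const muStar
  have mu' : ∀ x ∈ closure Ω, Monotone fun n => u (n + 2) x := fun x hx a b hab => hum x hx (by omega)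
  have mv' : ∀ x ∈ closure Ω, Monotone fun n => v (n + 2) x := fun x hx a b hab => hvm x hx (by omega)
  have hu' : ∀ x ∈ closure Ω, Tendsto (fun n => u (n + 2) x) atTop (𝓝 (uStar x)) :=
    fun x hx => (hu x hx).comp (tendsto_add_atTop_nat 2)
  have hv' : ∀ x ∈ closure Ω, Tendsto (fun n => v (n + 2) x) atTop (𝓝 (vStar x)) :=
    fun x hx => (hv x hx).comp (tendsto_add_atTop_nat 2)
  obtain ⟨a1, a2, a3⟩ := r.seq_limit hE0.le hq tl tm mu' mv' hu' hv'
  obtain ⟨b1, b2, b3⟩ := r.seq_limit hE0.le (fun n => (hq n).symm) tm tl mv' mu' hv' hu'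
  obtain ⟨c1, c2⟩ := gelfand_smooth hN ho (a1.mono subset_closure) (b1.mono subset_closure) a2 b2
  exact ⟨c1, c2, a1, b1, a2, b2, a3, b3⟩

end LP11

/-- **Step 1: `1 ≤ N ≤ 3`.** Uniform a priori bound: for every `Λ > 0` there is
`C = C(Ω, Λ)` bounding `sup_Ω u + sup_Ω v` over all stable classical solutions with parameters
`λ, μ ∈ (0, Λ]` and `λ/μ + μ/λ ≤ Λ`. Consequently, extremal solutions (increasing pointwise
limits of stable solutions along parameters `(1 − 1/n)(λ*, μ*)`) are smooth for `1 ≤ N ≤ 3`. -/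
theorem low_dimensional_bound_and_regularity {N : ℕ} (hN1 : 1 ≤ N) (hN3 : N ≤ 3)
    (Ω : Set (EuclideanSpace ℝ (Fin N))) (hΩ : IsBoundedDomain Ω) :
    (∀ Λ : ℝ, 0 < Λ → ∃ C : ℝ,
      ∀ (lam mu : ℝ), 0 < lam → 0 < mu → lam ≤ Λ → mu ≤ Λ →
        lam / mu + mu / lam ≤ Λ →
        ∀ (u v : EuclideanSpace ℝ (Fin N) → ℝ),
          IsStableGelfandSolution Ω lam mu u v →
          ∀ x ∈ Ω, ∀ y ∈ Ω, u x + v y ≤ C) ∧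
    (∀ (lamStar muStar : ℝ), 0 < lamStar → 0 < muStar →
      ∀ (u v : ℕ → EuclideanSpace ℝ (Fin N) → ℝ)
        (uStar vStar : EuclideanSpace ℝ (Fin N) → ℝ),
        (∀ n : ℕ, 1 ≤ n →
          IsStableGelfandSolution Ω ((1 - 1 / (n : ℝ)) * lamStar)
            ((1 - 1 / (n : ℝ)) * muStar) (u n) (v n)) →
        (∀ x ∈ closure Ω, Monotone fun n => u n x) →
        (∀ x ∈ closure Ω, Monotone fun n => v n x) →
        (∀ x ∈ closure Ω,
          Filter.Tendsto (fun n => u n x) Filter.atTop (nhds (uStar x))) →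
        (∀ x ∈ closure Ω,
          Filter.Tendsto (fun n => v n x) Filter.atTop (nhds (vStar x))) →
        ContDiffOn ℝ (⊤ : ℕ∞) uStar Ω ∧ ContDiffOn ℝ (⊤ : ℕ∞) vStar Ω ∧
          IsGelfandSolution Ω lamStar muStar uStar vStar) := by
  exact ⟨part_one hN1 hN3 hΩ.1 hΩ.2.2, part_two hN1 hN3 hΩ.1 hΩ.2.2⟩
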